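/- arXiv:2006.13388 — 2 statements merged into one kernel-verified Lean document; each statement's English description precedes it below -/
import Mathlib

section
/- For l ≥ 2 and n ≥ 0, the 2-enumeration of (2n+2, l)-alternating sign trapezoids equals 2^{n+1} · ∏_{1 ≤ i ≤ j ≤ n} (2(i+j) + l - 3)/(2i - 1) · ∏_{1 ≤ i ≤ j ≤ n+1} (2(i+j) + l - 3)/(2i - 1). -/
/-- An `(n,l)`-alternating sign trapezoid (for `l ≥ 2`): a trapezoidal array of `-1`s, `0`s
and `1`s with `n` rows, the top row having `2n+l-2` entries and each subsequent row two fewer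
entries centred below.  Rows are indexed by `0 ≤ i < n` and columns by `0 ≤ j < 2n+l-2`; the
entry `a i j` sits in row `i`, column `j`, and row `i` occupies columns `i ≤ j ≤ 2n+l-3-i`
(entries outside the trapezoid are `0`).  Conditions: the nonzero entries alternate in sign
along each row and each column, the topmost nonzero entry of each column is `1`, each row sums
to `1`, and each of the `l-2` central columns (columns `n ≤ j ≤ n+l-3`) sums to `0`. -/
structure AST (n l : ℕ) where
  a : ℕ → ℕ → ℤ
  entries : ∀ i j, a i j = -1 ∨ a i j = 0 ∨ a i j = 1
  outside : ∀ i j, (n ≤ i ∨ j < i ∨ 2 * n + l - 3 - i < j) → a i j = 0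
  row_sum : ∀ i, i < n → ∑ j ∈ Finset.range (2 * n + l - 2), a i j = 1
  row_alt : ∀ i j₁ j₂, j₁ < j₂ → a i j₁ ≠ 0 → a i j₂ ≠ 0 →
    (∀ j', j₁ < j' → j' < j₂ → a i j' = 0) → a i j₂ = -a i j₁
  col_alt : ∀ j i₁ i₂, i₁ < i₂ → a i₁ j ≠ 0 → a i₂ j ≠ 0 →
    (∀ i', i₁ < i' → i' < i₂ → a i' j = 0) → a i₂ j = -a i₁ j
  col_top : ∀ i j, a i j ≠ 0 → (∀ i', i' < i → a i' j = 0) → a i j = 1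
  central_sum : ∀ j, n ≤ j → j < n + l - 2 → ∑ i ∈ Finset.range n, a i j = 0

variable {n l : ℕ}

/-- The sum of the entries of column `j`. -/
def colSum (A : AST n l) (j : ℕ) : ℤ := ∑ i ∈ Finset.range n, A.a i j

/-- The row index of the bottom entry of column `j`. -/
def botRow (n l j : ℕ) : ℕ := min j (min (2 * n + l - 3 - j) (n - 1))

/-- Column `j` is a `1`-column: its entries sum to `1`. -/
def IsOneCol (A : AST n l) (j : ℕ) : Prop := colSum A j = 1

/-- Column `j` is a `10`-column: a `1`-column whose bottom entry is `0`. -/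
def IsTenCol (A : AST n l) (j : ℕ) : Prop := colSum A j = 1 ∧ A.a (botRow n l j) j = 0

/-- `q(A)`: the number of `-1`s in `A`. -/
def qStat (A : AST n l) : ℕ :=
  ∑ i ∈ Finset.range n, ∑ j ∈ Finset.range (2 * n + l - 2), if A.a i j = -1 then 1 else 0

/-- `r(A)`: the number of `1`-columns among the `n` leftmost columns. -/
def rStat (A : AST n l) : ℕ :=
  ((Finset.range n).filter fun j => colSum A j = 1).card

/-- `s(A)`: the number of `10`-columns among the `n` leftmost columns. -/
def sStat (A : AST n l) : ℕ :=
  ((Finset.range n).filter fun j => colSum A j = 1 ∧ A.a (botRow n l j) j = 0).card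

/-- `t(A)`: the number of `10`-columns among the `n` rightmost columns. -/
def tStat (A : AST n l) : ℕ :=
  ((Finset.Ico (n + l - 2) (2 * n + l - 2)).filter
    fun j => colSum A j = 1 ∧ A.a (botRow n l j) j = 0).card



namespace ASTProof

open PowerSeries

/-- Coefficients of `((1+x)/(1-x))^t` as polynomials in `t`. -/
noncomputable def fpoly : ℕ → Polynomial ℚ
  | 0 => 1
  | 1 => 2 * Polynomial.X
  | (k + 2) => Polynomial.C (1 / ((k : ℚ) + 2)) *
      (2 * Polynomial.X * fpoly (k + 1) + (k : Polynomial ℚ) * fpoly k)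

/-- The power series `((1+x)/(1-x))^t`. -/
noncomputable def pw (t : ℚ) : PowerSeries ℚ := PowerSeries.mk fun a => (fpoly a).eval t

lemma ode_iff (t : ℚ) (y : PowerSeries ℚ) :
    (1 - X ^ 2) * derivative ℚ y = C (2 * t) * y ↔
      (coeff 1 y = 2 * t * coeff 0 y ∧
        ∀ k : ℕ, ((k : ℚ) + 2) * coeff (k + 2) y = 2 * t * coeff (k + 1) y + k * coeff k y) := by
  have h0 : coeff 0 ((1 - X ^ 2) * derivative ℚ y) = coeff 1 y := by
    rw [sub_mul, map_sub, one_mul, coeff_derivative, coeff_X_pow_mul']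
    simp
  have h1 : coeff 1 ((1 - X ^ 2) * derivative ℚ y) = 2 * coeff 2 y := by
    rw [sub_mul, map_sub, one_mul, coeff_derivative, coeff_X_pow_mul']
    simp; ring
  have h2 : ∀ k, coeff (k + 2) ((1 - X ^ 2) * derivative ℚ y) =
      ((k : ℚ) + 3) * coeff (k + 3) y - (k + 1) * coeff (k + 1) y := by
    intro k
    rw [sub_mul, map_sub, one_mul, coeff_derivative, coeff_X_pow_mul', coeff_derivative]
    simp; ring
  constructor
  · intro h
    refine ⟨?_, ?_⟩
    · rw [← h0, h, coeff_C_mul]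
    · intro k
      rcases k with _ | k
      · have := h1; rw [h, coeff_C_mul] at this
        simp; linarith
      · have := h2 k; rw [h, coeff_C_mul] at this
        push_cast
        have e : k + 1 + 2 = k + 3 := rfl
        have e' : k + 1 + 1 = k + 2 := rfl
        rw [e, e']
        linarith
  · rintro ⟨ha, hb⟩
    ext k
    rw [coeff_C_mul]
    rcases k with _ | _ | k
    · rw [h0, ha]
    · rw [zero_add, h1]; have := hb 0; simp at this; linarith
    · have e : k + 1 + 1 = k + 2 := rfl
      rw [e, h2]
      have := hb (k + 1)
      push_cast at this
      have e : k + 1 + 2 = k + 3 := rfl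
      have e' : k + 1 + 1 = k + 2 := rfl
      rw [e, e'] at this
      linarith

lemma pw_rec (t : ℚ) : coeff 1 (pw t) = 2 * t * coeff 0 (pw t) ∧
        ∀ k : ℕ, ((k : ℚ) + 2) * coeff (k + 2) (pw t) =
          2 * t * coeff (k + 1) (pw t) + k * coeff k (pw t) := by
  refine ⟨by simp [pw, fpoly], ?_⟩
  intro k
  have : (k : ℚ) + 2 ≠ 0 := by positivity
  simp only [pw, coeff_mk, fpoly]
  simp
  field_simp

lemma coeff_zero_pw (t : ℚ) : coeff 0 (pw t) = 1 := by simp [pw, fpoly]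

lemma pw_ode (t : ℚ) : (1 - X ^ 2) * derivative ℚ (pw t) = C (2 * t) * pw t :=
  (ode_iff t _).2 (pw_rec t)

lemma pw_unique (t : ℚ) (y : PowerSeries ℚ) (h0 : coeff 0 y = 1)
    (h : (1 - X ^ 2) * derivative ℚ y = C (2 * t) * y) : y = pw t := by
  obtain ⟨h1, h2⟩ := (ode_iff t y).1 h
  obtain ⟨g1, g2⟩ := pw_rec t
  have g0 := coeff_zero_pw t
  have key : ∀ k, coeff k y = coeff k (pw t) ∧ coeff (k + 1) y = coeff (k + 1) (pw t) := by
    intro k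
    induction k with
    | zero => rw [h0, g0]; refine ⟨rfl, ?_⟩; rw [zero_add, h1, g1, h0, g0]
    | succ k ih =>
      refine ⟨ih.2, ?_⟩
      have a := h2 k
      have b := g2 k
      rw [ih.1, ih.2, ← b] at a
      have : (k : ℚ) + 2 ≠ 0 := by positivity
      exact mul_left_cancel₀ this a
  ext k
  exact (key k).1

lemma pw_zero : pw 0 = 1 := by
  symm
  apply pw_unique
  · simp
  · simp

lemma pw_add (s t : ℚ) : pw (s + t) = pw s * pw t := by
  symm
  apply pw_unique
  · have hs := coeff_zero_pw s
    have ht := coeff_zero_pw t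
    rw [coeff_zero_eq_constantCoeff_apply] at *
    rw [map_mul, hs, ht, one_mul]
  · rw [Derivation.leibniz, smul_eq_mul, smul_eq_mul, mul_add]
    have hs := pw_ode s
    have ht := pw_ode t
    have : (C (2 * (s + t)) : PowerSeries ℚ) = C (2 * s) + C (2 * t) := by
      rw [← map_add]; congr 1; ring
    rw [this]
    linear_combination pw s * ht + pw t * hs

lemma pw_one_mul : (1 - X) * pw 1 = 1 + X := by
  have : (1 - X : PowerSeries ℚ) * pw 1 = (1 - X) * ((1 + X) * (1 - X)⁻¹) := by
    congr 1
    symm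
    have hx : (1 - X : PowerSeries ℚ) * (1 - X)⁻¹ = 1 := PowerSeries.mul_inv_cancel _ (by simp)
    apply pw_unique
    · simp
    · rw [Derivation.leibniz, smul_eq_mul, smul_eq_mul]
      have hd : derivative ℚ ((1 - X : PowerSeries ℚ)⁻¹) = ((1 - X)⁻¹) ^ 2 := by
        rw [PowerSeries.derivative_inv']
        simp
      rw [hd]
      simp
      have c2 : (C 2 : PowerSeries ℚ) = 2 := rfl
      rw [c2]
      generalize (1 - X : PowerSeries ℚ)⁻¹ = z at *
      linear_combination ((1 + X) ^ 2 * z) * hx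
  rw [this, mul_left_comm, PowerSeries.mul_inv_cancel _ (by simp), mul_one]

lemma pw_evalNeg (t : ℚ) : evalNegHom (pw t) = pw (-t) := by
  apply pw_unique
  · simp [evalNegHom, coeff_rescale, coeff_zero_pw]
  · rw [ode_iff]
    obtain ⟨g1, g2⟩ := pw_rec t
    simp only [evalNegHom, coeff_rescale]
    refine ⟨?_, ?_⟩
    · rw [g1]; ring
    · intro k
      have := g2 k
      rw [pow_succ, pow_succ]
      linear_combination ((-1) ^ k : ℚ) * this

end ASTProof


namespace ASTProof

/-- The ambient exterior algebra. -/
abbrev Lam := ExteriorAlgebra ℚ (ℕ → ℚ)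

/-- Inclusion of vectors. -/
noncomputable def ev : (ℕ → ℚ) →ₗ[ℚ] Lam := ExteriorAlgebra.ι ℚ

/-- Contraction with the `a`-th coordinate functional. -/
noncomputable def dd (a : ℕ) : Lam →ₗ[ℚ] Lam :=
  CliffordAlgebra.contractLeft (Q := (0 : QuadraticForm ℚ (ℕ → ℚ))) (LinearMap.proj a)

/-- Grade involution. -/
noncomputable def sg : Lam →ₐ[ℚ] Lam :=
  CliffordAlgebra.involute (Q := (0 : QuadraticForm ℚ (ℕ → ℚ)))

/-- Scalar part. -/
noncomputable def scal : Lam →ₐ[ℚ] ℚ := ExteriorAlgebra.algebraMapInv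

lemma ev_sq (v : ℕ → ℚ) : ev v * ev v = 0 := ExteriorAlgebra.ι_sq_zero v

lemma ev_swap (v w : ℕ → ℚ) : ev v * ev w = - (ev w * ev v) :=
  eq_neg_of_add_eq_zero_left (ExteriorAlgebra.ι_add_mul_swap v w)

lemma sg_ev (v : ℕ → ℚ) : sg (ev v) = - ev v := CliffordAlgebra.involute_ι v

lemma scal_ev (v : ℕ → ℚ) : scal (ev v) = 0 := by
  simp [scal, ev, ExteriorAlgebra.algebraMapInv]

lemma lam_induction {P : Lam → Prop} (h1 : ∀ r : ℚ, P (algebraMap ℚ Lam r))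
    (h2 : ∀ x y, P x → P y → P (x + y)) (h3 : ∀ x v, P x → P (ev v * x)) : ∀ x, P x :=
  CliffordAlgebra.left_induction _ h1 h2 h3

lemma dd_ev_mul (a : ℕ) (v : ℕ → ℚ) (x : Lam) : dd a (ev v * x) = v a • x - ev v * dd a x :=
  CliffordAlgebra.contractLeft_ι_mul _ _ _

lemma dd_algebraMap (a : ℕ) (r : ℚ) : dd a (algebraMap ℚ Lam r) = 0 :=
  CliffordAlgebra.contractLeft_algebraMap _ _ _

lemma dd_one (a : ℕ) : dd a (1 : Lam) = 0 := CliffordAlgebra.contractLeft_one _ _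

lemma dd_ev (a : ℕ) (v : ℕ → ℚ) : dd a (ev v) = algebraMap ℚ Lam (v a) :=
  CliffordAlgebra.contractLeft_ι _ _ _

lemma dd_comm (a b : ℕ) (x : Lam) : dd a (dd b x) = - dd b (dd a x) :=
  CliffordAlgebra.contractLeft_comm _ _ _

lemma dd_mul (a : ℕ) (x y : Lam) : dd a (x * y) = dd a x * y + sg x * dd a y := by
  induction x using lam_induction with
  | h1 r => 
    rw [dd_algebraMap, zero_mul, zero_add, AlgHom.commutes, ← Algebra.smul_def, ← Algebra.smul_def,
      map_smul]
  | h2 x z hx hz => rw [add_mul, map_add, map_add, map_add, hx, hz, add_mul, add_mul]; abel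
  | h3 x v hx =>
    rw [mul_assoc, dd_ev_mul, hx, dd_ev_mul, map_mul, sg_ev, sub_mul, mul_add, smul_mul_assoc,
      neg_mul, neg_mul]
    simp only [mul_assoc]
    abel

lemma dd_mul_ev (a : ℕ) (x : Lam) (v : ℕ → ℚ) : dd a (x * ev v) = dd a x * ev v + v a • sg x := by
  rw [dd_mul, dd_ev, ← Algebra.commutes, Algebra.smul_def]

lemma sg_dd (a : ℕ) (x : Lam) : sg (dd a x) = - dd a (sg x) := by
  induction x using lam_induction with
  | h1 r => simp [dd_algebraMap]
  | h2 x z hx hz => simp only [map_add, hx, hz]; abel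
  | h3 x v hx =>
    rw [dd_ev_mul, map_sub, map_smul, map_mul, map_mul, sg_ev, neg_mul, neg_mul, map_neg,
      dd_ev_mul, hx, mul_neg]
    abel

lemma scal_sg (x : Lam) : scal (sg x) = scal x := by
  induction x using lam_induction with
  | h1 r => simp
  | h2 x z hx hz => simp only [map_add, hx, hz]
  | h3 x v hx => simp [sg_ev, scal_ev]

/-- `vol i` extracts the coefficient of `e_{i-1} ∧ ... ∧ e_0`. -/
noncomputable def vol : ℕ → Lam →ₗ[ℚ] ℚ
  | 0 => scal.toLinearMap
  | (i + 1) => (vol i) ∘ₗ (dd i)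

lemma vol_succ (i : ℕ) (x : Lam) : vol (i + 1) x = vol i (dd i x) := rfl

lemma vol_sg (i : ℕ) (x : Lam) : vol i (sg x) = (-1) ^ i * vol i x := by
  induction i generalizing x with
  | zero => simp [vol, scal_sg]
  | succ i ih =>
    rw [vol_succ, vol_succ]
    have : dd i (sg x) = - sg (dd i x) := by rw [sg_dd, neg_neg]
    rw [this, map_neg, ih]; ring

lemma vol_eq_zero (i a : ℕ) (ha : a < i) (x : Lam) (hx : dd a x = 0) : vol i x = 0 := by
  induction i generalizing x with
  | zero => omega
  | succ i ih =>
    rw [vol_succ]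
    rcases Nat.lt_succ_iff_lt_or_eq.1 ha with h | h
    · apply ih h; rw [dd_comm, hx]; simp
    · subst h; rw [hx]; simp

/-- ordered wedge product of the vectors `v j`, `j ∈ S`, `j < k`. -/
noncomputable def wedge (v : ℕ → ℕ → ℚ) (S : Finset ℕ) : ℕ → Lam
  | 0 => 1
  | (k + 1) => wedge v S k * (if k ∈ S then ev (v k) else 1)

/-- One-row automaton weights: `wt lo hi S T k h` is the weight of the first `k` columns
ending with partial row sum `0` (`h = false`) or `1` (`h = true`); the window is `[lo, hi]`. -/
def wt (lo hi : ℕ) (S T : Finset ℕ) : ℕ → Bool → ℚ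
  | 0, h => if h then 0 else 1
  | (k + 1), h =>
    if k ∈ S then
      if k ∈ T then wt lo hi S T k h
      else if lo ≤ k ∧ k ≤ hi then (if h then 0 else 2 * wt lo hi S T k true) else 0
    else
      if k ∈ T then
        if lo ≤ k ∧ k ≤ hi then (if h then wt lo hi S T k false else 0) else 0
      else wt lo hi S T k h

lemma wedge_congr (v : ℕ → ℕ → ℚ) (S S' : Finset ℕ) (k : ℕ) (h : ∀ j < k, (j ∈ S ↔ j ∈ S')) :
    wedge v S k = wedge v S' k := by
  induction k with
  | zero => rfl
  | succ k ih =>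
    simp only [wedge, h k (Nat.lt_succ_self k)]
    rw [ih fun j hj => h j (by omega)]

lemma wt_congr (lo hi : ℕ) (S S' T : Finset ℕ) (k : ℕ) (h : ∀ j < k, (j ∈ S ↔ j ∈ S')) (b : Bool) :
    wt lo hi S T k b = wt lo hi S' T k b := by
  induction k generalizing b with
  | zero => rfl
  | succ k ih =>
    have := ih fun j hj => h j (by omega)
    simp only [wt, h k (Nat.lt_succ_self k), this]

/-- The row-sum of weighted wedges. -/
noncomputable def rowSum (v : ℕ → ℕ → ℚ) (lo hi : ℕ) (T : Finset ℕ) (k : ℕ) (h : Bool) : Lam :=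
  ∑ S ∈ (Finset.range k).powerset, wt lo hi S T k h • wedge v S k

lemma rowSum_succ (v : ℕ → ℕ → ℚ) (lo hi : ℕ) (T : Finset ℕ) (k : ℕ) (h : Bool) :
    rowSum v lo hi T (k + 1) h =
      if k ∈ T then
        (if lo ≤ k ∧ k ≤ hi then (if h then rowSum v lo hi T k false else 0) else 0)
          + rowSum v lo hi T k h * ev (v k)
      else rowSum v lo hi T k h +
        (if lo ≤ k ∧ k ≤ hi then (if h then 0 else (2 : ℚ) • (rowSum v lo hi T k true * ev (v k)))
          else 0) := by
  unfold rowSum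
  rw [Finset.range_add_one, Finset.sum_powerset_insert (by simp)]
  have hk : ∀ S ∈ (Finset.range k).powerset, k ∉ S := by
    intro S hS hk
    have := Finset.mem_powerset.1 hS hk
    simp at this
  have e1 : ∀ S ∈ (Finset.range k).powerset, wt lo hi S T (k + 1) h • wedge v S (k + 1) =
      (if k ∈ T then
        if lo ≤ k ∧ k ≤ hi then (if h then wt lo hi S T k false else 0) else 0
      else wt lo hi S T k h) • wedge v S k := by
    intro S hS
    simp [wt, wedge, hk S hS]
  have e2 : ∀ S ∈ (Finset.range k).powerset,
      wt lo hi (insert k S) T (k + 1) h • wedge v (insert k S) (k + 1) =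
      (if k ∈ T then wt lo hi S T k h
      else if lo ≤ k ∧ k ≤ hi then (if h then 0 else 2 * wt lo hi S T k true) else 0)
        • (wedge v S k * ev (v k)) := by
    intro S hS
    have hc : ∀ j < k, (j ∈ insert k S ↔ j ∈ S) := by
      intro j hj
      simp; omega
    simp only [wt, wedge, Finset.mem_insert_self, if_true]
    rw [wedge_congr _ _ _ _ hc, wt_congr _ _ _ _ _ _ hc, wt_congr _ _ _ _ _ _ hc]
  rw [Finset.sum_congr rfl e1, Finset.sum_congr rfl e2]
  by_cases hT : k ∈ T <;> by_cases hw : lo ≤ k ∧ k ≤ hi <;> cases h <;>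
    simp only [hT, hw, if_true, if_false, and_self, Bool.false_eq_true, zero_smul,
      Finset.sum_const_zero, zero_add, add_zero, Finset.sum_mul, smul_mul_assoc, mul_smul,
      ← Finset.smul_sum]

lemma rowSum_low (v v' : ℕ → ℕ → ℚ) (a lo hi : ℕ) (T : Finset ℕ)
    (γ : ℕ → ℕ → ℚ) (hv : ∀ j, v j a = 0) (hlow : ∀ j < lo, v' j = - v j)
    (hγ : γ lo a = 1) (k : ℕ) (hk : k ≤ lo) :
    rowSum v lo hi T k true = dd a (wedge v' T k) ∧
    rowSum v lo hi T k false = dd a (wedge v' T k * ev (γ lo)) := by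
  induction k with
  | zero => simp [rowSum, wt, wedge, dd_one, dd_ev, hγ]
  | succ k ih =>
    obtain ⟨h1, h2⟩ := ih (by omega)
    have hw : ¬ (lo ≤ k ∧ k ≤ hi) := by omega
    have hdv : (v' k) a = 0 := by rw [hlow k (by omega)]; simp [hv]
    have h0 : rowSum v lo hi T k true = 0 := by
      clear hdv hw ih h1 h2
      induction k with
      | zero => simp [rowSum, wt]
      | succ k ih' =>
        rw [rowSum_succ, ih' (by omega)]
        have hw : ¬ (lo ≤ k ∧ k ≤ hi) := by omega
        simp [hw]
    rw [rowSum_succ, rowSum_succ]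
    by_cases hT : k ∈ T
    · simp only [hT, hw, if_true, if_false, zero_add, wedge]
      refine ⟨?_, ?_⟩
      · rw [dd_mul_ev, hdv, zero_smul, add_zero, ← h1, h0]; simp
      · rw [h2, hlow k (by omega), map_neg, mul_neg, neg_mul, mul_assoc, ev_swap, mul_neg, neg_neg,
          ← mul_assoc, dd_mul_ev a (wedge v' T k * ev (γ lo)), hv, zero_smul, add_zero]
    · simp only [hT, hw, if_false, add_zero, wedge, mul_one]
      exact ⟨h1, h2⟩

lemma rowSum_mid (v v' : ℕ → ℕ → ℚ) (a lo hi : ℕ) (T : Finset ℕ)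
    (γ : ℕ → ℕ → ℚ) (hv : ∀ j, v j a = 0) (hlow : ∀ j < lo, v' j = - v j)
    (hγ : ∀ j, γ j a = 1) (hmid : ∀ j, lo ≤ j → j ≤ hi → v' j = γ j + v j)
    (hmid' : ∀ j, lo ≤ j → j ≤ hi → γ (j + 1) = γ j + (2 : ℚ) • v j)
    (k : ℕ) (hk : lo ≤ k) (hk' : k ≤ hi + 1) :
    rowSum v lo hi T k true = dd a (wedge v' T k) ∧
    rowSum v lo hi T k false = dd a (wedge v' T k * ev (γ k)) := by
  induction k, hk using Nat.le_induction with
  | base => exact rowSum_low v v' a lo hi T γ hv hlow (hγ lo) lo le_rfl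
  | succ k hk ih =>
    obtain ⟨h1, h2⟩ := ih (by omega)
    have hw : (lo ≤ k ∧ k ≤ hi) := by omega
    rw [rowSum_succ, rowSum_succ]
    have hva : v' k a = 1 := by rw [hmid k hw.1 hw.2]; simp [hv, hγ]
    rw [dd_mul_ev, hγ, one_smul, ← h1] at h2
    by_cases hT : k ∈ T
    · simp only [hT, hw, if_true, wedge, and_self, Bool.false_eq_true, if_false, zero_add]
      have e1 : dd a (wedge v' T k * ev (v' k)) =
          rowSum v lo hi T k true * ev (γ k) + rowSum v lo hi T k true * ev (v k)
            + sg (wedge v' T k) := by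
        rw [dd_mul_ev, ← h1, hva, one_smul, hmid k hw.1 hw.2, map_add, mul_add]
      refine ⟨?_, ?_⟩
      · rw [e1, h2]; abel
      · rw [dd_mul_ev, e1, hγ, one_smul, h2, hmid' k hw.1 hw.2, map_mul, sg_ev,
          hmid k hw.1 hw.2, map_add, map_add, map_smul]
        generalize rowSum v lo hi T k true = A
        generalize sg (wedge v' T k) = B
        have g1 := ev_sq (γ k)
        have g2 := ev_sq (v k)
        have g3 := ev_swap (v k) (γ k)
        simp only [add_mul, mul_add, mul_assoc, mul_smul_comm, g1, g2, g3, mul_zero,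
          mul_neg]
        module
    · simp only [hT, hw, if_true, wedge, and_self, Bool.false_eq_true, if_false, mul_one, add_zero]
      refine ⟨h1, ?_⟩
      rw [dd_mul_ev, ← h1, hγ, one_smul, h2, hmid' k hw.1 hw.2, map_add, map_smul, mul_add,
        mul_smul_comm]
      abel

lemma rowSum_eq (v v' : ℕ → ℕ → ℚ) (a lo hi : ℕ) (hlh : lo ≤ hi) (T : Finset ℕ)
    (γ : ℕ → ℕ → ℚ) (hv : ∀ j, v j a = 0) (hlow : ∀ j < lo, v' j = - v j)
    (hhigh : ∀ j, hi < j → v' j = v j)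
    (hγ : ∀ j, γ j a = 1) (hmid : ∀ j, lo ≤ j → j ≤ hi → v' j = γ j + v j)
    (hmid' : ∀ j, lo ≤ j → j ≤ hi → γ (j + 1) = γ j + (2 : ℚ) • v j)
    (k : ℕ) (hk : hi + 1 ≤ k) :
    rowSum v lo hi T k true = dd a (wedge v' T k) := by
  induction k, hk using Nat.le_induction with
  | base => exact (rowSum_mid v v' a lo hi T γ hv hlow hγ hmid hmid' _ (by omega) le_rfl).1
  | succ k hk ih =>
    have hw : ¬ (lo ≤ k ∧ k ≤ hi) := by omega
    rw [rowSum_succ]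
    by_cases hT : k ∈ T
    · simp only [hT, hw, if_true, wedge, if_false, zero_add]
      rw [dd_mul_ev, hhigh k (by omega), hv, zero_smul, add_zero, ih]
    · simp only [hT, hw, if_false, add_zero, wedge, mul_one]
      exact ih

/-- Coefficient vector of `((1+x)/(1-x))^t` truncated at level `i`, reversed. -/
noncomputable def gvec (i : ℕ) (t : ℚ) : ℕ → ℚ :=
  fun a => if a < i then PowerSeries.coeff (i - 1 - a) (pw t) else 0

/-- Centred coordinate of a column. -/
noncomputable def ctr (W j : ℕ) : ℚ := (j : ℚ) - (W : ℚ) / 2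

/-- Column vectors after `i` rows. -/
noncomputable def vec (W i j : ℕ) : ℕ → ℚ :=
  if j + 1 < i then (-1 : ℚ) ^ (i - 1 - j) • gvec (j + 1) (ctr W j)
  else if W + 1 < j + i then gvec (W - j + 1) (ctr W j)
  else gvec i (ctr W j)

lemma gvec_step (i : ℕ) (t : ℚ) :
    gvec (i + 1) (t + 1) - gvec i (t + 1) = gvec (i + 1) t + gvec i t := by
  have h1 : (1 - PowerSeries.X) * pw (t + 1) = (1 + PowerSeries.X) * pw t := by
    rw [add_comm t 1, pw_add, ← mul_assoc, pw_one_mul]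
  funext a
  simp only [gvec, Pi.sub_apply, Pi.add_apply]
  by_cases ha : a < i
  · have ha' : a < i + 1 := by omega
    simp only [ha, ha', if_true]
    have := congrArg (PowerSeries.coeff (i - 1 - a + 1)) h1
    rw [sub_mul, add_mul, one_mul, one_mul, map_sub, map_add, PowerSeries.coeff_succ_X_mul,
      PowerSeries.coeff_succ_X_mul] at this
    have e : i + 1 - 1 - a = i - 1 - a + 1 := by omega
    rw [e, this]
  · by_cases hai : a < i + 1
    · have e : i + 1 - 1 - a = 0 := by omega
      simp only [ha, hai, if_true, if_false, e, coeff_zero_pw]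
      norm_num
    · simp [ha, hai]

/-- Transfer recursion. -/
noncomputable def Zt (W : ℕ) : ℕ → Finset ℕ → ℚ
  | 0, S => if S = ∅ then 1 else 0
  | (i + 1), T => ∑ S ∈ (Finset.range (W + 1)).powerset,
      wt i (W - i) S T (W + 1) true * Zt W i S

lemma vec_zero (W i j : ℕ) (hj : j ≤ W) : vec W i j i = 0 := by
  unfold vec
  split_ifs
  · simp [gvec]; omega
  · simp [gvec]; omega
  · simp [gvec]

lemma wedge_zero (W : ℕ) (S : Finset ℕ) (k : ℕ) (hk : k ≤ W + 1) :
    wedge (vec W 0) S k = if ∀ j < k, j ∉ S then 1 else 0 := by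
  induction k with
  | zero => simp [wedge]
  | succ k ih =>
    rw [wedge, ih (by omega)]
    have : vec W 0 k = 0 := by
      have : ¬ (W + 1 < k) := by omega
      funext a
      simp [vec, this, gvec]
    by_cases hT : k ∈ S
    · simp only [hT, if_true, this, map_zero, mul_zero]
      rw [if_neg]
      push Not
      exact ⟨k, by omega, hT⟩
    · simp only [hT, if_false, mul_one]
      congr 1
      apply propext
      constructor
      · intro h j hj
        rcases Nat.lt_succ_iff_lt_or_eq.1 hj with h' | h'
        · exact h j h'
        · rw [h']; exact hT
      · intro h j hj
        exact h j (by omega)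

lemma wedge_vcongr (v v' : ℕ → ℕ → ℚ) (S : Finset ℕ) (k : ℕ) (h : ∀ j < k, v j = v' j) :
    wedge v S k = wedge v' S k := by
  induction k with
  | zero => rfl
  | succ k ih =>
    simp only [wedge, h k (Nat.lt_succ_self k)]
    rw [ih fun j hj => h j (by omega)]

lemma Zt_eq (W i : ℕ) (hi : 2 * i ≤ W + 2) (S : Finset ℕ) (hS : S ⊆ Finset.range (W + 1)) :
    Zt W i S = vol i (wedge (vec W i) S (W + 1)) := by
  induction i generalizing S with
  | zero =>
    rw [wedge_zero _ _ _ le_rfl, Zt]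
    have : (∀ j < W + 1, j ∉ S) ↔ S = ∅ := by
      constructor
      · intro h
        apply Finset.eq_empty_of_forall_notMem
        intro j hj
        exact h j (by simpa using hS hj) hj
      · rintro rfl; simp
    simp only [this]
    split_ifs <;> simp [vol]
  | succ i ih =>
    rw [Zt, vol_succ]
    let v : ℕ → ℕ → ℚ := fun j => if j ≤ W then vec W i j else 0
    let v' : ℕ → ℕ → ℚ := fun j => if j ≤ W then vec W (i + 1) j else 0
    have e : wedge (vec W (i + 1)) S (W + 1) = wedge v' S (W + 1) := by
      apply wedge_vcongr
      intro j hj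
      simp [v', show j ≤ W by omega]
    have key := rowSum_eq v v' i i (W - i) (by omega) S
      (fun j => gvec (i + 1) (ctr W j) - gvec i (ctr W j)) ?_ ?_ ?_ ?_ ?_ ?_ (W + 1) (by omega)
    · rw [e, ← key, rowSum, map_sum]
      apply Finset.sum_congr rfl
      intro T hT
      rw [map_smul, smul_eq_mul, ih (by omega) T (Finset.mem_powerset.1 hT)]
      congr 2
      apply wedge_vcongr
      intro j hj
      simp [v, show j ≤ W by omega]
    · intro j
      simp only [v]
      split_ifs with h
      · exact vec_zero W i j h
      · rfl
    · intro j hj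
      have h1 : j ≤ W := by omega
      simp only [v, v', h1, if_true, vec]
      have h2 : j + 1 < i + 1 := by omega
      simp only [h2, if_true]
      by_cases h3 : j + 1 < i
      · simp only [h3, if_true]
        have : i + 1 - 1 - j = (i - 1 - j) + 1 := by omega
        rw [this, pow_succ, mul_neg_one, neg_smul]
      · have h4 : ¬ (W + 1 < j + i) := by omega
        have h5 : j + 1 = i := by omega
        have h6 : i + 1 - 1 - j = 1 := by omega
        simp only [h4, if_false, h5, h6]
        simp
    · intro j hj
      simp only [v, v']
      split_ifs with h1
      · have h2 : ¬ (j + 1 < i + 1) := by omega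
        have h3 : ¬ (j + 1 < i) := by omega
        have h4 : W + 1 < j + (i + 1) := by omega
        simp only [vec, h2, h3, h4, if_true, if_false]
        split_ifs with h5
        · rfl
        · congr 1; omega
      · rfl
    · intro j
      simp [gvec, coeff_zero_pw]
    · intro j hj hj'
      have h1 : j ≤ W := by omega
      have h2 : ¬ (j + 1 < i + 1) := by omega
      have h3 : ¬ (j + 1 < i) := by omega
      have h4 : ¬ (W + 1 < j + (i + 1)) := by omega
      have h5 : ¬ (W + 1 < j + i) := by omega
      simp only [v, v', h1, vec, h2, h3, h4, h5, if_true, if_false]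
      abel
    · intro j hj hj'
      have h1 : j ≤ W := by omega
      have h3 : ¬ (j + 1 < i) := by omega
      have h5 : ¬ (W + 1 < j + i) := by omega
      simp only [v, h1, if_true, vec, h3, h5, if_false]
      have : ctr W (j + 1) = ctr W j + 1 := by simp [ctr]; ring
      rw [this, gvec_step]
      module

end ASTProof


namespace ASTProof

lemma ev2_central (a b : ℕ → ℚ) (x : Lam) : ev a * ev b * x = x * (ev a * ev b) := by
  induction x using lam_induction with
  | h1 r => exact (Algebra.commutes _ _).symm
  | h2 x z hx hz => rw [mul_add, add_mul, hx, hz]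
  | h3 x v hx =>
    have : ev a * ev b * ev v = ev v * (ev a * ev b) := by
      rw [mul_assoc, ev_swap b v, mul_neg, ← mul_assoc, ev_swap a v, neg_mul, neg_neg, mul_assoc]
    rw [← mul_assoc, this, mul_assoc, hx, mul_assoc]

lemma ev2_sq (a b : ℕ → ℚ) : (ev a * ev b) * (ev a * ev b) = 0 := by
  rw [← mul_assoc, ev2_central, ← mul_assoc, ev_sq, zero_mul, zero_mul]

/-- Products of elementary even factors. -/
noncomputable def eprod (w r : ℕ → ℕ → ℚ) : ℕ → Lam
  | 0 => 1
  | (k + 1) => eprod w r k * (1 + ev (w k) * ev (r k))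

lemma eprod_central (w r : ℕ → ℕ → ℚ) (k : ℕ) (x : Lam) : eprod w r k * x = x * eprod w r k := by
  induction k generalizing x with
  | zero => simp [eprod]
  | succ k ih =>
    rw [eprod, mul_assoc, ih, ← mul_assoc x, ← ih x, mul_assoc (eprod w r k) x, ih (x * _),
      add_mul, mul_add, one_mul, mul_one, ev2_central]

lemma eprod_sg (w r : ℕ → ℕ → ℚ) (k : ℕ) : sg (eprod w r k) = eprod w r k := by
  induction k with
  | zero => simp [eprod]
  | succ k ih => simp [eprod, ih, sg_ev]

lemma exp_sum (w r : ℕ → ℕ → ℚ) (k : ℕ) :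
    IsNilpotent (∑ i ∈ Finset.range k, ev (w i) * ev (r i)) ∧
    IsNilpotent.exp (∑ i ∈ Finset.range k, ev (w i) * ev (r i)) = eprod w r k := by
  induction k with
  | zero => simp [eprod, IsNilpotent.exp_zero]
  | succ k ih =>
    have hn : (ev (w k) * ev (r k)) ^ 2 = 0 := by rw [pow_two, ev2_sq]
    have hn' : IsNilpotent (ev (w k) * ev (r k)) := ⟨2, hn⟩
    have hc : Commute (∑ i ∈ Finset.range k, ev (w i) * ev (r i)) (ev (w k) * ev (r k)) :=
      (ev2_central _ _ _).symm
    rw [Finset.sum_range_succ]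
    refine ⟨hc.isNilpotent_add ih.1 hn', ?_⟩
    rw [IsNilpotent.exp_add_of_commute hc ih.1 hn', ih.2, eprod, IsNilpotent.exp_eq_sum hn]
    simp [Finset.sum_range_succ]

/-- The two-sided recursion. -/
noncomputable def xprod (s r : ℕ → ℕ → ℚ) : ℕ → Lam
  | 0 => 1
  | (k + 1) => (1 + ev (s k - r k)) * xprod s r k * (1 + ev (s k + r k))

/-- the weights `2 s_k + 4 ∑_{j<k} s_j`. -/
noncomputable def wvec (s : ℕ → ℕ → ℚ) (k : ℕ) : ℕ → ℚ :=
  (2 : ℚ) • s k + (4 : ℚ) • ∑ j ∈ Finset.range k, s j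

lemma xprod_eq (s r : ℕ → ℕ → ℚ) (k : ℕ) :
    xprod s r k = eprod (wvec s) r k * (1 + (2 : ℚ) • ev (∑ j ∈ Finset.range k, s j)) := by
  induction k with
  | zero => simp [xprod, eprod]
  | succ k ih =>
    rw [xprod, ih, eprod, ← mul_assoc, ← eprod_central, mul_assoc, mul_assoc, mul_assoc]
    congr 1
    rw [Finset.sum_range_succ, wvec]
    generalize (∑ j ∈ Finset.range k, s j) = t
    simp only [map_add, map_sub, map_smul]
    have g1 := ev_sq (s k)
    have g2 := ev_sq (r k)
    have g3 := ev_sq t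
    have g4 := ev_swap (r k) (s k)
    have g5 := ev_swap t (s k)
    have g6 := ev_swap t (r k)
    generalize ev (s k) = S at *
    generalize ev (r k) = R at *
    generalize ev t = τ at *
    have g4' : ∀ x, R * (S * x) = - (S * (R * x)) := fun x => by
      rw [← mul_assoc, g4, neg_mul, mul_assoc]
    have g5' : ∀ x, τ * (S * x) = - (S * (τ * x)) := fun x => by
      rw [← mul_assoc, g5, neg_mul, mul_assoc]
    have g6' : ∀ x, τ * (R * x) = - (R * (τ * x)) := fun x => by
      rw [← mul_assoc, g6, neg_mul, mul_assoc]
    have g1' : ∀ x, S * (S * x) = 0 := fun x => by rw [← mul_assoc, g1, zero_mul]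
    have g2' : ∀ x, R * (R * x) = 0 := fun x => by rw [← mul_assoc, g2, zero_mul]
    simp only [add_mul, mul_add, sub_mul, mul_sub, one_mul, mul_one, mul_assoc, smul_mul_assoc,
      mul_smul_comm, g1, g2, g3, g4, g5, g6, g4', g5', g6', g1', g2', mul_neg, neg_mul, mul_zero,
      smul_neg, neg_neg, smul_zero]
    module

lemma vol_xprod (s r : ℕ → ℕ → ℚ) (m k : ℕ) (hm : Even m) :
    vol m (xprod s r k) = vol m (eprod (wvec s) r k) := by
  rw [xprod_eq, mul_add, mul_one, map_add]
  have := vol_sg m (eprod (wvec s) r k * (2 : ℚ) • ev (∑ j ∈ Finset.range k, s j))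
  rw [hm.neg_one_pow, map_mul, eprod_sg, map_smul, sg_ev, smul_neg, mul_neg, map_neg] at this
  linarith

/-- product of `e_b q_b` -/
noncomputable def gprod (e q : ℕ → ℕ → ℚ) : ℕ → Lam
  | 0 => 1
  | (k + 1) => gprod e q k * (ev (e k) * ev (q k))

lemma vol_eprod (e q : ℕ → ℕ → ℚ) (m N : ℕ) (hm : 2 * N ≤ m)
    (he : ∀ b, e b = Pi.single (2 * b + 1) 1) (hq : ∀ b c, q b (2 * c + 1) = 0)
    (k : ℕ) (hk : k ≤ N) (Y : Lam) (hY : ∀ b < k, dd (2 * b + 1) Y = 0) :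
    vol m (eprod e q k * Y) = vol m (gprod e q k * Y) := by
  induction k generalizing Y with
  | zero => simp [eprod, gprod]
  | succ k ih =>
    have hdF : ∀ j ≤ k, dd (2 * k + 1) (eprod e q j) = 0 := by
      intro j
      induction j with
      | zero => intro; simp [eprod, dd_one]
      | succ j ihj =>
        intro hj
        have : k ≠ j := by omega
        rw [eprod, dd_mul, ihj (by omega), map_add, dd_one, dd_ev_mul, dd_ev, hq, he]
        simp [Pi.single_apply, this]
    rw [eprod, gprod, mul_assoc, mul_assoc, add_mul, one_mul, mul_add, map_add,
      vol_eq_zero m (2 * k + 1) (by omega) (eprod e q k * Y)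
        (by rw [dd_mul, hdF k le_rfl, hY k (by omega)]; simp), zero_add]
    apply ih (by omega)
    intro b hb
    have : b ≠ k := by omega
    rw [mul_assoc, dd_ev_mul, dd_ev_mul, hq, he, hY b (by omega)]
    simp [Pi.single_apply, this]

/-- product of `k` vectors -/
noncomputable def vprod (q : ℕ → ℕ → ℚ) : ℕ → Lam
  | 0 => 1
  | (k + 1) => vprod q k * ev (q k)

lemma vprod_eq (q : ℕ → ℕ → ℚ) (k : ℕ) :
    vprod q k = ExteriorAlgebra.ιMulti ℚ k (fun i : Fin k => q i) := by
  rw [ExteriorAlgebra.ιMulti_apply]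
  induction k with
  | zero => simp [vprod]
  | succ k ih =>
    rw [List.ofFn_succ', List.concat_eq_append, List.prod_append, vprod, ih]
    simp [ev]

lemma vprod_ev (q : ℕ → ℕ → ℚ) (k : ℕ) (v : ℕ → ℚ) :
    vprod q k * ev v = (-1 : ℚ) ^ k • (ev v * vprod q k) := by
  induction k with
  | zero => simp [vprod]
  | succ k ih =>
    rw [vprod, mul_assoc, ev_swap, mul_neg, ← mul_assoc, ih, pow_succ, mul_neg_one, neg_smul,
      smul_mul_assoc, mul_assoc]

lemma gprod_eq (e q : ℕ → ℕ → ℚ) (k : ℕ) :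
    gprod e q k = (∏ i ∈ Finset.range k, (-1 : ℚ) ^ i) • (vprod e k * vprod q k) := by
  induction k with
  | zero => simp [gprod, vprod]
  | succ k ih =>
    rw [gprod, ih, Finset.prod_range_succ, vprod, vprod, smul_mul_assoc, mul_smul]
    congr 1
    rw [← mul_assoc, mul_assoc (vprod e k), vprod_ev, mul_smul_comm, smul_mul_assoc]
    simp only [mul_assoc]

lemma vol_gprod_one (k : ℕ) :
    vol (2 * k) (gprod (fun b => Pi.single (2 * b + 1) 1) (fun b => Pi.single (2 * b) 1) k) = 1 := by
  induction k with
  | zero => simp [gprod, vol]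
  | succ k ih =>
    have hd : ∀ a, 2 * k ≤ a → ∀ j ≤ k, dd a (gprod (fun b => Pi.single (2 * b + 1) 1)
        (fun b => Pi.single (2 * b) 1) j) = 0 := by
      intro a ha j
      induction j with
      | zero => intro; simp [gprod, dd_one]
      | succ j ihj =>
        intro hj
        have h1 : a ≠ 2 * j + 1 := by omega
        have h2 : a ≠ 2 * j := by omega
        rw [gprod, dd_mul, ihj (by omega), dd_ev_mul, dd_ev]
        simp [h1, h2]
    rw [gprod, ← ev2_central, show 2 * (k + 1) = 2 * k + 1 + 1 by ring, vol_succ, vol_succ,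
      mul_assoc, dd_ev_mul, dd_ev_mul, hd _ (by omega) _ le_rfl]
    simp
    rw [dd_ev_mul, hd _ (by omega) _ le_rfl]
    simpa using ih

lemma vol_gprod (N : ℕ) (q : ℕ → ℕ → ℚ) (hq : ∀ b a, (∀ c < N, a ≠ 2 * c) → q b a = 0) :
    vol (2 * N) (gprod (fun b => Pi.single (2 * b + 1) 1) q N) =
      Matrix.det (Matrix.of fun b c : Fin N => q b (2 * (c : ℕ))) := by
  let emb : (Fin N → ℚ) →ₗ[ℚ] (ℕ → ℚ) :=
    ∑ c : Fin N, (LinearMap.single ℚ (fun _ : ℕ => ℚ) (2 * (c : ℕ))) ∘ₗ (LinearMap.proj c)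
  let φ : Lam →ₗ[ℚ] ℚ := (vol (2 * N)) ∘ₗ
    ((∏ i ∈ Finset.range N, (-1 : ℚ) ^ i) •
      LinearMap.mulLeft ℚ (vprod (fun b => Pi.single (2 * b + 1) 1) N))
  let Ψ : (Fin N → ℚ) [⋀^Fin N]→ₗ[ℚ] ℚ :=
    (φ.compAlternatingMap (ExteriorAlgebra.ιMulti ℚ N)).compLinearMap emb
  have hΨ : ∀ q' : ℕ → ℕ → ℚ, (∀ b a, (∀ c < N, a ≠ 2 * c) → q' b a = 0) →
      vol (2 * N) (gprod (fun b => Pi.single (2 * b + 1) 1) q' N) =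
        Ψ (fun b c => q' b (2 * (c : ℕ))) := by
    intro q' hq'
    rw [gprod_eq, vprod_eq q']
    simp only [Ψ, φ, AlternatingMap.compLinearMap_apply, LinearMap.compAlternatingMap_apply,
      LinearMap.comp_apply, LinearMap.smul_apply, LinearMap.mulLeft_apply]
    congr 4
    funext b
    funext a
    simp only [emb, LinearMap.sum_apply, LinearMap.comp_apply, LinearMap.proj_apply,
      LinearMap.single_apply, Finset.sum_apply]
    by_cases h : ∃ c < N, a = 2 * c
    · obtain ⟨c, hc, rfl⟩ := h
      rw [Finset.sum_eq_single ⟨c, hc⟩]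
      · simp
      · intro d _ hd
        have : 2 * c ≠ 2 * (d : ℕ) := by
          intro h; apply hd; ext; simp; omega
        simp [this]
      · simp
    · push Not at h
      rw [hq' b a h, Finset.sum_eq_zero]
      intro d _
      simp [h d d.2]
  have hdet := AlternatingMap.eq_smul_basis_det (Pi.basisFun ℚ (Fin N)) Ψ
  rw [hΨ q hq, hdet]
  have h1 : Ψ (Pi.basisFun ℚ (Fin N)) = 1 := by
    rw [← vol_gprod_one N, gprod_eq, vprod_eq (fun b => Pi.single (2 * b) 1)]
    simp only [Ψ, φ, AlternatingMap.compLinearMap_apply, LinearMap.compAlternatingMap_apply,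
      LinearMap.comp_apply, LinearMap.smul_apply, LinearMap.mulLeft_apply]
    congr 4
    funext b
    simp only [emb, LinearMap.sum_apply, LinearMap.comp_apply, LinearMap.proj_apply,
      LinearMap.single_apply, Pi.basisFun_apply]
    rw [Finset.sum_eq_single b]
    · simp
    · intro d _ hd
      simp [hd]
    · simp
  rw [h1, one_smul, Pi.basisFun_det]
  rfl

end ASTProof

namespace ASTProof

lemma sum_wedge (v : ℕ → ℕ → ℚ) (ok : ℕ → Prop) [DecidablePred ok] (k : ℕ) :
    ∑ C ∈ ((Finset.range k).filter ok).powerset, wedge v C k =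
      ((List.range k).map fun j => if ok j then 1 + ev (v j) else 1).prod := by
  induction k with
  | zero => simp [wedge]
  | succ k ih =>
    rw [List.range_succ, List.map_append, List.prod_append, ← ih, Finset.range_add_one,
      Finset.filter_insert]
    have hk : k ∉ (Finset.range k).filter ok := by simp
    have h1 : ∀ C ∈ ((Finset.range k).filter ok).powerset, wedge v C (k + 1) = wedge v C k := by
      intro C hC
      have : k ∉ C := fun h => hk (Finset.mem_powerset.1 hC h)
      simp [wedge, this]
    have h2 : ∀ C ∈ ((Finset.range k).filter ok).powerset,
        wedge v (insert k C) (k + 1) = wedge v C k * ev (v k) := by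
      intro C hC
      simp only [wedge, Finset.mem_insert_self, if_true]
      rw [wedge_congr v (insert k C) C k]
      intro j hj
      rw [Finset.mem_insert]
      constructor
      · rintro (h | h)
        · omega
        · exact h
      · exact Or.inr
    split_ifs with h
    · rw [Finset.sum_powerset_insert hk, Finset.sum_congr rfl h1, Finset.sum_congr rfl h2,
        ← Finset.sum_mul]
      simp [h, mul_add]
    · rw [Finset.sum_congr rfl h1]
      simp [h]

/-- Right column vectors. -/
noncomputable def rho (m : ℕ) (t : ℚ) (k a : ℕ) : ℚ :=
  if a + k < m then PowerSeries.coeff (m - 1 - k - a) (pw (t + k)) else 0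

/-- Odd part. -/
noncomputable def sVec (m : ℕ) (t : ℚ) (k a : ℕ) : ℚ := if Odd a then rho m t k a else 0

/-- Even part. -/
noncomputable def rVec (m : ℕ) (t : ℚ) (k a : ℕ) : ℚ := if Odd a then 0 else rho m t k a

lemma coeff_pw_neg (t : ℚ) (a : ℕ) :
    PowerSeries.coeff a (pw (-t)) = (-1) ^ a * PowerSeries.coeff a (pw t) := by
  rw [← pw_evalNeg]
  simp [PowerSeries.evalNegHom, PowerSeries.coeff_rescale]

lemma vec_right (m l k : ℕ) (hl : 2 ≤ l) (hk : k < m) (hm : Even m) :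
    vec (2 * m + l - 3) m (m + l - 2 + k) =
      sVec m (((l : ℚ) - 1) / 2) k + rVec m (((l : ℚ) - 1) / 2) k := by
  have hc : ctr (2 * m + l - 3) (m + l - 2 + k) = ((l : ℚ) - 1) / 2 + k := by
    have h3 : 3 ≤ 2 * m + l := by omega
    have h2 : 2 ≤ m + l := by omega
    rw [ctr, Nat.cast_sub h3]
    push_cast [Nat.cast_sub h2]
    ring
  have : vec (2 * m + l - 3) m (m + l - 2 + k) = gvec (m - k) (((l : ℚ) - 1) / 2 + k) := by
    rw [vec, hc, if_neg (by omega)]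
    split_ifs with h
    · congr 1; omega
    · congr 1; omega
  rw [this]
  funext a
  simp only [gvec, Pi.add_apply, sVec, rVec, rho]
  by_cases h : a + k < m
  · rw [if_pos (by omega), show m - k - 1 - a = m - 1 - k - a by omega]
    split_ifs <;> simp
  · rw [if_neg (by omega)]
    split_ifs <;> simp

lemma vec_left (m l k : ℕ) (hl : 2 ≤ l) (hk : k < m) (hm : Even m) :
    vec (2 * m + l - 3) m (m - 1 - k) =
      sVec m (((l : ℚ) - 1) / 2) k - rVec m (((l : ℚ) - 1) / 2) k := by
  have hc : ctr (2 * m + l - 3) (m - 1 - k) = - (((l : ℚ) - 1) / 2 + k) := by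
    have h3 : 3 ≤ 2 * m + l := by omega
    rw [ctr, Nat.cast_sub h3, Nat.cast_sub (by omega), Nat.cast_sub (by omega)]
    push_cast
    ring
  have : vec (2 * m + l - 3) m (m - 1 - k) =
      (-1 : ℚ) ^ k • gvec (m - k) (-(((l : ℚ) - 1) / 2 + k)) := by
    rw [vec, hc]
    split_ifs with h h'
    · rw [show m - 1 - (m - 1 - k) = k by omega, show m - 1 - k + 1 = m - k by omega]
    · omega
    · have : k = 0 := by omega
      subst this; simp
  rw [this]
  funext a
  simp only [gvec, Pi.sub_apply, Pi.smul_apply, sVec, rVec, rho, smul_eq_mul]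
  by_cases h : a + k < m
  · rw [if_pos (by omega), coeff_pw_neg, show m - k - 1 - a = m - 1 - k - a by omega,
      ← mul_assoc, ← pow_add, show k + (m - 1 - k - a) = m - 1 - a by omega]
    simp only [h, if_true]
    by_cases ha : Odd a
    · have : Even (m - 1 - a) := by
        obtain ⟨b, rfl⟩ := hm
        obtain ⟨c, rfl⟩ := ha
        exact ⟨b - c - 1, by omega⟩
      simp [ha, this.neg_one_pow]
    · have : Odd (m - 1 - a) := by
        obtain ⟨b, rfl⟩ := hm
        rw [Nat.not_odd_iff_even] at ha
        obtain ⟨c, rfl⟩ := ha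
        exact ⟨b - c - 1, by omega⟩
      simp [ha, this.neg_one_pow]
  · rw [if_neg (by omega)]
    simp [h]

lemma prod_split (m l : ℕ) (hl : 2 ≤ l) (hm : Even m) (k : ℕ) (hk : k ≤ m) :
    ((List.range' (m - k) k).map fun j => 1 + ev (vec (2 * m + l - 3) m j)).prod *
    ((List.range' (m + l - 2) k).map fun j => 1 + ev (vec (2 * m + l - 3) m j)).prod =
    xprod (sVec m (((l : ℚ) - 1) / 2)) (rVec m (((l : ℚ) - 1) / 2)) k := by
  induction k with
  | zero => simp [xprod]
  | succ k ih =>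
    rw [List.range'_succ, List.range'_concat, List.map_cons, List.map_append, List.prod_cons,
      List.prod_append, show m - (k + 1) + 1 = m - k by omega, xprod, ← ih (by omega), one_mul,
      ← vec_right m l k hl (by omega) hm, ← vec_left m l k hl (by omega) hm,
      show m - 1 - k = m - (k + 1) by omega]
    simp [mul_assoc]

lemma prod_eq_xprod (m l : ℕ) (hl : 2 ≤ l) (hm : Even m) (h0 : 0 < m) :
    ((List.range (2 * m + l - 2)).map fun j =>
      if ¬ (m ≤ j ∧ j < m + l - 2) then 1 + ev (vec (2 * m + l - 3) m j) else 1).prod =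
    xprod (sVec m (((l : ℚ) - 1) / 2)) (rVec m (((l : ℚ) - 1) / 2)) m := by
  have : List.range (2 * m + l - 2) =
      List.range' (m - m) m ++ List.range' m (l - 2) ++ List.range' (m + l - 2) m := by
    rw [List.range_eq_range', show 2 * m + l - 2 = m + (l - 2) + m by omega, Nat.sub_self,
      ← List.range'_append_1, ← List.range'_append_1]
    rw [show 0 + (m + (l - 2)) = m + l - 2 by omega, zero_add]
  rw [this, List.map_append, List.map_append, List.prod_append, List.prod_append,
    ← prod_split m l hl hm m le_rfl]
  have e1 : (List.map (fun j => if ¬ (m ≤ j ∧ j < m + l - 2) then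
      1 + ev (vec (2 * m + l - 3) m j) else 1) (List.range' (m - m) m)) =
      (List.range' (m - m) m).map fun j => 1 + ev (vec (2 * m + l - 3) m j) := by
    apply List.map_congr_left
    intro j hj
    rw [List.mem_range'_1] at hj
    rw [if_pos (by omega)]
  have e2 : (List.map (fun j => if ¬ (m ≤ j ∧ j < m + l - 2) then
      1 + ev (vec (2 * m + l - 3) m j) else 1) (List.range' (m + l - 2) m)) =
      (List.range' (m + l - 2) m).map fun j => 1 + ev (vec (2 * m + l - 3) m j) := by
    apply List.map_congr_left
    intro j hj
    rw [List.mem_range'_1] at hj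
    rw [if_pos (by omega)]
  have e3 : (List.map (fun j => if ¬ (m ≤ j ∧ j < m + l - 2) then
      1 + ev (vec (2 * m + l - 3) m j) else 1) (List.range' m (l - 2))).prod = 1 := by
    apply List.prod_eq_one
    intro x hx
    rw [List.mem_map] at hx
    obtain ⟨j, hj, rfl⟩ := hx
    rw [List.mem_range'_1] at hj
    rw [if_neg (by omega)]
  rw [e1, e2, e3, mul_one]

lemma eprod_congr (N : ℕ) (w r q : ℕ → ℕ → ℚ) (M : ℕ)
    (hw : ∀ k a, (∀ b < N, a ≠ 2 * b + 1) → w k a = 0)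
    (hq : ∀ b, q b = ∑ i ∈ Finset.range M, w i (2 * b + 1) • r i) :
    eprod w r M = eprod (fun b => Pi.single (2 * b + 1) 1) q N := by
  rw [← (exp_sum w r M).2, ← (exp_sum _ q N).2]
  congr 1
  have hwk : ∀ k, w k = ∑ b ∈ Finset.range N, w k (2 * b + 1) • Pi.single (2 * b + 1) (1 : ℚ) := by
    intro k
    funext a
    rw [Finset.sum_apply]
    simp only [Pi.smul_apply, Pi.single_apply, smul_eq_mul, mul_ite, mul_one, mul_zero]
    by_cases h : ∀ b < N, a ≠ 2 * b + 1
    · rw [hw k a h, Finset.sum_eq_zero]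
      intro b hb
      rw [if_neg (h b (Finset.mem_range.1 hb))]
    · push Not at h
      obtain ⟨b, hb, rfl⟩ := h
      rw [Finset.sum_eq_single b]
      · simp
      · intro c _ hc
        rw [if_neg (by omega)]
      · intro h; simp at h; omega
  have : ∀ k, ev (w k) * ev (r k) =
      ∑ b ∈ Finset.range N, ev (Pi.single (2 * b + 1) 1) * ev (w k (2 * b + 1) • r k) := by
    intro k
    conv_lhs => rw [hwk k]
    rw [map_sum, Finset.sum_mul]
    refine Finset.sum_congr rfl fun b _ => ?_
    simp [map_smul]
  rw [Finset.sum_congr rfl fun k _ => this k, Finset.sum_comm]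
  refine Finset.sum_congr rfl fun b _ => ?_
  rw [← Finset.mul_sum, hq, map_sum]

/-- Row functions as polynomials. -/
noncomputable def rp (k a : ℕ) : Polynomial ℚ :=
  if k ≤ a then (fpoly (a - k)).comp (Polynomial.X + Polynomial.C (k : ℚ)) else 0

/-- Kernel. -/
def Kf (k j : ℕ) : ℚ := if j < k then 4 else if j = k then 2 else 0

/-- The matrix. -/
noncomputable def Qp (N : ℕ) : Matrix (Fin N) (Fin N) (Polynomial ℚ) :=
  Matrix.of fun α β => ∑ k ∈ Finset.range (2 * N), ∑ j ∈ Finset.range (2 * N),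
    Polynomial.C (Kf k j) * rp k (2 * (α : ℕ) + 1) * rp j (2 * (β : ℕ))

lemma rp_eval (k a : ℕ) (t : ℚ) : (rp k a).eval t =
    if k ≤ a then PowerSeries.coeff (a - k) (pw (t + k)) else 0 := by
  unfold rp
  split_ifs
  · simp [pw]
  · simp

lemma part_b (N l : ℕ) (hl : 2 ≤ l) (hN : 0 < N) :
    ∑ C ∈ ((Finset.range (2 * (2 * N) + l - 2)).filter
      fun j => ¬ (2 * N ≤ j ∧ j < 2 * N + l - 2)).powerset,
      vol (2 * N) (wedge (vec (2 * (2 * N) + l - 3) (2 * N)) C (2 * (2 * N) + l - 2)) =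
    (Qp N).det.eval (((l : ℚ) - 1) / 2) := by
  rw [← map_sum, sum_wedge, prod_eq_xprod _ _ hl ⟨N, by ring⟩ (by omega),
    vol_xprod _ _ _ _ ⟨N, by ring⟩]
  set t : ℚ := ((l : ℚ) - 1) / 2 with ht
  set q : ℕ → ℕ → ℚ := fun b => ∑ i ∈ Finset.range (2 * N),
    wvec (sVec (2 * N) t) i (2 * b + 1) • rVec (2 * N) t i with hq
  have hw : ∀ k a, (∀ b < N, a ≠ 2 * b + 1) → sVec (2 * N) t k a = 0 := by
    intro k a h
    unfold sVec rho
    split_ifs with h1 h2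
    · obtain ⟨b, rfl⟩ := h1
      exact absurd rfl (h b (by omega))
    · rfl
    · rfl
  rw [eprod_congr N _ _ q (2 * N) ?_ (fun b => rfl)]
  · have h1 := vol_eprod (fun b => Pi.single (2 * b + 1) 1) q (2 * N) N le_rfl (fun b => rfl) ?_
      N le_rfl 1 (fun b _ => dd_one _)
    · rw [mul_one, mul_one] at h1
      rw [h1, vol_gprod]
      · rw [← Polynomial.coe_evalRingHom, RingHom.map_det, ← Matrix.det_transpose,
          ← Matrix.det_submatrix_equiv_self (Fin.revPerm)]
        congr 1
        ext α β
        simp only [Matrix.submatrix_apply, Matrix.transpose_apply, Matrix.of_apply, Qp,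
          RingHom.mapMatrix_apply, Matrix.map_apply, Polynomial.coe_evalRingHom, hq,
          Finset.sum_apply, Pi.smul_apply, smul_eq_mul, Polynomial.eval_finsetSum,
          Polynomial.eval_mul, Polynomial.eval_C, rp_eval, Fin.revPerm_apply, Fin.val_rev]
        refine Finset.sum_congr rfl fun k hk => ?_
        rw [Finset.mem_range] at hk
        have e1 : rVec (2 * N) t k (2 * (N - (α + 1))) =
            if k ≤ 2 * (α : ℕ) + 1 then PowerSeries.coeff (2 * (α : ℕ) + 1 - k) (pw (t + k)) else 0 := by
          have : ¬ Odd (2 * (N - ((α : ℕ) + 1))) := by simp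
          have hα := α.2
          rw [rVec, if_neg this, rho]
          by_cases h : k ≤ 2 * (α : ℕ) + 1
          · rw [if_pos (by omega), if_pos h]
            congr 2; omega
          · rw [if_neg (by omega), if_neg h]
        have e2 : ∀ j, sVec (2 * N) t j (2 * (N - (β + 1)) + 1) =
            if j ≤ 2 * (β : ℕ) then PowerSeries.coeff (2 * (β : ℕ) - j) (pw (t + j)) else 0 := by
          intro j
          have : Odd (2 * (N - ((β : ℕ) + 1)) + 1) := by simp
          have hα := β.2
          rw [sVec, if_pos this, rho]
          by_cases h : j ≤ 2 * (β : ℕ)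
          · rw [if_pos (by omega), if_pos h]
            congr 2; omega
          · rw [if_neg (by omega), if_neg h]
        rw [e1, wvec]
        simp only [Pi.add_apply, Pi.smul_apply, Finset.sum_apply, e2, smul_eq_mul]
        set A := (if k ≤ 2 * (α : ℕ) + 1 then PowerSeries.coeff (2 * (α : ℕ) + 1 - k) (pw (t + k)) else 0)
        set B : ℕ → ℚ := fun j => if j ≤ 2 * (β : ℕ) then PowerSeries.coeff (2 * (β : ℕ) - j) (pw (t + j)) else 0
        change (2 * B k + 4 * ∑ j ∈ Finset.range k, B j) * A =
          ∑ j ∈ Finset.range (2 * N), Kf k j * A * B j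
        have hsub : Finset.range (k + 1) ⊆ Finset.range (2 * N) := by
          intro x; simp only [Finset.mem_range]; omega
        rw [← Finset.sum_subset hsub, Finset.sum_range_succ]
        · have : ∑ j ∈ Finset.range k, Kf k j * A * B j = ∑ j ∈ Finset.range k, 4 * A * B j := by
            refine Finset.sum_congr rfl fun j hj => ?_
            simp [Kf, Finset.mem_range.1 hj]
          rw [this, ← Finset.mul_sum]
          simp [Kf]
          ring
        · intro j _ hj
          simp only [Finset.mem_range] at hj
          have h1 : ¬ j < k := by omega
          have h2 : ¬ j = k := by omega
          simp [Kf, h1, h2]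
      · intro b a h
        simp only [hq, Finset.sum_apply, Pi.smul_apply]
        apply Finset.sum_eq_zero
        intro i _
        have : rVec (2 * N) t i a = 0 := by
          unfold rVec rho
          split_ifs with h1 h2
          · rfl
          · rw [Nat.not_odd_iff_even] at h1
            obtain ⟨c, rfl⟩ := h1
            exact absurd (by ring) (h c (by omega))
          · rfl
        simp [this]
    · intro b c
      simp [hq, Finset.sum_apply, rVec]
  · intro k a h
    simp [wvec, hw _ _ h]

end ASTProof

namespace ASTProof

/-- partial sums -/
def psum (f : ℕ → ℤ) (k : ℕ) : ℤ := ∑ j ∈ Finset.range k, f j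

lemma psum_succ (f : ℕ → ℤ) (k : ℕ) : psum f (k + 1) = psum f k + f k := Finset.sum_range_succ _ _

lemma psum_zero (f : ℕ → ℤ) : psum f 0 = 0 := by simp [psum]

/-- alternation -/
def Alt (f : ℕ → ℤ) : Prop := ∀ j₁ j₂, j₁ < j₂ → f j₁ ≠ 0 → f j₂ ≠ 0 →
    (∀ j', j₁ < j' → j' < j₂ → f j' = 0) → f j₂ = -f j₁

lemma psum_const (f : ℕ → ℤ) (a b : ℕ) (hab : a ≤ b) (h : ∀ j, a ≤ j → j < b → f j = 0) :
    psum f b = psum f a := by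
  induction b, hab using Nat.le_induction with
  | base => rfl
  | succ b hb ih => rw [psum_succ, ih fun j h1 h2 => h j h1 (by omega), h b hb (by omega), add_zero]

lemma psum_of_alt (f : ℕ → ℤ) (he : ∀ j, f j = -1 ∨ f j = 0 ∨ f j = 1) (ha : Alt f)
    (ht : ∀ i, f i ≠ 0 → (∀ i', i' < i → f i' = 0) → f i = 1) (k : ℕ) :
    (psum f k = 0 ∧ ((∀ j < k, f j = 0) ∨
      ∃ j < k, f j = -1 ∧ ∀ j', j < j' → j' < k → f j' = 0)) ∨
    (psum f k = 1 ∧ ∃ j < k, f j = 1 ∧ ∀ j', j < j' → j' < k → f j' = 0) := by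
  induction k with
  | zero => left; simp [psum]
  | succ k ih =>
    rw [psum_succ]
    by_cases h0 : f k = 0
    · rw [h0, add_zero]
      have hx : ∀ j, j < k + 1 → j < k ∨ j = k := fun j h => by omega
      rcases ih with ⟨h1, h2 | ⟨j, h2, h3, h4⟩⟩ | ⟨h1, j, h2, h3, h4⟩
      · left
        refine ⟨h1, Or.inl fun j hj => ?_⟩
        rcases hx j hj with h | rfl
        · exact h2 j h
        · exact h0
      · left
        refine ⟨h1, Or.inr ⟨j, by omega, h3, fun j' h5 h6 => ?_⟩⟩
        rcases hx j' h6 with h | rfl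
        · exact h4 j' h5 h
        · exact h0
      · right
        refine ⟨h1, ⟨j, by omega, h3, fun j' h5 h6 => ?_⟩⟩
        rcases hx j' h6 with h | rfl
        · exact h4 j' h5 h
        · exact h0
    · rcases ih with ⟨h1, h2 | ⟨j, h2, h3, h4⟩⟩ | ⟨h1, j, h2, h3, h4⟩
      · have := ht k h0 h2
        right
        exact ⟨by rw [h1, this]; norm_num, k, by omega, this, fun j' h5 h6 => by omega⟩
      · have := ha j k h2 (by rw [h3]; norm_num) h0 h4
        rw [h3] at this
        right
        exact ⟨by rw [h1, this]; norm_num, k, by omega, by rw [this]; norm_num, fun j' h5 h6 => by omega⟩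
      · have := ha j k h2 (by rw [h3]; norm_num) h0 h4
        rw [h3] at this
        left
        exact ⟨by rw [h1, this]; norm_num, Or.inr ⟨k, by omega, by rw [this], fun j' h5 h6 => by omega⟩⟩

/-- zero-one partial sums -/
def ZO (f : ℕ → ℤ) : Prop := ∀ k, psum f k = 0 ∨ psum f k = 1

lemma zo_of_alt (f : ℕ → ℤ) (he : ∀ j, f j = -1 ∨ f j = 0 ∨ f j = 1) (ha : Alt f)
    (ht : ∀ i, f i ≠ 0 → (∀ i', i' < i → f i' = 0) → f i = 1) : ZO f := fun k =>
  (psum_of_alt f he ha ht k).imp And.left And.left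

lemma zo_of_alt_sum (f : ℕ → ℤ) (he : ∀ j, f j = -1 ∨ f j = 0 ∨ f j = 1) (ha : Alt f)
    (k : ℕ) (hk : psum f k = 1) : ZO f := by
  by_cases hz : ∃ i, f i ≠ 0 
  swap
  · push Not at hz
    simp [psum, hz] at hk
  classical
  rcases he (Nat.find hz) with h | h | h
  · exfalso
    have := zo_of_alt (fun j => - f j) (fun j => by rcases he j with h | h | h <;> simp [h])
      (fun j₁ j₂ h1 h2 h3 h4 => by
        show - f j₂ = - (- f j₁)
        rw [ha j₁ j₂ h1 (by simpa using h2) (by simpa using h3) (by simpa using h4)])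
      (fun i h1 h2 => by
        have : i = Nat.find hz := by
          symm
          rw [Nat.find_eq_iff]
          exact ⟨by simpa using h1, by simpa using h2⟩
        simp only [this, h]; norm_num) k
    have e : psum (fun j => - f j) k = - psum f k := by simp [psum]
    rw [e, hk] at this
    omega
  · exact absurd h (Nat.find_spec hz)
  · apply zo_of_alt f he ha
    intro i h1 h2
    have : i = Nat.find hz := by
      symm
      rw [Nat.find_eq_iff]
      simpa using ⟨h1, h2⟩
    rw [this, h]

lemma zo_entries (f : ℕ → ℤ) (h : ZO f) (j : ℕ) : f j = -1 ∨ f j = 0 ∨ f j = 1 := by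
  have h1 := h j
  have h2 := h (j + 1)
  rw [psum_succ] at h2
  omega

lemma zo_alt (f : ℕ → ℤ) (h : ZO f) : Alt f := by
  intro a b hab ha hb hz
  have h1 := h a
  have h2 := h (a + 1)
  have h3 := h (b + 1)
  have e := psum_const f (a + 1) b hab (fun j h1 h2 => hz j h1 h2)
  rw [psum_succ] at h2 h3
  rw [e, psum_succ] at h3
  omega

lemma zo_top (f : ℕ → ℤ) (h : ZO f) (i : ℕ) (h0 : f i ≠ 0) (hz : ∀ i', i' < i → f i' = 0) :
    f i = 1 := by
  have e := psum_const f 0 i (Nat.zero_le _) (fun j _ h2 => hz j h2)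
  have h2 := h (i + 1)
  rw [psum_succ, e, psum_zero] at h2
  omega

/-- indicator -/
def ind (S : Finset ℕ) (j : ℕ) : ℤ := if j ∈ S then 1 else 0

/-- The row determined by two consecutive states. -/
def brow (S T : Finset ℕ) (j : ℕ) : ℤ := ind T j - ind S j

/-- validity of a row -/
def RowOK (W i : ℕ) (b : ℕ → ℤ) : Prop :=
  (∀ j, (j < i ∨ W - i < j) → b j = 0) ∧ ZO b ∧ psum b (W + 1) = 1

/-- bool to int -/
def bi (h : Bool) : ℤ := if h then 1 else 0

/-- number of minus ones -/
def qrow (b : ℕ → ℤ) (k : ℕ) : ℕ := ∑ j ∈ Finset.range k, if b j = -1 then 1 else 0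

/-- partial validity -/
def PRow (lo hi : ℕ) (b : ℕ → ℤ) (k : ℕ) (h : Bool) : Prop :=
  (∀ j < k, (j < lo ∨ hi < j) → b j = 0) ∧ (∀ j ≤ k, psum b j = 0 ∨ psum b j = 1) ∧
    psum b k = bi h

open Classical in
lemma wt_eq (lo hi : ℕ) (S T : Finset ℕ) (k : ℕ) (h : Bool) :
    wt lo hi S T k h = if PRow lo hi (brow S T) k h then 2 ^ qrow (brow S T) k else 0 := by
  induction k generalizing h with
  | zero =>
    cases h <;> simp [wt, PRow, psum, bi, qrow]
  | succ k ih =>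
    have key : PRow lo hi (brow S T) (k + 1) h ↔
        PRow lo hi (brow S T) k h ∧ brow S T k = 0 ∨
        (lo ≤ k ∧ k ≤ hi) ∧ PRow lo hi (brow S T) k (!h) ∧ brow S T k = bi h - bi (!h) := by
      unfold PRow
      rw [psum_succ]
      constructor
      · rintro ⟨h1, h2, h3⟩
        have h4 := h2 k (by omega)
        by_cases hb : brow S T k = 0
        · left
          refine ⟨⟨fun j hj => h1 j (by omega), fun j hj => h2 j (by omega), by omega⟩, hb⟩
        · right
          have hx : psum (brow S T) k = bi (!h) := by
            cases h <;> simp [bi] at * <;> omega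
          refine ⟨?_, ⟨fun j hj => h1 j (by omega), fun j hj => h2 j (by omega), hx⟩, by omega⟩
          by_contra hc
          exact hb (h1 k (by omega) (by omega))
      · have hbi : bi h = 0 ∨ bi h = 1 := by cases h <;> simp [bi]
        rintro (⟨⟨h1, h2, h3⟩, h4⟩ | ⟨h0, ⟨h1, h2, h3⟩, h4⟩)
        · refine ⟨fun j hj hj' => ?_, fun j hj => ?_, by omega⟩
          · rcases Nat.lt_succ_iff_lt_or_eq.1 hj with h | rfl
            · exact h1 j h hj'
            · exact h4
          · rcases Nat.le_succ_iff.1 hj with h | rfl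
            · exact h2 j h
            · rw [psum_succ]; omega
        · refine ⟨fun j hj hj' => ?_, fun j hj => ?_, by omega⟩
          · rcases Nat.lt_succ_iff_lt_or_eq.1 hj with h | rfl
            · exact h1 j h hj'
            · omega
          · rcases Nat.le_succ_iff.1 hj with h | rfl
            · exact h2 j h
            · rw [psum_succ]; omega
    have hq : qrow (brow S T) (k + 1) = qrow (brow S T) k + if brow S T k = -1 then 1 else 0 :=
      Finset.sum_range_succ _ _
    rw [wt, hq]
    simp only [ih, key]
    by_cases hS : k ∈ S <;> by_cases hT : k ∈ T
    · have : brow S T k = 0 := by simp [brow, ind, hS, hT]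
      have h2 : bi h - bi (!h) ≠ 0 := by cases h <;> simp [bi]
      simp [hS, hT, this, h2.symm]
    · have : brow S T k = -1 := by simp [brow, ind, hS, hT]
      cases h <;> by_cases hw : lo ≤ k ∧ k ≤ hi <;> simp [hS, hT, this, bi, hw, pow_succ, mul_comm]
    · have : brow S T k = 1 := by simp [brow, ind, hS, hT]
      cases h <;> by_cases hw : lo ≤ k ∧ k ≤ hi <;> simp [hS, hT, this, bi, hw]
    · have : brow S T k = 0 := by simp [brow, ind, hS, hT]
      have h2 : bi h - bi (!h) ≠ 0 := by cases h <;> simp [bi]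
      simp [hS, hT, this, h2.symm]

lemma brow_out (W : ℕ) (S T : Finset ℕ) (hS : S ⊆ Finset.range (W + 1))
    (hT : T ⊆ Finset.range (W + 1)) (j : ℕ) (hj : W < j) : brow S T j = 0 := by
  have h1 : j ∉ S := fun h => by have := hS h; simp at this; omega
  have h2 : j ∉ T := fun h => by have := hT h; simp at this; omega
  simp [brow, ind, h1, h2]

open Classical in
lemma wt_true (W i : ℕ) (S T : Finset ℕ) (hS : S ⊆ Finset.range (W + 1))
    (hT : T ⊆ Finset.range (W + 1)) :
    wt i (W - i) S T (W + 1) true =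
      if RowOK W i (brow S T) then 2 ^ qrow (brow S T) (W + 1) else 0 := by
  rw [wt_eq]
  congr 1
  apply propext
  constructor
  · rintro ⟨h1, h2, h3⟩
    refine ⟨fun j hj => ?_, fun k => ?_, h3⟩
    · by_cases h : j < W + 1
      · exact h1 j h hj
      · exact brow_out W S T hS hT j (by omega)
    · by_cases h : k ≤ W + 1
      · exact h2 k h
      · rw [psum_const _ (W + 1) k (by omega)
          (fun j h4 _ => brow_out W S T hS hT j (by omega))]
        exact h2 _ le_rfl
  · rintro ⟨h1, h2, h3⟩
    exact ⟨fun j _ => h1 j, fun k _ => h2 k, h3⟩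

/-- Valid arrays with `i` rows and final state `T`. -/
def Val (W : ℕ) : ℕ → Finset ℕ → Set (ℕ → ℕ → ℤ)
  | 0, T => {a | T = ∅ ∧ a = 0}
  | (i + 1), T => ⋃ S ∈ {S : Finset ℕ | S ∈ (Finset.range (W + 1)).powerset ∧ RowOK W i (brow S T)},
      Set.image (fun a => Function.update a i (brow S T)) (Val W i S)

lemma val_zero (W i : ℕ) (T : Finset ℕ) (a : ℕ → ℕ → ℤ) (ha : a ∈ Val W i T) (i' : ℕ)
    (hi : i ≤ i') : a i' = 0 := by
  induction i generalizing T a with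
  | zero => rw [ha.2]; rfl
  | succ i ih =>
    simp only [Val, Set.mem_iUnion, Set.mem_image] at ha
    obtain ⟨S, hS, a', ha', rfl⟩ := ha
    rw [Function.update_of_ne (by omega)]
    exact ih S a' ha' (by omega)

lemma val_col (W i : ℕ) (T : Finset ℕ) (a : ℕ → ℕ → ℤ) (ha : a ∈ Val W i T) (j : ℕ) :
    psum (fun i' => a i' j) i = ind T j := by
  induction i generalizing T a with
  | zero => rw [ha.1, psum_zero]; simp [ind]
  | succ i ih =>
    simp only [Val, Set.mem_iUnion, Set.mem_image] at ha
    obtain ⟨S, hS, a', ha', rfl⟩ := ha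
    rw [psum_succ, Function.update_self]
    have : psum (fun i' => Function.update a' i (brow S T) i' j) i = psum (fun i' => a' i' j) i := by
      refine Finset.sum_congr rfl fun x hx => ?_
      have : x ≠ i := by simp at hx; omega
      simp only [Function.update_of_ne this]
    rw [this, ih S a' ha', brow]
    ring

lemma ind_inj (S T : Finset ℕ) (h : ∀ j, ind S j = ind T j) : S = T := by
  ext j
  have := h j
  unfold ind at this
  split_ifs at this <;> tauto

/-- total number of minus ones -/
def qarr (W : ℕ) (a : ℕ → ℕ → ℤ) (i : ℕ) : ℕ := ∑ i' ∈ Finset.range i, qrow (a i') (W + 1)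

lemma val_sum (W i : ℕ) (T : Finset ℕ) (hT : T ⊆ Finset.range (W + 1)) :
    (Val W i T).Finite ∧ ∑ᶠ a ∈ Val W i T, (2 : ℚ) ^ qarr W a i = Zt W i T := by
  classical
  induction i generalizing T with
  | zero =>
    by_cases h : T = ∅
    · have : Val W 0 T = {0} := by ext a; simp [Val, h]
      rw [this]
      simp [qarr, Zt, h]
    · have : Val W 0 T = ∅ := by ext a; simp [Val, h]
      rw [this]
      simp [Zt, h]
  | succ i ih =>
    have hfin : {S : Finset ℕ | S ∈ (Finset.range (W + 1)).powerset ∧ RowOK W i (brow S T)}.Finite :=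
      (Finset.finite_toSet (Finset.range (W + 1)).powerset).subset fun S hS => hS.1
    have hfin2 : ∀ S ∈ {S : Finset ℕ | S ∈ (Finset.range (W + 1)).powerset ∧ RowOK W i (brow S T)},
        (Set.image (fun a => Function.update a i (brow S T)) (Val W i S)).Finite := fun S hS =>
      (ih S (Finset.mem_powerset.1 hS.1)).1.image _
    refine ⟨hfin.biUnion hfin2, ?_⟩
    rw [Val, finsum_mem_biUnion _ hfin hfin2]
    · rw [Zt]
      have : {S : Finset ℕ | S ∈ (Finset.range (W + 1)).powerset ∧ RowOK W i (brow S T)} =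
          ((Finset.range (W + 1)).powerset.filter fun S => RowOK W i (brow S T)) := by
        ext S; simp
      rw [this, finsum_mem_coe_finset, Finset.sum_filter]
      refine Finset.sum_congr rfl fun S hS => ?_
      have hS := Finset.mem_powerset.1 hS
      rw [wt_true W i S T hS hT]
      split_ifs with hok
      · rw [finsum_mem_image, ← (ih S hS).2, mul_finsum_mem]
        · refine finsum_mem_congr rfl fun a ha => ?_
          rw [← pow_add]
          congr 1
          rw [qarr, Finset.sum_range_succ, Function.update_self, add_comm, qarr]
          congr 1
          refine Finset.sum_congr rfl fun x hx => ?_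
          rw [Function.update_of_ne (by simp at hx; omega)]
        · intro a ha b hb hab
          funext i'
          have := congrFun hab i'
          by_cases h : i' = i
          · rw [h, val_zero W i S a ha i le_rfl, val_zero W i S b hb i le_rfl]
          · simpa [Function.update_of_ne h] using this
      · simp
    · intro S hS S' hS' hne
      rw [Function.onFun, Set.disjoint_left]
      rintro a ⟨a1, h1, rfl⟩ ⟨a2, h2, h3⟩
      apply hne
      apply ind_inj
      intro j
      rw [← val_col W i S a1 h1 j, ← val_col W i S' a2 h2 j]
      refine Finset.sum_congr rfl fun x hx => ?_
      have := congrFun h3 x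
      simp at hx
      simp only [Function.update_of_ne (show x ≠ i by omega)] at this
      simp only [this]

lemma val_props (W i : ℕ) (T : Finset ℕ) (hT : T ⊆ Finset.range (W + 1)) (a : ℕ → ℕ → ℤ)
    (ha : a ∈ Val W i T) :
    (∀ i' < i, RowOK W i' (a i')) ∧ ∀ j, ZO (fun i' => a i' j) := by
  induction i generalizing T a with
  | zero => rw [ha.2]; simp [ZO, psum]
  | succ i ih =>
    have ha0 := ha
    simp only [Val, Set.mem_iUnion, Set.mem_image] at ha
    obtain ⟨S, hS, a', ha', rfl⟩ := ha
    obtain ⟨h1, h2⟩ := ih S (Finset.mem_powerset.1 hS.1) a' ha'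
    constructor
    · intro i' hi'
      by_cases h : i' = i
      · rw [h, Function.update_self]; exact hS.2
      · rw [Function.update_of_ne h]; exact h1 i' (by omega)
    · intro j k
      by_cases hk : k ≤ i
      · have : psum (fun i' => Function.update a' i (brow S T) i' j) k = psum (fun i' => a' i' j) k := by
          refine Finset.sum_congr rfl fun x hx => ?_
          have : x ≠ i := by simp at hx; omega
          simp only [Function.update_of_ne this]
        rw [this]
        exact h2 j k
      · rw [psum_const _ (i + 1) k (by omega), val_col W (i + 1) T _ ha0 j]
        · unfold ind; split_ifs <;> simp
        · intro i' hi' _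
          exact congrFun (val_zero W (i + 1) T _ ha0 i' hi') j

lemma val_of (W m : ℕ) (a : ℕ → ℕ → ℤ) (hr : ∀ i' < m, RowOK W i' (a i'))
    (hc : ∀ j, ZO (fun i' => a i' j)) (i : ℕ) (hi : i ≤ m) :
    (fun i' => if i' < i then a i' else 0) ∈
      Val W i ((Finset.range (W + 1)).filter fun j => psum (fun i' => a i' j) i = 1) := by
  induction i with
  | zero =>
    refine ⟨?_, ?_⟩
    · ext j; simp [psum]
    · simp; rfl
  | succ i ih =>
    simp only [Val, Set.mem_iUnion, Set.mem_image]
    have key : brow ((Finset.range (W + 1)).filter fun j => psum (fun i' => a i' j) i = 1)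
      ((Finset.range (W + 1)).filter fun j => psum (fun i' => a i' j) (i + 1) = 1) = a i := by
      funext j
      by_cases hj : j < W + 1
      · have h1 := hc j i
        have h2 := hc j (i + 1)
        simp only [brow, ind, Finset.mem_filter, Finset.mem_range, hj, true_and]
        rw [psum_succ] at h2 ⊢
        split_ifs <;> omega
      · rw [(hr i (by omega)).1 j (by omega)]
        simp [brow, ind, hj]
    refine ⟨(Finset.range (W + 1)).filter fun j => psum (fun i' => a i' j) i = 1, ⟨by simp, ?_⟩,
      _, ih (by omega), ?_⟩
    · rw [key]; exact hr i (by omega)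
    · rw [key]
      funext i'
      by_cases h : i' = i
      · rw [h]; simp
      · rw [Function.update_of_ne h]
        by_cases h2 : i' < i
        · simp [h2, show i' < i + 1 by omega]
        · simp [h2, show ¬ i' < i + 1 by omega]

lemma ast_inj (m l : ℕ) : Function.Injective (AST.a : AST m l → ℕ → ℕ → ℤ) := by
  intro A B h
  cases A; cases B
  simp at h
  simp [h]

lemma ast_range (m l : ℕ) (hl : 2 ≤ l) (hm : 0 < m) :
    Set.range (AST.a : AST m l → ℕ → ℕ → ℤ) =
      ⋃ T ∈ {T : Finset ℕ | T ∈ ((Finset.range (2 * m + l - 2)).filter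
        fun j => ¬ (m ≤ j ∧ j < m + l - 2)).powerset}, Val (2 * m + l - 3) m T := by
  have hW : 2 * m + l - 3 + 1 = 2 * m + l - 2 := by omega
  ext a
  simp only [Set.mem_range, Set.mem_iUnion]
  constructor
  · rintro ⟨A, rfl⟩
    have hr : ∀ i' < m, RowOK (2 * m + l - 3) i' (A.a i') := by
      intro i hi
      have hs : psum (A.a i) (2 * m + l - 3 + 1) = 1 := by rw [hW]; exact A.row_sum i hi
      refine ⟨fun j hj => A.outside i j (Or.inr hj), ?_, hs⟩
      exact zo_of_alt_sum _ (A.entries i) (A.row_alt i) _ hs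
    have hc : ∀ j, ZO (fun i' => A.a i' j) := fun j =>
      zo_of_alt _ (fun i => A.entries i j) (A.col_alt j) (fun i => A.col_top i j)
    have := val_of _ m A.a hr hc m le_rfl
    have e : (fun i' => if i' < m then A.a i' else 0) = A.a := by
      funext i
      split_ifs with h
      · rfl
      · funext j; exact (A.outside i j (Or.inl (by omega))).symm
    rw [e] at this
    refine ⟨_, ?_, this⟩
    simp only [Set.mem_ofPred_eq, Finset.mem_powerset]
    intro j hj
    rw [Finset.mem_filter, hW] at hj
    rw [Finset.mem_filter]
    refine ⟨hj.1, fun h => ?_⟩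
    have := A.central_sum j h.1 h.2
    have h2 := hj.2
    unfold psum at h2
    rw [this] at h2
    exact absurd h2 (by norm_num)
  · rintro ⟨T, hT, ha⟩
    simp only [Set.mem_ofPred_eq, Finset.mem_powerset] at hT
    have hT' : T ⊆ Finset.range (2 * m + l - 3 + 1) := by
      rw [hW]; exact hT.trans (Finset.filter_subset _ _)
    obtain ⟨h1, h2⟩ := val_props _ m T hT' a ha
    refine ⟨⟨a, fun i j => zo_entries _ (h2 j) i, ?_, ?_, ?_, fun j => zo_alt _ (h2 j),
      fun i j => zo_top _ (h2 j) i, ?_⟩, rfl⟩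
    · rintro i j (h | h)
      · exact congrFun (val_zero _ m T a ha i h) j
      · by_cases him : i < m
        · exact (h1 i him).1 j h
        · exact congrFun (val_zero _ m T a ha i (by omega)) j
    · intro i hi
      rw [← hW]
      exact (h1 i hi).2.2
    · intro i
      by_cases him : i < m
      · exact zo_alt _ (h1 i him).2.1
      · intro j₁ j₂ _ h3
        exact absurd (congrFun (val_zero _ m T a ha i (by omega)) j₁) h3
    · intro j h3 h4
      have := val_col _ m T a ha j
      have hj : j ∉ T := fun h => by
        have := hT h
        simp at this
        omega
      simp only [psum, ind, hj, if_false] at this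
      exact this

lemma ast_sum (m l : ℕ) (hl : 2 ≤ l) (hm : 0 < m) :
    ∑ᶠ A : AST m l, (2 : ℚ) ^ qStat A =
      ∑ C ∈ ((Finset.range (2 * m + l - 2)).filter
        fun j => ¬ (m ≤ j ∧ j < m + l - 2)).powerset, Zt (2 * m + l - 3) m C := by
  have hW : 2 * m + l - 3 + 1 = 2 * m + l - 2 := by omega
  have h1 : ∑ᶠ A : AST m l, (2 : ℚ) ^ qStat A =
      ∑ᶠ A : AST m l, (2 : ℚ) ^ qarr (2 * m + l - 3) A.a m := by
    refine finsum_congr fun A => ?_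
    rw [qStat, qarr]
    simp only [qrow, hW]
  have hsub : ∀ C ∈ ((Finset.range (2 * m + l - 2)).filter
        fun j => ¬ (m ≤ j ∧ j < m + l - 2)).powerset, C ⊆ Finset.range (2 * m + l - 3 + 1) := by
    intro C hC
    rw [hW]
    exact (Finset.mem_powerset.1 hC).trans (Finset.filter_subset _ _)
  rw [h1, ← finsum_mem_range (f := fun a => (2 : ℚ) ^ qarr (2 * m + l - 3) a m) (ast_inj m l),
    ast_range m l hl hm, finsum_mem_biUnion]
  · change ∑ᶠ T ∈ ((((Finset.range (2 * m + l - 2)).filter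
        fun j => ¬ (m ≤ j ∧ j < m + l - 2)).powerset : Finset (Finset ℕ)) : Set (Finset ℕ)), _ = _
    rw [finsum_mem_coe_finset]
    exact Finset.sum_congr rfl fun C hC => (val_sum _ m C (hsub C hC)).2
  · intro S hS S' hS' hne
    rw [Function.onFun, Set.disjoint_left]
    intro a h1 h2
    apply hne
    apply ind_inj
    intro j
    rw [← val_col _ m S a h1 j, ← val_col _ m S' a h2 j]
  · exact Finset.finite_toSet (((Finset.range (2 * m + l - 2)).filter
        fun j => ¬ (m ≤ j ∧ j < m + l - 2)).powerset)
  · intro C hC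
    exact (val_sum _ m C (hsub C hC)).1

lemma ast_det (n l : ℕ) (hl : 2 ≤ l) :
    ∑ᶠ A : AST (2 * n + 2) l, (2 : ℚ) ^ qStat A = (Qp (n + 1)).det.eval (((l : ℚ) - 1) / 2) := by
  rw [← part_b (n + 1) l hl (by omega), show 2 * n + 2 = 2 * (n + 1) by ring,
    ast_sum _ l hl (by omega)]
  refine Finset.sum_congr rfl fun C hC => ?_
  have hW : 2 * (2 * (n + 1)) + l - 3 + 1 = 2 * (2 * (n + 1)) + l - 2 := by omega
  rw [Zt_eq _ _ (by omega), hW]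
  rw [hW]
  exact (Finset.mem_powerset.1 hC).trans (Finset.filter_subset _ _)

end ASTProof

namespace ASTProof

section expand
variable {R : Type*} [CommRing R]

lemma det_exp1 (N M : ℕ) (A : Fin N → ℕ → R) (G : ℕ → Fin N → R) :
    Matrix.det (Matrix.of fun α β : Fin N => ∑ k ∈ Finset.range M, A α k * G k β) =
    ∑ p ∈ Fintype.piFinset (fun _ : Fin N => Finset.range M), (∏ α, A α (p α)) *
      Matrix.det (Matrix.of fun α β : Fin N => G (p α) β) := by
  have h := (Matrix.detRowAlternating (R := R) (n := Fin N)).toMultilinearMap.map_sum_finset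
    (fun α k => A α k • fun β => G k β) (fun _ => Finset.range M)
  have e : (Matrix.of fun α β : Fin N => ∑ k ∈ Finset.range M, A α k * G k β) =
      fun α => ∑ k ∈ Finset.range M, A α k • fun β => G k β := by
    ext α β
    simp [Finset.sum_apply]
  rw [e]
  refine h.trans (Finset.sum_congr rfl fun p _ => ?_)
  rw [MultilinearMap.map_smul_univ]
  rfl

lemma det_expand (N M : ℕ) (A B : Fin N → ℕ → R) (K : ℕ → ℕ → R) :
    Matrix.det (Matrix.of fun α β : Fin N => ∑ k ∈ Finset.range M, ∑ j ∈ Finset.range M,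
      K k j * A α k * B β j) =
    ∑ p ∈ Fintype.piFinset (fun _ : Fin N => Finset.range M),
    ∑ q ∈ Fintype.piFinset (fun _ : Fin N => Finset.range M),
      (∏ α, A α (p α)) * ((∏ β, B β (q β)) *
      Matrix.det (Matrix.of fun α β : Fin N => K (p α) (q β))) := by
  have e : (Matrix.of fun α β : Fin N => ∑ k ∈ Finset.range M, ∑ j ∈ Finset.range M,
      K k j * A α k * B β j) = Matrix.of fun α β : Fin N => ∑ k ∈ Finset.range M,
      A α k * ∑ j ∈ Finset.range M, B β j * K k j := by
    ext α β
    simp only [Matrix.of_apply, Finset.mul_sum]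
    refine Finset.sum_congr rfl fun k _ => Finset.sum_congr rfl fun j _ => by ring
  rw [e, det_exp1 N M A (fun k β => ∑ j ∈ Finset.range M, B β j * K k j)]
  refine Finset.sum_congr rfl fun p _ => ?_
  rw [← Finset.mul_sum]
  congr 1
  rw [← Matrix.det_transpose]
  have := det_exp1 N M B (fun j α => K (p α) j)
  refine Eq.trans ?_ (this.trans (Finset.sum_congr rfl fun q _ => ?_))
  · rfl
  · rw [← Matrix.det_transpose]
    rfl

end expand

lemma inj_sum (N : ℕ) (p : Fin N → ℕ) (hp : Function.Injective p) :
    N * (N - 1) / 2 ≤ ∑ i, p i ∧ ((∃ i, N ≤ p i) → N * (N - 1) / 2 < ∑ i, p i) := by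
  classical
  set s := Finset.univ.image p with hs
  have h1 : ∑ i, p i = ∑ x ∈ s, x := by
    rw [hs, Finset.sum_image (fun a _ b _ h => hp h)]
  have hc : s.card = N := by
    rw [hs, Finset.card_image_of_injective _ hp]; simp
  have hcard : (s \ Finset.range N).card = (Finset.range N \ s).card := by
    apply Finset.card_sdiff_comm
    simp [hc]
  have h2 : ∑ x ∈ s, x = ∑ x ∈ s \ Finset.range N, x + ∑ x ∈ s ∩ Finset.range N, x := by
    rw [add_comm, Finset.sum_inter_add_sum_sdiff]
  have h3 : ∑ x ∈ Finset.range N, x = ∑ x ∈ Finset.range N \ s, x + ∑ x ∈ s ∩ Finset.range N, x := by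
    rw [add_comm, Finset.inter_comm, Finset.sum_inter_add_sum_sdiff]
  have h4 : (s \ Finset.range N).card * N ≤ ∑ x ∈ s \ Finset.range N, x := by
    rw [← smul_eq_mul]
    apply Finset.card_nsmul_le_sum
    intro x hx
    simp at hx
    omega
  have h5 : ∑ x ∈ Finset.range N \ s, x ≤ (Finset.range N \ s).card * (N - 1) := by
    rw [← smul_eq_mul]
    apply Finset.sum_le_card_nsmul
    intro x hx
    simp at hx
    omega
  rw [← Finset.sum_range_id, h1, h2, h3]
  rw [← hcard] at h5
  constructor
  · have : (s \ Finset.range N).card * (N - 1) ≤ (s \ Finset.range N).card * N :=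
      Nat.mul_le_mul_left _ (by omega)
    omega
  · rintro ⟨i, hi⟩
    have hpos : 0 < (s \ Finset.range N).card := by
      rw [Finset.card_pos]
      exact ⟨p i, by simp [hs, hi]⟩
    have hN : 0 < N := i.pos
    have : (s \ Finset.range N).card * (N - 1) < (s \ Finset.range N).card * N :=
      Nat.mul_lt_mul_of_pos_left (by omega) hpos
    omega

lemma coeff_prod_le {ι : Type*} (s : Finset ι) (f : ι → Polynomial ℚ) (d : ι → ℕ)
    (h : ∀ i ∈ s, (f i).natDegree ≤ d i) :
    (∏ i ∈ s, f i).natDegree ≤ ∑ i ∈ s, d i ∧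
    (∏ i ∈ s, f i).coeff (∑ i ∈ s, d i) = ∏ i ∈ s, (f i).coeff (d i) := by
  classical
  induction s using Finset.induction_on with
  | empty => simp
  | insert a s ha ih =>
    obtain ⟨h1, h2⟩ := ih fun i hi => h i (Finset.mem_insert_of_mem hi)
    have h3 := h a (Finset.mem_insert_self a s)
    rw [Finset.prod_insert ha, Finset.sum_insert ha, Finset.prod_insert ha, ← h2]
    exact ⟨Polynomial.natDegree_mul_le.trans (add_le_add h3 h1),
      Polynomial.coeff_mul_add_eq_of_natDegree_le h3 h1⟩

lemma fpoly_deg (a : ℕ) : (fpoly a).natDegree ≤ a ∧ (fpoly a).coeff a = 2 ^ a / (a.factorial : ℚ) := by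
  induction a using Nat.strong_induction_on with
  | _ a ih =>
    match a with
    | 0 => simp [fpoly]
    | 1 =>
      constructor
      · rw [fpoly, show (2 : Polynomial ℚ) = Polynomial.C 2 from rfl]
        exact (Polynomial.natDegree_C_mul_le _ _).trans Polynomial.natDegree_X_le
      · rw [fpoly, show (2 : Polynomial ℚ) = Polynomial.C 2 from rfl]
        simp
    | (k + 2) =>
      obtain ⟨h1, h2⟩ := ih (k + 1) (by omega)
      obtain ⟨h3, -⟩ := ih k (by omega)
      have e : fpoly (k + 2) = Polynomial.C (2 / ((k : ℚ) + 2)) * (Polynomial.X * fpoly (k + 1)) +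
          Polynomial.C ((k : ℚ) / ((k : ℚ) + 2)) * fpoly k := by
        rw [fpoly, show (2 : Polynomial ℚ) = Polynomial.C 2 from rfl,
          show (k : Polynomial ℚ) = Polynomial.C (k : ℚ) by simp, div_eq_mul_one_div (2 : ℚ),
          div_eq_mul_one_div (k : ℚ), Polynomial.C_mul, Polynomial.C_mul]
        ring
      have h4 : (Polynomial.X * fpoly (k + 1)).natDegree ≤ k + 2 := by
        refine Polynomial.natDegree_mul_le.trans ?_
        rw [Polynomial.natDegree_X]; omega
      rw [e]
      constructor
      · refine Polynomial.natDegree_add_le_of_degree_le ?_ ?_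
        · exact (Polynomial.natDegree_C_mul_le _ _).trans h4
        · exact (Polynomial.natDegree_C_mul_le _ _).trans (by omega)
      · rw [Polynomial.coeff_add, Polynomial.coeff_C_mul, Polynomial.coeff_C_mul,
          Polynomial.coeff_X_mul, h2, Polynomial.coeff_eq_zero_of_natDegree_lt (by omega),
          Nat.factorial_succ (k + 1)]
        push_cast
        have : (((k + 1).factorial : ℕ) : ℚ) ≠ 0 := by positivity
        field_simp
        ring

lemma fpoly_natDegree (a : ℕ) : (fpoly a).natDegree = a := by
  obtain ⟨h1, h2⟩ := fpoly_deg a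
  apply le_antisymm h1
  apply Polynomial.le_natDegree_of_ne_zero
  rw [h2]
  positivity

/-- leading coefficients -/
noncomputable def lc (k a : ℕ) : ℚ := if k ≤ a then 2 ^ (a - k) / ((a - k).factorial : ℚ) else 0

lemma rp_deg (k a : ℕ) (h : k ≤ a) : (rp k a).natDegree ≤ a - k ∧ (rp k a).coeff (a - k) = lc k a := by
  have h1 := Polynomial.natDegree_taylor (fpoly (a - k)) (k : ℚ)
  have h2 := Polynomial.coeff_taylor_natDegree (r := (k : ℚ)) (f := fpoly (a - k))
  rw [Polynomial.taylor_apply] at h1 h2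
  rw [fpoly_natDegree, Polynomial.leadingCoeff, fpoly_natDegree, (fpoly_deg _).2] at h2
  rw [fpoly_natDegree] at h1
  rw [rp, if_pos h, lc, if_pos h]
  exact ⟨h1.le, h2⟩

lemma det_Kf (N : ℕ) : Matrix.det (Matrix.of fun α β : Fin N => Kf α β) = 2 ^ N := by
  rw [Matrix.det_of_isLowerTriangular]
  · simp [Kf]
  · intro i j hij
    have : (i : ℕ) < j := by simpa using hij
    have h1 : ¬ (j : ℕ) < i := by omega
    have h2 : ¬ (j : ℕ) = i := by omega
    simp [Kf, h1, h2, -Fin.val_fin_lt]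

lemma Qp_coeff (N : ℕ) : (Qp N).det.natDegree ≤ N ^ 2 ∧
    (Qp N).det.coeff (N ^ 2) = 2 ^ N *
      Matrix.det (Matrix.of fun α k : Fin N => lc k (2 * (α : ℕ) + 1)) *
      Matrix.det (Matrix.of fun α k : Fin N => lc k (2 * (α : ℕ))) := by
  classical
  have hQ := det_expand N (2 * N) (fun α k => rp k (2 * (α : ℕ) + 1)) (fun β j => rp j (2 * (β : ℕ)))
    (fun k j => Polynomial.C (Kf k j))
  have hL := det_expand N (2 * N)
    (fun α k => if k < N then lc k (2 * (α : ℕ) + 1) else 0)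
    (fun β j => if j < N then lc j (2 * (β : ℕ)) else 0) Kf
  have hdK : ∀ p q : Fin N → ℕ, Matrix.det (Matrix.of fun α β : Fin N =>
      Polynomial.C (Kf (p α) (q β))) =
      Polynomial.C (Matrix.det (Matrix.of fun α β : Fin N => Kf (p α) (q β))) := by
    intro p q
    rw [RingHom.map_det]
    rfl
  have key : ∀ p q : Fin N → ℕ,
      ((∏ α : Fin N, rp (p α) (2 * (α : ℕ) + 1)) * ((∏ β : Fin N, rp (q β) (2 * (β : ℕ))) *
        Polynomial.C (Matrix.det (Matrix.of fun α β : Fin N => Kf (p α) (q β))))).natDegree ≤ N ^ 2 ∧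
      ((∏ α : Fin N, rp (p α) (2 * (α : ℕ) + 1)) * ((∏ β : Fin N, rp (q β) (2 * (β : ℕ))) *
        Polynomial.C (Matrix.det (Matrix.of fun α β : Fin N => Kf (p α) (q β))))).coeff (N ^ 2) =
      ((∏ α : Fin N, if p α < N then lc (p α) (2 * (α : ℕ) + 1) else 0) *
        ((∏ β : Fin N, if q β < N then lc (q β) (2 * (β : ℕ)) else 0) *
        (Matrix.det (Matrix.of fun α β : Fin N => Kf (p α) (q β))))) := by
    intro p q
    by_cases hp : Function.Injective p
    swap
    · have : Matrix.det (Matrix.of fun α β : Fin N => Kf (p α) (q β)) = 0 := by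
        unfold Function.Injective at hp
        push Not at hp
        obtain ⟨a, b, hab, hne⟩ := hp
        apply Matrix.det_zero_of_row_eq hne
        funext β; simp [hab]
      simp [this]
    by_cases hq : Function.Injective q
    swap
    · have : Matrix.det (Matrix.of fun α β : Fin N => Kf (p α) (q β)) = 0 := by
        unfold Function.Injective at hq
        push Not at hq
        obtain ⟨a, b, hab, hne⟩ := hq
        apply Matrix.det_zero_of_column_eq hne
        intro β; simp [hab]
      simp [this]
    by_cases hp1 : ∀ α : Fin N, p α ≤ 2 * (α : ℕ) + 1
    swap
    · push Not at hp1
      obtain ⟨α, hα⟩ := hp1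
      have h1 : (∏ α : Fin N, rp (p α) (2 * (α : ℕ) + 1)) = 0 := by
        apply Finset.prod_eq_zero (Finset.mem_univ α)
        rw [rp, if_neg (by omega)]
      have h2 : (∏ α : Fin N, if p α < N then lc (p α) (2 * (α : ℕ) + 1) else 0) = 0 := by
        apply Finset.prod_eq_zero (Finset.mem_univ α)
        rw [lc, if_neg (show ¬ p α ≤ 2 * (α : ℕ) + 1 by omega)]
        simp
      rw [h1, h2]
      simp
    by_cases hq1 : ∀ α : Fin N, q α ≤ 2 * (α : ℕ)
    swap
    · push Not at hq1
      obtain ⟨α, hα⟩ := hq1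
      have h1 : (∏ α : Fin N, rp (q α) (2 * (α : ℕ))) = 0 := by
        apply Finset.prod_eq_zero (Finset.mem_univ α)
        rw [rp, if_neg (by omega)]
      have h2 : (∏ α : Fin N, if q α < N then lc (q α) (2 * (α : ℕ)) else 0) = 0 := by
        apply Finset.prod_eq_zero (Finset.mem_univ α)
        rw [lc, if_neg (show ¬ q α ≤ 2 * (α : ℕ) by omega)]
        simp
      rw [h1, h2]
      simp
    obtain ⟨a1, a2⟩ := coeff_prod_le Finset.univ (fun α : Fin N => rp (p α) (2 * (α : ℕ) + 1))
      (fun α => 2 * (α : ℕ) + 1 - p α) (fun α _ => (rp_deg _ _ (hp1 α)).1)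
    obtain ⟨b1, b2⟩ := coeff_prod_le Finset.univ (fun α : Fin N => rp (q α) (2 * (α : ℕ)))
      (fun α => 2 * (α : ℕ) - q α) (fun α _ => (rp_deg _ _ (hq1 α)).1)
    rw [Finset.prod_congr rfl fun α _ => (rp_deg _ _ (hp1 α)).2] at a2
    rw [Finset.prod_congr rfl fun α _ => (rp_deg _ _ (hq1 α)).2] at b2
    have s1 : ∑ α : Fin N, (2 * (α : ℕ) + 1 - p α) + ∑ α, p α = N ^ 2 := by
      rw [← Finset.sum_add_distrib, Finset.sum_congr rfl fun α _ => Nat.sub_add_cancel (hp1 α),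
        Fin.sum_univ_eq_sum_range (fun α => 2 * α + 1)]
      clear * -
      induction N with
      | zero => simp
      | succ N ih => rw [Finset.sum_range_succ, ih]; ring
    have s2 : ∑ α : Fin N, (2 * (α : ℕ) - q α) + ∑ α, q α = N * (N - 1) := by
      rw [← Finset.sum_add_distrib, Finset.sum_congr rfl fun α _ => Nat.sub_add_cancel (hq1 α),
        Fin.sum_univ_eq_sum_range (fun α => 2 * α), ← Finset.mul_sum, mul_comm, Finset.sum_range_id_mul_two]
    obtain ⟨i1, i2⟩ := inj_sum N p hp
    obtain ⟨j1, j2⟩ := inj_sum N q hq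
    have hev : 2 * (N * (N - 1) / 2) = N * (N - 1) :=
      Nat.mul_div_cancel' (Nat.even_mul_pred_self N).two_dvd
    set P := (∏ α : Fin N, rp (p α) (2 * (α : ℕ) + 1)) with hP
    set P' := (∏ α : Fin N, rp (q α) (2 * (α : ℕ))) with hP'
    set dK := Matrix.det (Matrix.of fun α β : Fin N => Kf (p α) (q β))
    have hd : (P * (P' * Polynomial.C dK)).natDegree ≤
        ∑ α : Fin N, (2 * (α : ℕ) + 1 - p α) + ∑ α : Fin N, (2 * (α : ℕ) - q α) :=
      Polynomial.natDegree_mul_le.trans (add_le_add a1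
        ((Polynomial.natDegree_mul_C_le _ _).trans b1))
    refine ⟨by omega, ?_⟩
    by_cases hpN : ∀ i, p i < N
    swap
    · have : ∃ i, N ≤ p i := by push Not at hpN; exact hpN
      have h3 := i2 this
      rw [Polynomial.coeff_eq_zero_of_natDegree_lt (by omega)]
      obtain ⟨i, hi⟩ := this
      rw [Finset.prod_eq_zero (Finset.mem_univ i) (if_neg (by omega))]
      simp
    by_cases hqN : ∀ i, q i < N
    swap
    · have : ∃ i, N ≤ q i := by push Not at hqN; exact hqN
      have h3 := j2 this
      rw [Polynomial.coeff_eq_zero_of_natDegree_lt (by omega)]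
      obtain ⟨i, hi⟩ := this
      rw [Finset.prod_eq_zero (f := fun β : Fin N => if q β < N then lc (q β) (2 * (β : ℕ)) else 0)
        (Finset.mem_univ i) (if_neg (by omega))]
      simp
    simp only [hpN, hqN, if_true]
    have sumeq : ∀ r : Fin N → ℕ, Function.Injective r → (∀ i, r i < N) →
        ∑ i, r i = N * (N - 1) / 2 := by
      intro r hr hrN
      have hb : Function.Bijective (fun i : Fin N => (⟨r i, hrN i⟩ : Fin N)) := by
        rw [← Finite.injective_iff_bijective]
        intro a b hab
        exact hr (by simpa using hab)
      have := hb.sum_comp (fun i : Fin N => (i : ℕ))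
      simp only at this
      rw [this, Fin.sum_univ_eq_sum_range (fun i => i), Finset.sum_range_id]
    have t1 := sumeq p hp hpN
    have t2 := sumeq q hq hqN
    have hN2 : N ^ 2 = ∑ α : Fin N, (2 * (α : ℕ) + 1 - p α) + ∑ α : Fin N, (2 * (α : ℕ) - q α) := by
      omega
    rw [← mul_assoc, Polynomial.coeff_mul_C, hN2,
      Polynomial.coeff_mul_add_eq_of_natDegree_le a1 b1, a2, b2, mul_assoc]
  have hQ' : (Qp N).det = _ := hQ
  rw [hQ']
  simp only [hdK]
  constructor
  · apply Polynomial.natDegree_sum_le_of_forall_le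
    intro p _
    apply Polynomial.natDegree_sum_le_of_forall_le
    intro q _
    exact (key p q).1
  · rw [Polynomial.finsetSum_coeff]
    simp only [Polynomial.finsetSum_coeff, (key _ _).2]
    rw [← hL]
    have hprod : (Matrix.of fun α β : Fin N => ∑ k ∈ Finset.range (2 * N), ∑ j ∈ Finset.range (2 * N),
        Kf k j * (if k < N then lc k (2 * (α : ℕ) + 1) else 0) *
          (if j < N then lc j (2 * (β : ℕ)) else 0)) =
        (Matrix.of fun α k : Fin N => lc k (2 * (α : ℕ) + 1)) *
        (Matrix.of fun α β : Fin N => Kf α β) *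
        (Matrix.of fun α k : Fin N => lc k (2 * (α : ℕ))).transpose := by
      ext α β
      have red : ∀ f : ℕ → ℚ, ∑ k ∈ Finset.range (2 * N), (if k < N then f k else 0) =
          ∑ k : Fin N, f k := by
        intro f
        rw [Fin.sum_univ_eq_sum_range f, ← Finset.sum_filter]
        congr 1
        ext x; simp; omega
      simp only [Matrix.mul_apply, Matrix.of_apply, Matrix.transpose_apply, Finset.sum_mul]
      rw [Finset.sum_comm]
      rw [← red fun j => ∑ k : Fin N, lc k (2 * (α : ℕ) + 1) * Kf k j * lc j (2 * (β : ℕ))]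
      refine Finset.sum_congr rfl fun j _ => ?_
      split_ifs
      · rw [← red fun k => lc k (2 * (α : ℕ) + 1) * Kf k j * lc j (2 * (β : ℕ))]
        refine Finset.sum_congr rfl fun k _ => ?_
        split_ifs
        · ring
        · ring
      · simp
    rw [hprod, Matrix.det_mul, Matrix.det_mul, Matrix.det_transpose, det_Kf]
    ring

end ASTProof

namespace ASTProof

lemma vand_prod (N : ℕ) : ∏ i : Fin N, ∏ j ∈ Finset.Ioi i, (2 * (j : ℚ) - 2 * (i : ℚ)) =
    ∏ j ∈ Finset.range N, (2 ^ j * (j.factorial : ℚ)) := by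
  induction N with
  | zero => simp
  | succ N ih =>
    rw [Fin.prod_univ_succ, Fin.prod_Ioi_zero, Finset.prod_range_succ, ← ih, mul_comm]
    congr 1
    · refine Finset.prod_congr rfl fun i _ => ?_
      rw [Fin.prod_Ioi_succ]
      refine Finset.prod_congr rfl fun j _ => ?_
      simp
      ring
    · rw [Finset.prod_congr rfl (g := fun j : Fin N => 2 * (((j : ℕ) + 1 : ℕ) : ℚ))]
      · rw [Finset.prod_mul_distrib, Fin.prod_univ_eq_prod_range (fun j => ((j + 1 : ℕ) : ℚ)),
          ← Nat.cast_prod, Finset.prod_range_add_one_eq_factorial]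
        simp
      · intro j _
        simp

lemma lc_eq (k a : ℕ) : lc k a = 2 ^ a / (a.factorial : ℚ) * ((1 / 2) ^ k * (descPochhammer ℚ k).eval (a : ℚ)) := by
  rw [descPochhammer_eval_eq_descFactorial, lc]
  split_ifs with h
  · rw [← Nat.factorial_mul_descFactorial h]
    push_cast
    have h1 : ((a - k).factorial : ℚ) ≠ 0 := by positivity
    have h2 : (a.descFactorial k : ℚ) ≠ 0 := by
      have := Nat.pow_sub_le_descFactorial a k
      have : 0 < a.descFactorial k := lt_of_lt_of_le (by apply pow_pos; omega) this
      positivity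
    have h3 : (2 : ℚ) ^ a = 2 ^ (a - k) * 2 ^ k := by rw [← pow_add]; congr 1; omega
    rw [h3, one_div, inv_pow]
    field_simp
  · rw [Nat.descFactorial_of_lt (by omega)]
    simp

lemma det_lc (N c : ℕ) : Matrix.det (Matrix.of fun α k : Fin N => lc k (2 * (α : ℕ) + c)) =
    ∏ j ∈ Finset.range N, (2 ^ (2 * j + c) * (j.factorial : ℚ) / ((2 * j + c).factorial : ℚ)) := by
  have e : (Matrix.of fun α k : Fin N => lc k (2 * (α : ℕ) + c)) = Matrix.of fun α k : Fin N =>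
      (2 ^ (2 * (α : ℕ) + c) / ((2 * (α : ℕ) + c).factorial : ℚ)) *
        (Matrix.of fun α k : Fin N => (1 / 2) ^ (k : ℕ) * (Matrix.of fun α k : Fin N =>
          (descPochhammer ℚ k).eval ((2 * (α : ℕ) + c : ℕ) : ℚ)) α k) α k := by
    ext α k
    simp only [Matrix.of_apply]
    rw [lc_eq]
  rw [e, Matrix.det_mul_column, Matrix.det_mul_row,
    ← Matrix.det_eval_matrixOfPolynomials_eq_det_vandermonde
      (fun α : Fin N => ((2 * (α : ℕ) + c : ℕ) : ℚ))
      (fun k : Fin N => descPochhammer ℚ k) (fun i => descPochhammer_natDegree ℚ i)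
      (fun i => monic_descPochhammer ℚ i), Matrix.det_vandermonde]
  have : ∀ i j : Fin N, ((2 * (j : ℕ) + c : ℕ) : ℚ) - ((2 * (i : ℕ) + c : ℕ) : ℚ) =
      2 * (j : ℚ) - 2 * (i : ℚ) := by intro i j; push_cast; ring
  simp only [this]
  rw [vand_prod, Fin.prod_univ_eq_prod_range (fun j => (2 : ℚ) ^ (2 * j + c) / ((2 * j + c).factorial : ℚ)),
    Fin.prod_univ_eq_prod_range (fun j => (1 / 2 : ℚ) ^ j), ← Finset.prod_mul_distrib,
    ← Finset.prod_mul_distrib]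
  refine Finset.prod_congr rfl fun j _ => ?_
  have h3 : ((2 * j + c).factorial : ℚ) ≠ 0 := by positivity
  rw [one_div, inv_pow]
  field_simp

lemma det_lc1 (N : ℕ) : Matrix.det (Matrix.of fun α k : Fin N => lc k (2 * (α : ℕ) + 1)) =
    ∏ j ∈ Finset.range N, ∏ i ∈ Finset.range (j + 1), (2 / (2 * ((i : ℚ) + 1) - 1)) := by
  rw [det_lc]
  refine Finset.prod_congr rfl fun j hj => ?_
  clear hj
  induction j with
  | zero => simp; norm_num
  | succ j ih =>
    rw [Finset.prod_range_succ, ← ih, show 2 * (j + 1) + 1 = (2 * j + 1) + 1 + 1 by ring,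
      Nat.factorial_succ, Nat.factorial_succ, Nat.factorial_succ]
    have h3 : ((2 * j + 1).factorial : ℚ) ≠ 0 := by positivity
    have h4 : (2 * ((j : ℚ) + 1 + 1) - 1) ≠ 0 := by
      have : (0 : ℚ) ≤ j := by positivity
      linarith
    push_cast
    have h5 : (2 * (j : ℚ) + 1 + 1 + 1) ≠ 0 := by positivity
    have h6 : (2 * (j : ℚ) + 1 + 1) ≠ 0 := by positivity
    field_simp
    ring

lemma det_lc0 (n : ℕ) : Matrix.det (Matrix.of fun α k : Fin (n + 1) => lc k (2 * (α : ℕ))) =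
    ∏ j ∈ Finset.range n, ∏ i ∈ Finset.range (j + 1), (2 / (2 * ((i : ℚ) + 1) - 1)) := by
  have := det_lc (n + 1) 0
  simp only [add_zero] at this
  rw [this, Finset.prod_range_succ']
  simp only [mul_zero, pow_zero, Nat.factorial_zero, Nat.cast_one, one_mul, div_one, mul_one]
  refine Finset.prod_congr rfl fun j hj => ?_
  clear hj
  induction j with
  | zero => simp [Nat.factorial]; norm_num
  | succ j ih =>
    rw [Finset.prod_range_succ, ← ih, show 2 * (j + 1 + 1) = (2 * (j + 1)) + 1 + 1 by ring,
      Nat.factorial_succ (j + 1), Nat.factorial_succ (2 * (j + 1) + 1), Nat.factorial_succ (2 * (j + 1))]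
    have h3 : ((2 * (j + 1)).factorial : ℚ) ≠ 0 := by positivity
    push_cast
    rw [show (2 * ((j : ℚ) + 1 + 1) - 1) = 2 * ((j : ℚ) + 1) + 1 by ring]
    have h5 : (2 * ((j : ℚ) + 1) + 1 + 1) ≠ 0 := by positivity
    have h6 : (2 * ((j : ℚ) + 1) + 1) ≠ 0 := by positivity
    field_simp
    ring

end ASTProof

namespace ASTProof

section series
open PowerSeries

/-- u -/
noncomputable def uS : PowerSeries ℚ := X * pw 1
/-- inverse of `1 - x^2` -/
noncomputable def iS : PowerSeries ℚ := (1 - X ^ 2)⁻¹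
/-- inverse of `1 + x^2` -/
noncomputable def jS : PowerSeries ℚ := (1 + X ^ 2)⁻¹
/-- a -/
noncomputable def aS : PowerSeries ℚ := 2 * X * iS
/-- g -/
noncomputable def gS : PowerSeries ℚ := ((1 - X ^ 2) ^ 2 - 4 * X ^ 2) * iS * jS
/-- A -/
noncomputable def AS : PowerSeries ℚ := C (1 / 2) * (1 + X ^ 2) ^ 2 * iS
/-- inverse of `1 - u` -/
noncomputable def wS : PowerSeries ℚ := (1 - uS)⁻¹

lemma iS_mul : (1 - X ^ 2) * iS = 1 := PowerSeries.mul_inv_cancel _ (by simp)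
lemma jS_mul : (1 + X ^ 2) * jS = 1 := PowerSeries.mul_inv_cancel _ (by simp)
lemma wS_mul : (1 - uS) * wS = 1 := PowerSeries.mul_inv_cancel _ (by simp [uS])

lemma uS_mul : (1 - X) * uS = X * (1 + X) := by
  rw [uS, ← pw_one_mul]; ring

lemma one_sub_X_ne : (1 - X : PowerSeries ℚ) ≠ 0 := by
  intro h
  have := congrArg (coeff 0) h
  simp at this

lemma one_sub_X2_ne : (1 - X ^ 2 : PowerSeries ℚ) ≠ 0 := by
  intro h
  have := congrArg (coeff 0) h
  simp at this

lemma gS_mul : gS * (1 + uS) = (1 + aS) * (1 - uS) := by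
  apply mul_left_cancel₀ one_sub_X_ne
  apply mul_left_cancel₀ one_sub_X2_ne
  have h1 : (1 - X) * (1 + uS) = 1 + X ^ 2 := by linear_combination uS_mul
  have h2 : (1 - X) * (1 - uS) = 1 - 2 * X - X ^ 2 := by linear_combination -uS_mul
  have h3 : (1 - X ^ 2) * (1 + aS) = 1 + 2 * X - X ^ 2 := by
    rw [aS]; linear_combination 2 * X * iS_mul
  have h4 : (1 - X ^ 2) * gS * (1 + X ^ 2) = (1 - X ^ 2) ^ 2 - 4 * X ^ 2 := by
    rw [gS]
    linear_combination ((1 - X ^ 2) ^ 2 - 4 * X ^ 2) * ((1 + X ^ 2) * jS) * iS_mul +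
      ((1 - X ^ 2) ^ 2 - 4 * X ^ 2) * jS_mul
  linear_combination (1 - X ^ 2) * gS * h1 + h4 - (1 - X ^ 2) * (1 + aS) * h2 -
    (1 - 2 * X - X ^ 2) * h3

lemma C_two : C (2 : ℚ) = (2 : PowerSeries ℚ) := map_ofNat C 2
lemma C_four : C (4 : ℚ) = (4 : PowerSeries ℚ) := map_ofNat C 4

lemma two_C_half : (2 : PowerSeries ℚ) * C (1 / 2) = 1 := by
  rw [← C_two, ← map_mul]; norm_num

lemma AS_mul : AS * pw 1 = C (1 / 2) * (1 + uS) ^ 2 := by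
  apply mul_left_cancel₀ one_sub_X_ne
  apply mul_left_cancel₀ one_sub_X_ne
  have h1 : (1 - X) * (1 + uS) = 1 + X ^ 2 := by linear_combination uS_mul
  have h3 : (1 - X) * ((1 - X) * (AS * pw 1)) = C (1 / 2) * (1 + X ^ 2) ^ 2 := by
    rw [AS]
    linear_combination (1 - X) * (C (1 / 2) * (1 + X ^ 2) ^ 2 * iS) * pw_one_mul +
      C (1 / 2) * (1 + X ^ 2) ^ 2 * iS_mul
  rw [h3]
  linear_combination -C (1 / 2) * ((1 - X) * (1 + uS) + (1 + X ^ 2)) * h1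

lemma pw_nat (j : ℕ) : pw 1 ^ j = pw j := by
  induction j with
  | zero => simp [pw_zero]
  | succ j ih => rw [pow_succ, ih, Nat.cast_succ, pw_add]

lemma uS_pow (j : ℕ) : uS ^ j = X ^ j * pw j := by rw [uS, mul_pow, pw_nat]

lemma AS_pow (k : ℕ) : AS ^ k * pw k = C ((1 / 2) ^ k) * (1 + uS) ^ (2 * k) := by
  rw [← pw_nat, ← mul_pow, AS_mul, mul_pow, ← pow_mul, map_pow]

lemma AS_pow' (k : ℕ) : AS ^ k = C ((1 / 2) ^ k) * (1 + uS) ^ (2 * k) * pw (-k) := by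
  rw [← AS_pow, mul_assoc, ← pw_add, add_neg_cancel, pw_zero, mul_one]

lemma x_deriv (s : ℚ) : X * derivative ℚ (pw s) = C s * aS * pw s := by
  apply mul_left_cancel₀ one_sub_X2_ne
  rw [aS]
  have h := pw_ode s
  rw [map_mul, C_two] at h
  linear_combination X * h - C s * 2 * X * pw s * iS_mul

lemma lagr0 (d : ℕ) (hd : 0 < d) : coeff d ((1 + aS) * pw (-d)) = 0 := by
  have h := congrArg (coeff d) (x_deriv (-(d : ℚ)))
  obtain ⟨e, rfl⟩ : ∃ e, d = e + 1 := ⟨d - 1, by omega⟩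
  rw [coeff_succ_X_mul, coeff_derivative, mul_assoc, coeff_C_mul] at h
  rw [add_mul, one_mul, map_add]
  have h2 : ((e : ℚ) + 1) ≠ 0 := by positivity
  apply mul_left_cancel₀ h2
  push_cast at h ⊢
  linear_combination h

lemma lagr (n j : ℕ) : coeff n ((1 + aS) * pw (-n) * uS ^ j) = if n = j then 1 else 0 := by
  rw [uS_pow, show (1 + aS) * pw (-n) * (X ^ j * pw j) = X ^ j * ((1 + aS) * (pw (-n) * pw j)) by ring,
    ← pw_add, coeff_X_pow_mul']
  split_ifs with h1 h2 h2
  · subst h2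
    rw [neg_add_cancel, pw_zero, Nat.sub_self]
    simp [aS]
  · have : (-(n : ℚ) + j) = - ((n - j : ℕ) : ℚ) := by
      rw [Nat.cast_sub h1]; ring
    rw [this, lagr0 _ (by omega)]
  · omega
  · rfl

lemma lagr_poly (n : ℕ) (D : Polynomial ℚ) :
    coeff n ((1 + aS) * pw (-n) * Polynomial.aeval uS D) = D.coeff n := by
  induction D using Polynomial.induction_on' with
  | add p q hp hq => rw [map_add, mul_add, map_add, hp, hq, Polynomial.coeff_add]
  | monomial j c =>
    rw [Polynomial.aeval_monomial, Polynomial.coeff_monomial, ← mul_assoc, mul_comm _ (algebraMap _ _ c),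
      mul_assoc, PowerSeries.algebraMap_apply, Algebra.algebraMap_self, RingHom.id_apply,
      coeff_C_mul, lagr]
    simp [eq_comm]

lemma sum_K (m j : ℕ) (hj : j < m) :
    (∑ i ∈ Finset.range m, C (Kf i j) * uS ^ i) = 2 * uS ^ j * (1 + uS) * wS - uS ^ m * (4 * wS) := by
  have key : (∑ i ∈ Finset.range m, C (Kf i j) * uS ^ i) * (1 - uS) =
      2 * uS ^ j * (1 + uS) - 4 * uS ^ m := by
    induction m, hj using Nat.le_induction with
    | base =>
      rw [Finset.sum_range_succ, Finset.sum_eq_zero]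
      · simp [Kf, C_two]
        ring
      · intro i hi
        have h1 := Finset.mem_range.1 hi
        simp [Kf, show ¬ j < i by omega, show ¬ j = i by omega]
    | succ m hm ih =>
      rw [Finset.sum_range_succ, add_mul, ih]
      have : Kf m j = 4 := by simp [Kf, show j < m by omega]
      rw [this, C_four]
      ring
  linear_combination wS * key - (∑ i ∈ Finset.range m, C (Kf i j) * uS ^ i) * wS_mul

lemma coeff_u_pow_mul (m p : ℕ) (h : p < m) (Y : PowerSeries ℚ) : coeff p (Y * uS ^ m) = 0 := by
  rw [uS_pow, show Y * (X ^ m * pw m) = X ^ m * (Y * pw m) by ring, coeff_X_pow_mul', if_neg (by omega)]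

lemma sum_refl (D : Polynomial ℚ) (k ν m : ℕ) (ε : ℚ) (hk : k ≤ ν) (hm : ν + k < m)
    (hd : D.natDegree ≤ 2 * k) (hr : Polynomial.reflect (2 * k) D = Polynomial.C ε * D) :
    ∑ j ∈ Finset.range m, Polynomial.C ((Polynomial.X ^ j * D).coeff (ν + k)) * Polynomial.X ^ j =
      Polynomial.C ε * (Polynomial.X ^ (ν - k) * D) := by
  ext i
  rw [Polynomial.finsetSum_coeff, Polynomial.coeff_C_mul]
  simp only [Polynomial.coeff_C_mul, Polynomial.coeff_X_pow, Polynomial.coeff_X_pow_mul']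
  simp only [mul_ite, mul_one, mul_zero, Finset.sum_ite_eq, Finset.mem_range]
  have hr' : ∀ i ≤ 2 * k, D.coeff (2 * k - i) = ε * D.coeff i := by
    intro i hi
    have := congrArg (fun f => Polynomial.coeff f i) hr
    simpa [Polynomial.coeff_reflect, Polynomial.revAt_le hi] using this
  have hz : ∀ i, 2 * k < i → D.coeff i = 0 := fun i hi =>
    Polynomial.coeff_eq_zero_of_natDegree_lt (by omega)
  by_cases h1 : ν - k ≤ i
  · rw [if_pos h1]
    by_cases h2 : i ≤ ν + k
    · rw [if_pos (by omega), if_pos h2, ← hr' _ (by omega)]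
      congr 1
      omega
    · rw [hz (i - (ν - k)) (by omega)]
      simp [h2]
  · rw [if_neg h1, if_pos (by omega), if_pos (by omega), hz _ (by omega)]

lemma refl_pow (r : ℕ) : Polynomial.reflect r ((1 + Polynomial.X : Polynomial ℚ) ^ r) =
    (1 + Polynomial.X) ^ r ∧ ((1 + Polynomial.X : Polynomial ℚ) ^ r).natDegree ≤ r := by
  have hd : (1 + Polynomial.X : Polynomial ℚ).natDegree ≤ 1 := by
    rw [add_comm]; exact (Polynomial.natDegree_X_add_C (1 : ℚ)).le
  have h1 : Polynomial.reflect 1 (1 + Polynomial.X : Polynomial ℚ) = 1 + Polynomial.X := by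
    rw [Polynomial.reflect_add, Polynomial.reflect_one]
    have := Polynomial.reflect_C_mul_X_pow (c := (1 : ℚ)) 1 1
    simp at this
    simp [add_comm, this]
  induction r with
  | zero => simp
  | succ r ih =>
    refine ⟨?_, ?_⟩
    · rw [pow_succ, Polynomial.reflect_mul _ _ ih.2 hd, ih.1, h1]
    · rw [pow_succ]; exact Polynomial.natDegree_mul_le.trans (add_le_add ih.2 hd)

lemma refl_D (k : ℕ) (hk : 0 < k) :
    Polynomial.reflect (2 * k) ((1 - Polynomial.X) * (1 + Polynomial.X : Polynomial ℚ) ^ (2 * k - 1)) =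
    Polynomial.C (-1) * ((1 - Polynomial.X) * (1 + Polynomial.X : Polynomial ℚ) ^ (2 * k - 1)) ∧
    ((1 - Polynomial.X) * (1 + Polynomial.X : Polynomial ℚ) ^ (2 * k - 1)).natDegree ≤ 2 * k := by
  have hd : (1 - Polynomial.X : Polynomial ℚ).natDegree ≤ 1 := by
    apply (Polynomial.natDegree_sub_le _ _).trans
    simp
  have h1 : Polynomial.reflect 1 (1 - Polynomial.X : Polynomial ℚ) = Polynomial.X - 1 := by
    rw [Polynomial.reflect_sub, Polynomial.reflect_one]
    have := Polynomial.reflect_C_mul_X_pow (c := (1 : ℚ)) 1 1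
    simp at this
    simp [this]
  have e : 2 * k = 1 + (2 * k - 1) := by omega
  constructor
  · conv_lhs => rw [e]
    rw [show 1 + (2 * k - 1) - 1 = 2 * k - 1 by omega, Polynomial.reflect_mul _ _ hd (refl_pow _).2,
      (refl_pow _).1, h1]
    simp
    ring
  · exact Polynomial.natDegree_mul_le.trans ((add_le_add hd (refl_pow _).2).trans (by omega))

/-- the bilinear form -/
noncomputable def BB (m ν : ℕ) (p q : ℕ) (Φ Ψ : PowerSeries ℚ) : ℚ :=
  ∑ i ∈ Finset.range m, ∑ j ∈ Finset.range m,
    Kf i j * coeff p (Φ * pw (-ν) * uS ^ i) * coeff q (Ψ * pw (-ν) * uS ^ j)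

lemma AS_pow_cancel (ν k : ℕ) (hk : k ≤ ν) :
    C ((1 / 2) ^ k) * pw (-ν) * (uS ^ (ν - k) * (1 + uS) ^ (2 * k)) = X ^ (ν - k) * AS ^ k := by
  have h1 : pw ((ν - k : ℕ) : ℚ) * pw k * pw (-ν) = 1 := by
    rw [← pw_add, ← pw_add, ← pw_zero]
    congr 1
    rw [Nat.cast_sub hk]
    ring
  rw [uS_pow]
  linear_combination -pw (-ν) * X ^ (ν - k) * pw ((ν - k : ℕ) : ℚ) * AS_pow k + X ^ (ν - k) * AS ^ k * h1

lemma lemA (m ν k q : ℕ) (hk : k ≤ ν) (hm : ν + k < m) (Ψ : PowerSeries ℚ) :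
    BB m ν (ν + k) q (gS * AS ^ k) Ψ = 2 * coeff q (Ψ * (X ^ (ν - k) * AS ^ k)) := by
  have h1 : ∀ j ∈ Finset.range m, ∑ i ∈ Finset.range m,
      Kf i j * coeff (ν + k) (gS * AS ^ k * pw (-ν) * uS ^ i) =
      2 * ((1 / 2) ^ k * (Polynomial.X ^ j * (1 + Polynomial.X : Polynomial ℚ) ^ (2 * k)).coeff (ν + k)) := by
    intro j hj
    have e : ∑ i ∈ Finset.range m, Kf i j * coeff (ν + k) (gS * AS ^ k * pw (-ν) * uS ^ i) =
        coeff (ν + k) (gS * AS ^ k * pw (-ν) * ∑ i ∈ Finset.range m, C (Kf i j) * uS ^ i) := by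
      rw [Finset.mul_sum, map_sum]
      refine Finset.sum_congr rfl fun i _ => ?_
      rw [← coeff_C_mul]
      congr 1
      ring
    have e2 : gS * AS ^ k * pw (-ν) * ∑ i ∈ Finset.range m, C (Kf i j) * uS ^ i =
        C (2 * (1 / 2) ^ k) * ((1 + aS) * pw (-(ν + k : ℕ)) *
          Polynomial.aeval uS (Polynomial.X ^ j * (1 + Polynomial.X : Polynomial ℚ) ^ (2 * k))) -
        (gS * AS ^ k * pw (-ν) * (4 * wS)) * uS ^ m := by
      rw [sum_K m j (Finset.mem_range.1 hj), show (-((ν + k : ℕ) : ℚ)) = -k + -ν by push_cast; ring,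
        pw_add, map_mul, C_two]
      simp only [map_mul, map_pow, map_add, map_one, Polynomial.aeval_X]
      rw [← map_pow]
      have hA := AS_pow' k
      linear_combination (AS ^ k * pw (-ν) * 2 * uS ^ j * wS) * gS_mul +
        AS ^ k * pw (-ν) * 2 * uS ^ j * (1 + aS) * wS_mul +
        pw (-ν) * 2 * uS ^ j * (1 + aS) * hA
    rw [e, e2, map_sub, coeff_C_mul, lagr_poly, coeff_u_pow_mul m _ hm]
    ring
  have h2 := sum_refl ((1 + Polynomial.X : Polynomial ℚ) ^ (2 * k)) k ν m 1 hk hm (refl_pow _).2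
    (by rw [(refl_pow _).1]; simp)
  have h3 := congrArg (Polynomial.aeval uS) h2
  rw [map_sum] at h3
  simp only [map_mul, map_pow, map_add, map_one, Polynomial.aeval_X, Polynomial.aeval_C, one_mul,
    PowerSeries.algebraMap_apply, Algebra.algebraMap_self, RingHom.id_apply] at h3
  rw [BB, Finset.sum_comm]
  have h4 : ∀ j ∈ Finset.range m, ∑ i ∈ Finset.range m,
      Kf i j * coeff (ν + k) (gS * AS ^ k * pw (-ν) * uS ^ i) * coeff q (Ψ * pw (-ν) * uS ^ j) =
      coeff q (C (2 * (1 / 2) ^ k) * Ψ * pw (-ν) *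
        (C ((Polynomial.X ^ j * (1 + Polynomial.X : Polynomial ℚ) ^ (2 * k)).coeff (ν + k)) * uS ^ j)) := by
    intro j hj
    rw [← Finset.sum_mul, h1 j hj, ← mul_assoc, ← coeff_C_mul]
    congr 1
    rw [map_mul]
    ring
  rw [Finset.sum_congr rfl h4, ← map_sum, ← Finset.mul_sum, h3, ← coeff_C_mul, C_two]
  congr 1
  rw [map_mul, C_two]
  linear_combination 2 * Ψ * AS_pow_cancel ν k hk

lemma lemB (m ν k p : ℕ) (hk : k ≤ ν) (hk0 : 0 < k) (hm : ν + k < m) (hp : p < m) (Φ : PowerSeries ℚ) :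
    BB m ν p (ν + k) Φ (gS * AS ^ k) = -2 * coeff p (Φ * (X ^ (ν - k) * AS ^ k)) := by
  have epow : (1 + uS) ^ (2 * k) = (1 + uS) * (1 + uS) ^ (2 * k - 1) := by
    rw [← pow_succ']; congr 1; omega
  set D : Polynomial ℚ := (1 - Polynomial.X) * (1 + Polynomial.X) ^ (2 * k - 1) with hD
  have h1 : ∀ j, coeff (ν + k) (gS * AS ^ k * pw (-ν) * uS ^ j) =
      (1 / 2) ^ k * (Polynomial.X ^ j * D).coeff (ν + k) := by
    intro j
    rw [← lagr_poly, ← coeff_C_mul]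
    congr 1
    rw [show (-((ν + k : ℕ) : ℚ)) = -k + -ν by push_cast; ring, pw_add]
    simp only [hD, map_mul, map_pow, map_add, map_sub, map_one, Polynomial.aeval_X]
    rw [← map_pow]
    have hA := AS_pow' k
    rw [epow] at hA
    linear_combination gS * pw (-ν) * uS ^ j * hA +
      C ((1 / 2) ^ k) * pw (-k) * pw (-ν) * uS ^ j * (1 + uS) ^ (2 * k - 1) * gS_mul
  have h2 := sum_refl D k ν m (-1) hk hm (refl_D k hk0).2 (refl_D k hk0).1
  have h3 := congrArg (Polynomial.aeval uS) h2
  rw [map_sum] at h3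
  simp only [map_mul, map_pow, Polynomial.aeval_X, Polynomial.aeval_C,
    PowerSeries.algebraMap_apply, Algebra.algebraMap_self, RingHom.id_apply] at h3
  rw [BB, Finset.sum_comm]
  have h4 : ∀ j ∈ Finset.range m, ∑ i ∈ Finset.range m,
      Kf i j * coeff p (Φ * pw (-ν) * uS ^ i) * coeff (ν + k) (gS * AS ^ k * pw (-ν) * uS ^ j) =
      coeff p (C (2 * (1 / 2) ^ k) * Φ * pw (-ν) * (1 + uS) * wS *
        (C ((Polynomial.X ^ j * D).coeff (ν + k)) * uS ^ j)) := by
    intro j hj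
    rw [h1, ← Finset.sum_mul]
    have e : ∑ i ∈ Finset.range m, Kf i j * coeff p (Φ * pw (-ν) * uS ^ i) =
        coeff p (Φ * pw (-ν) * ∑ i ∈ Finset.range m, C (Kf i j) * uS ^ i) := by
      rw [Finset.mul_sum, map_sum]
      refine Finset.sum_congr rfl fun i _ => ?_
      rw [← coeff_C_mul]
      congr 1
      ring
    rw [e, sum_K m j (Finset.mem_range.1 hj), mul_sub,
      show Φ * pw (-ν) * (uS ^ m * (4 * wS)) = (Φ * pw (-ν) * (4 * wS)) * uS ^ m by ring,
      map_sub, coeff_u_pow_mul m _ hp, sub_zero, mul_comm, ← coeff_C_mul]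
    congr 1
    rw [map_mul, map_mul, C_two]
    ring
  rw [Finset.sum_congr rfl h4, ← map_sum, ← Finset.mul_sum, h3, ← coeff_C_mul, show C (-2 : ℚ) = (-2 : PowerSeries ℚ) by rw [map_neg, C_two]]
  congr 1
  rw [map_mul, C_two, hD]
  simp only [map_mul, map_pow, map_add, map_sub, map_one, Polynomial.aeval_X, map_neg]
  rw [← map_pow]
  have hc := AS_pow_cancel ν k hk
  rw [epow] at hc
  linear_combination -2 * Φ * hc - 2 * C ((1 / 2) ^ k) * Φ * pw (-ν) * (1 + uS) * uS ^ (ν - k) * (1 + uS) ^ (2 * k - 1) * wS_mul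

end series
end ASTProof

namespace ASTProof

section divis
open PowerSeries

/-- even power series -/
def Ev (f : PowerSeries ℚ) : Prop := evalNegHom f = f

lemma Ev.odd {f : PowerSeries ℚ} (h : Ev f) (n : ℕ) (hn : Odd n) : coeff n f = 0 := by
  have := congrArg (coeff n) h
  rw [evalNegHom, coeff_rescale, hn.neg_one_pow] at this
  linarith

lemma Ev.mul {f g : PowerSeries ℚ} (hf : Ev f) (hg : Ev g) : Ev (f * g) := by
  unfold Ev at *; rw [map_mul, hf, hg]

lemma Ev.pow {f : PowerSeries ℚ} (hf : Ev f) (k : ℕ) : Ev (f ^ k) := by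
  unfold Ev at *; rw [map_pow, hf]

lemma Ev.one : Ev 1 := by unfold Ev; rw [map_one]

lemma Ev.add {f g : PowerSeries ℚ} (hf : Ev f) (hg : Ev g) : Ev (f + g) := by
  unfold Ev at *; rw [map_add, hf, hg]

lemma Ev.sub {f g : PowerSeries ℚ} (hf : Ev f) (hg : Ev g) : Ev (f - g) := by
  unfold Ev at *; rw [map_sub, hf, hg]

lemma Ev.C (c : ℚ) : Ev (PowerSeries.C c) := by
  unfold Ev; ext n
  rw [evalNegHom, coeff_rescale, coeff_C]
  split_ifs with h <;> simp [h]

lemma Ev.X2 : Ev (X ^ 2) := by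
  unfold Ev; rw [map_pow, evalNegHom_X]; ring

lemma Ev.inv {f g : PowerSeries ℚ} (hf : Ev f) (h : f * g = 1) : Ev g := by
  unfold Ev at *
  have h2 := congrArg evalNegHom h
  rw [map_mul, hf, map_one] at h2
  calc evalNegHom g = (f * g) * evalNegHom g := by rw [h, one_mul]
    _ = g * (f * evalNegHom g) := by ring
    _ = g := by rw [h2, mul_one]

lemma iS_ev : Ev iS := (Ev.one.sub Ev.X2).inv iS_mul
lemma jS_ev : Ev jS := (Ev.one.add Ev.X2).inv jS_mul
lemma gS_ev : Ev gS := by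
  unfold gS
  rw [← C_four]
  exact (((Ev.one.sub Ev.X2).pow 2).sub ((Ev.C 4).mul Ev.X2)).mul iS_ev |>.mul jS_ev
lemma AS_ev : Ev AS := by
  unfold AS
  exact ((Ev.C _).mul ((Ev.one.add Ev.X2).pow 2)).mul iS_ev

lemma Ev.coeff_X {f : PowerSeries ℚ} (h : Ev f) (n r : ℕ) (hn : Odd (n + r)) :
    coeff n (f * X ^ r) = 0 := by
  rw [coeff_mul_X_pow']
  split_ifs with h1
  · exact h.odd _ (by rw [Nat.odd_sub h1]; rw [Nat.odd_add] at hn; exact hn)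
  · rfl

lemma iS_zero : coeff 0 iS = 1 := by
  have := congrArg (coeff 0) iS_mul
  simpa [sub_mul] using this
lemma jS_zero : coeff 0 jS = 1 := by
  have := congrArg (coeff 0) jS_mul
  simpa [add_mul] using this
lemma gS_zero : coeff 0 gS = 1 := by
  have h1 := iS_zero
  have h2 := jS_zero
  simp at h1 h2
  simp [gS, h1, h2]
lemma AS_zero : coeff 0 AS = 1 / 2 := by
  have h1 := iS_zero
  simp at h1
  simp [AS, h1]

/-- row series -/
noncomputable def PhiS (ν p : ℕ) : PowerSeries ℚ := if ν ≤ p ∧ p ≤ 2 * ν then gS * AS ^ (p - ν) else 1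
/-- column series -/
noncomputable def PsiS (ν p : ℕ) : PowerSeries ℚ := if ν < p ∧ p ≤ 2 * ν then gS * AS ^ (p - ν) else 1

lemma PhiS_ev (ν p : ℕ) : Ev (PhiS ν p) := by
  unfold PhiS; split_ifs
  · exact gS_ev.mul (AS_ev.pow _)
  · exact Ev.one
lemma PsiS_ev (ν p : ℕ) : Ev (PsiS ν p) := by
  unfold PsiS; split_ifs
  · exact gS_ev.mul (AS_ev.pow _)
  · exact Ev.one

lemma PhiS_zero (ν p : ℕ) : coeff 0 (PhiS ν p) ≠ 0 := by
  have h1 := gS_zero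
  have h2 := AS_zero
  unfold PhiS; split_ifs
  · simp at h1 h2 ⊢
    simp [h1, h2]
  · simp
lemma PsiS_zero (ν p : ℕ) : coeff 0 (PsiS ν p) ≠ 0 := by
  have h1 := gS_zero
  have h2 := AS_zero
  unfold PsiS; split_ifs
  · simp at h1 h2 ⊢
    simp [h1, h2]
  · simp

/-- derivative of the power at zero -/
noncomputable def ell : PowerSeries ℚ := PowerSeries.mk fun a => (Polynomial.derivative (fpoly a)).eval 0

lemma deriv_fpoly (a : ℕ) (s : ℚ) :
    (Polynomial.derivative (fpoly a)).eval s = coeff a (ell * pw s) := by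
  have h : (fpoly a).comp (Polynomial.X + Polynomial.C s) =
      ∑ ij ∈ Finset.HasAntidiagonal.antidiagonal a, fpoly ij.1 * Polynomial.C ((fpoly ij.2).eval s) := by
    apply Polynomial.funext
    intro t
    have h2 := congrArg (coeff a) (pw_add t s)
    rw [coeff_mul] at h2
    simp only [pw, coeff_mk] at h2
    rw [Polynomial.eval_comp, Polynomial.eval_finsetSum]
    simp [h2]
  have h3 := congrArg (fun f => (Polynomial.derivative f).eval 0) h
  simp only [Polynomial.derivative_comp, Polynomial.derivative_sum, Polynomial.eval_finsetSum] at h3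
  rw [coeff_mul]
  simpa [ell, pw] using h3

lemma rp_eval' (k a ν : ℕ) : (rp k a).eval (-(ν : ℚ)) = coeff a (pw (-ν) * uS ^ k) := by
  rw [rp_eval, uS_pow, show pw (-ν) * (X ^ k * pw k) = X ^ k * (pw (-ν) * pw k) by ring,
    coeff_X_pow_mul', ← pw_add]

lemma rp_deriv (k a ν : ℕ) : (Polynomial.derivative (rp k a)).eval (-(ν : ℚ)) =
    coeff a (ell * (pw (-ν) * uS ^ k)) := by
  rw [uS_pow, show ell * (pw (-ν) * (X ^ k * pw k)) = X ^ k * (ell * (pw (-ν) * pw k)) by ring,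
    coeff_X_pow_mul', ← pw_add, rp]
  split_ifs with h
  · rw [Polynomial.derivative_comp]
    simp [deriv_fpoly]
  · simp

/-- triangular weights -/
noncomputable def Lw (Φ : ℕ → PowerSeries ℚ) (α α' : ℕ) : ℚ :=
  if α' ≤ α then coeff (2 * α - 2 * α') (Φ α) else 0

lemma Lw_conv (N : ℕ) (Φ : ℕ → PowerSeries ℚ) (α δ : ℕ) (hα : α < N) (hδ : δ ≤ 1)
    (hΦ : Ev (Φ α)) (Y : PowerSeries ℚ) :
    ∑ α' : Fin N, Lw Φ α α' * coeff (2 * (α' : ℕ) + δ) Y = coeff (2 * α + δ) (Φ α * Y) := by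
  rw [Fin.sum_univ_eq_sum_range (fun a => Lw Φ α a * coeff (2 * a + δ) Y), mul_comm (Φ α),
    coeff_mul, Finset.Nat.sum_antidiagonal_eq_sum_range_succ (fun i j => coeff i Y * coeff j (Φ α))]
  have h1 : ∑ a ∈ Finset.range N, Lw Φ α a * coeff (2 * a + δ) Y =
      ∑ a ∈ Finset.range (α + 1), Lw Φ α a * coeff (2 * a + δ) Y := by
    symm
    apply Finset.sum_subset
    · intro a; simp; omega
    · intro a _ h
      simp only [Finset.mem_range] at h
      rw [Lw, if_neg (by omega), zero_mul]
  have h2 : ∑ i ∈ Finset.range (2 * α + δ).succ, coeff i Y * coeff (2 * α + δ - i) (Φ α) =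
      ∑ i ∈ (Finset.range (α + 1)).image (fun a => 2 * a + δ),
        coeff i Y * coeff (2 * α + δ - i) (Φ α) := by
    symm
    apply Finset.sum_subset
    · intro a; simp only [Finset.mem_image, Finset.mem_range]; rintro ⟨b, hb, rfl⟩; omega
    · intro a ha h
      simp only [Finset.mem_image, Finset.mem_range, not_exists, not_and] at h ha
      rw [hΦ.odd, mul_zero]
      rw [Nat.odd_iff]
      by_contra hc
      have := h ((a - δ) / 2)
      omega
  rw [h1, h2, Finset.sum_image (by intro a _ b _ h; simpa using h)]
  refine Finset.sum_congr rfl fun a ha => ?_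
  have := Finset.mem_range.1 ha
  rw [Lw, if_pos (by omega), mul_comm]
  congr 3
  omega

/-- transformed matrix -/
noncomputable def MM (N ν : ℕ) (α β : Fin N) : Polynomial ℚ :=
  ∑ k ∈ Finset.range (2 * N), ∑ j ∈ Finset.range (2 * N), Polynomial.C (Kf k j) *
    (∑ α' : Fin N, Polynomial.C (Lw (fun a => PhiS ν (2 * a + 1)) α α') * rp k (2 * (α' : ℕ) + 1)) *
    (∑ β' : Fin N, Polynomial.C (Lw (fun a => PsiS ν (2 * a)) β β') * rp j (2 * (β' : ℕ)))

lemma MM_eq (N ν : ℕ) : Matrix.of (MM N ν) =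
    (Matrix.of fun α α' : Fin N => Polynomial.C (Lw (fun a => PhiS ν (2 * a + 1)) α α')) * Qp N *
    (Matrix.of fun β β' : Fin N => Polynomial.C (Lw (fun a => PsiS ν (2 * a)) β β')).transpose := by
  ext1 α β
  simp only [Matrix.mul_apply, Matrix.of_apply, Matrix.transpose_apply, MM, Qp]
  simp only [Finset.mul_sum, Finset.sum_mul]
  have sw : ∀ F : ℕ → ℕ → Fin N → Fin N → Polynomial ℚ,
      ∑ k ∈ Finset.range (2 * N), ∑ j ∈ Finset.range (2 * N), ∑ b, ∑ a, F k j b a =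
      ∑ b, ∑ a, ∑ k ∈ Finset.range (2 * N), ∑ j ∈ Finset.range (2 * N), F k j b a := by
    intro F
    calc _ = ∑ k ∈ Finset.range (2 * N), ∑ b, ∑ a, ∑ j ∈ Finset.range (2 * N), F k j b a := by
          refine Finset.sum_congr rfl fun k _ => ?_
          rw [Finset.sum_comm]
          exact Finset.sum_congr rfl fun b _ => Finset.sum_comm
      _ = _ := by
          rw [Finset.sum_comm]
          exact Finset.sum_congr rfl fun b _ => Finset.sum_comm
  rw [sw]
  refine Finset.sum_congr rfl fun b _ => Finset.sum_congr rfl fun a _ =>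
    Finset.sum_congr rfl fun k _ => Finset.sum_congr rfl fun j _ => ?_
  ring

lemma BB_congr_eval (N ν : ℕ) (α β : Fin N) :
    (MM N ν α β).eval (-(ν : ℚ)) =
      BB (2 * N) ν (2 * α + 1) (2 * β) (PhiS ν (2 * α + 1)) (PsiS ν (2 * β)) := by
  rw [MM, BB, Polynomial.eval_finsetSum]
  refine Finset.sum_congr rfl fun k _ => ?_
  rw [Polynomial.eval_finsetSum]
  refine Finset.sum_congr rfl fun j _ => ?_
  rw [Polynomial.eval_mul, Polynomial.eval_mul, Polynomial.eval_finsetSum, Polynomial.eval_finsetSum]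
  simp only [Polynomial.eval_mul, Polynomial.eval_C, rp_eval']
  have h1 := Lw_conv N (fun a => PhiS ν (2 * a + 1)) α 1 α.2 le_rfl (PhiS_ev _ _) (pw (-ν) * uS ^ k)
  have h2 := Lw_conv N (fun a => PsiS ν (2 * a)) β 0 β.2 (by omega) (PsiS_ev _ _) (pw (-ν) * uS ^ j)
  simp only [add_zero] at h2
  rw [h1, h2, mul_assoc (PhiS _ _), mul_assoc (PsiS _ _)]

lemma BB_congr_deriv (N ν : ℕ) (α β : Fin N) :
    (Polynomial.derivative (MM N ν α β)).eval (-(ν : ℚ)) =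
      BB (2 * N) ν (2 * α + 1) (2 * β) (PhiS ν (2 * α + 1) * ell) (PsiS ν (2 * β)) +
      BB (2 * N) ν (2 * α + 1) (2 * β) (PhiS ν (2 * α + 1)) (PsiS ν (2 * β) * ell) := by
  rw [MM, BB, BB, Polynomial.derivative_sum, Polynomial.eval_finsetSum, ← Finset.sum_add_distrib]
  refine Finset.sum_congr rfl fun k _ => ?_
  rw [Polynomial.derivative_sum, Polynomial.eval_finsetSum, ← Finset.sum_add_distrib]
  refine Finset.sum_congr rfl fun j _ => ?_
  rw [mul_assoc (Polynomial.C (Kf k j)), Polynomial.derivative_C_mul, Polynomial.derivative_mul,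
    Polynomial.derivative_sum, Polynomial.derivative_sum]
  simp only [Polynomial.eval_mul, Polynomial.eval_add, Polynomial.eval_finsetSum, Polynomial.eval_C,
    Polynomial.derivative_C_mul, rp_eval', rp_deriv]
  have h1 := Lw_conv N (fun a => PhiS ν (2 * a + 1)) α 1 α.2 le_rfl (PhiS_ev _ _) (pw (-ν) * uS ^ k)
  have h2 := Lw_conv N (fun a => PsiS ν (2 * a)) β 0 β.2 (by omega) (PsiS_ev _ _) (pw (-ν) * uS ^ j)
  have h3 := Lw_conv N (fun a => PhiS ν (2 * a + 1)) α 1 α.2 le_rfl (PhiS_ev _ _) (ell * (pw (-ν) * uS ^ k))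
  have h4 := Lw_conv N (fun a => PsiS ν (2 * a)) β 0 β.2 (by omega) (PsiS_ev _ _) (ell * (pw (-ν) * uS ^ j))
  simp only [add_zero] at h2 h4
  rw [h1, h2, h3, h4]
  simp only [mul_assoc]
  ring

/-- row null indicator -/
def nr (ν α : ℕ) : ℕ := if ν ≤ 2 * α + 1 ∧ 2 * α + 1 ≤ 2 * ν then 1 else 0
/-- column null indicator -/
def nc (ν β : ℕ) : ℕ := if ν < 2 * β ∧ 2 * β ≤ 2 * ν then 1 else 0

lemma row_null (N ν : ℕ) (α : Fin N) (h : ν ≤ 2 * (α : ℕ) + 1 ∧ 2 * (α : ℕ) + 1 ≤ 2 * ν) (q : ℕ)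
    (Ψ : PowerSeries ℚ) :
    BB (2 * N) ν (2 * α + 1) q (PhiS ν (2 * α + 1)) Ψ =
      2 * coeff q (Ψ * (X ^ (ν - (2 * α + 1 - ν)) * AS ^ (2 * (α : ℕ) + 1 - ν))) := by
  have := α.2
  have h1 := lemA (2 * N) ν (2 * α + 1 - ν) q (by omega) (by omega) Ψ
  rw [show ν + (2 * (α : ℕ) + 1 - ν) = 2 * α + 1 by omega] at h1
  rw [PhiS, if_pos h, h1]

lemma col_null (N ν : ℕ) (β : Fin N) (h : ν < 2 * (β : ℕ) ∧ 2 * (β : ℕ) ≤ 2 * ν) (p : ℕ) (hp : p < 2 * N)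
    (Φ : PowerSeries ℚ) :
    BB (2 * N) ν p (2 * β) Φ (PsiS ν (2 * β)) =
      -2 * coeff p (Φ * (X ^ (ν - (2 * β - ν)) * AS ^ (2 * (β : ℕ) - ν))) := by
  have := β.2
  have h1 := lemB (2 * N) ν (2 * β - ν) p (by omega) (by omega) (by omega) hp Φ
  rw [show ν + (2 * (β : ℕ) - ν) = 2 * β by omega] at h1
  rw [PsiS, if_pos h, h1]

lemma dvd_one (p : Polynomial ℚ) (a : ℚ) (h : p.eval a = 0) :
    (Polynomial.X - Polynomial.C a) ∣ p := Polynomial.dvd_iff_isRoot.2 h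

lemma dvd_two (p : Polynomial ℚ) (a : ℚ) (h : p.eval a = 0) (h' : (Polynomial.derivative p).eval a = 0) :
    (Polynomial.X - Polynomial.C a) ^ 2 ∣ p := by
  obtain ⟨q, rfl⟩ := dvd_one p a h
  rw [pow_two]
  refine mul_dvd_mul_left _ (dvd_one q a ?_)
  simpa using h'

lemma MM_dvd (N ν : ℕ) (α β : Fin N) :
    (Polynomial.X - Polynomial.C (-(ν : ℚ))) ^ (nr ν α + nc ν β) ∣ MM N ν α β := by
  have hα := α.2
  have hβ := β.2
  have hr : (ν ≤ 2 * (α : ℕ) + 1 ∧ 2 * (α : ℕ) + 1 ≤ 2 * ν) → (MM N ν α β).eval (-(ν : ℚ)) = 0 := by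
    intro h
    rw [BB_congr_eval, row_null N ν α h, show ∀ a b c : PowerSeries ℚ, a * (b * c) = a * c * b by
      intros; ring, ((PsiS_ev _ _).mul (AS_ev.pow _)).coeff_X, mul_zero]
    rw [Nat.odd_iff]
    omega
  have hc : (ν < 2 * (β : ℕ) ∧ 2 * (β : ℕ) ≤ 2 * ν) → (MM N ν α β).eval (-(ν : ℚ)) = 0 := by
    intro h
    rw [BB_congr_eval, col_null N ν β h _ (by omega), show ∀ a b c : PowerSeries ℚ, a * (b * c) = a * c * b by
      intros; ring, ((PhiS_ev _ _).mul (AS_ev.pow _)).coeff_X, mul_zero]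
    rw [Nat.odd_iff]
    omega
  unfold nr nc
  split_ifs with h1 h2 h2
  · refine dvd_two _ _ (hr h1) ?_
    rw [BB_congr_deriv, row_null N ν α h1, col_null N ν β h2 _ (by omega), PhiS, if_pos h1, PsiS, if_pos h2,
      show gS * AS ^ (2 * (α : ℕ) + 1 - ν) * ell * (X ^ (ν - (2 * β - ν)) * AS ^ (2 * (β : ℕ) - ν)) =
        gS * AS ^ (2 * (α : ℕ) + 1 - ν) * AS ^ (2 * (β : ℕ) - ν) * ell * X ^ (ν - (2 * (β : ℕ) - ν)) by ring,
      show gS * AS ^ (2 * (β : ℕ) - ν) * ell * (X ^ (ν - (2 * α + 1 - ν)) * AS ^ (2 * (α : ℕ) + 1 - ν)) =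
        gS * AS ^ (2 * (α : ℕ) + 1 - ν) * AS ^ (2 * (β : ℕ) - ν) * ell * X ^ (ν - (2 * (α : ℕ) + 1 - ν)) by ring,
      coeff_mul_X_pow', coeff_mul_X_pow', if_pos (by omega), if_pos (by omega),
      show 2 * (α : ℕ) + 1 - (ν - (2 * β - ν)) = 2 * β - (ν - (2 * α + 1 - ν)) by omega]
    ring
  · simpa using dvd_one _ _ (hr h1)
  · simpa using dvd_one _ _ (hc h2)
  · simp

lemma det_Lw (N : ℕ) (Φ : ℕ → PowerSeries ℚ) (h : ∀ a, coeff 0 (Φ a) ≠ 0) :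
    IsUnit (Matrix.det (Matrix.of fun α α' : Fin N => Polynomial.C (Lw Φ α α'))) := by
  rw [Matrix.det_of_isLowerTriangular]
  · rw [IsUnit.prod_univ_iff]
    intro i
    rw [Matrix.of_apply, Polynomial.isUnit_C, isUnit_iff_ne_zero]
    simpa [Lw] using h i
  · intro i j hij
    have : (i : ℕ) < j := hij
    rw [Matrix.of_apply, Lw, if_neg (by omega), map_zero]

lemma Qp_dvd (N ν : ℕ) : (Polynomial.X - Polynomial.C (-(ν : ℚ))) ^
    (∑ α ∈ Finset.range N, nr ν α + ∑ β ∈ Finset.range N, nc ν β) ∣ (Qp N).det := by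
  have h1 := congrArg Matrix.det (MM_eq N ν)
  rw [Matrix.det_mul, Matrix.det_mul, Matrix.det_transpose] at h1
  have u1 := det_Lw N (fun a => PhiS ν (2 * a + 1)) (fun a => PhiS_zero _ _)
  have u2 := det_Lw N (fun a => PsiS ν (2 * a)) (fun a => PsiS_zero _ _)
  rw [← (u1.dvd_mul_left), ← u2.dvd_mul_right, ← h1]
  choose G hG using MM_dvd N ν
  have h2 : Matrix.of (MM N ν) = Matrix.of fun α β : Fin N =>
      (Polynomial.X - Polynomial.C (-(ν : ℚ))) ^ nr ν α * (Matrix.of fun α β : Fin N =>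
      (Polynomial.X - Polynomial.C (-(ν : ℚ))) ^ nc ν β * Matrix.of G α β) α β := by
    ext1 α β
    rw [Matrix.of_apply, hG, pow_add, mul_assoc]
    rfl
  rw [h2, Matrix.det_mul_column, Matrix.det_mul_row, ← mul_assoc, Finset.prod_pow_eq_pow_sum,
    Finset.prod_pow_eq_pow_sum, ← pow_add, Fin.sum_univ_eq_sum_range, Fin.sum_univ_eq_sum_range]
  exact dvd_mul_right _ _

end divis
end ASTProof

namespace ASTProof

section concl
open Polynomial

lemma nr_prod (f : ℕ → ℚ[X]) (m j : ℕ) (h : 2 * j + 2 ≤ m) :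
    ∏ i ∈ Finset.range (j + 1), f (i + j + 1) = ∏ ν ∈ Finset.range m, f ν ^ nr ν j := by
  have h1 : ∏ ν ∈ Finset.range m, f ν ^ nr ν j = ∏ ν ∈ Finset.Ico (j + 1) (2 * j + 2), f ν := by
    rw [← Finset.prod_subset (s₁ := Finset.Ico (j + 1) (2 * j + 2))]
    · refine Finset.prod_congr rfl fun ν hν => ?_
      rw [Finset.mem_Ico] at hν
      rw [nr, if_pos (by omega), pow_one]
    · intro ν; simp; omega
    · intro ν _ hν
      rw [Finset.mem_Ico] at hν
      rw [nr, if_neg (by omega), pow_zero]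
  rw [h1, Finset.prod_Ico_eq_prod_range, show 2 * j + 2 - (j + 1) = j + 1 by omega]
  refine Finset.prod_congr rfl fun i _ => ?_
  congr 1; ring

lemma nc_succ (ν j : ℕ) : nc ν (j + 1) = nr ν j := by
  unfold nc nr
  congr 1
  apply propext
  omega

lemma nc_zero (ν : ℕ) : nc ν 0 = 0 := by
  unfold nc; rw [if_neg (by omega)]

lemma nr_prods (f : ℕ → ℚ[X]) (m N : ℕ) (h : 2 * N ≤ m) :
    ∏ j ∈ Finset.range N, ∏ i ∈ Finset.range (j + 1), f (i + j + 1) =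
      ∏ ν ∈ Finset.range m, f ν ^ (∑ j ∈ Finset.range N, nr ν j) := by
  simp only [← Finset.prod_pow_eq_pow_sum]
  rw [Finset.prod_comm]
  refine Finset.prod_congr rfl fun j hj => ?_
  have := Finset.mem_range.1 hj
  exact nr_prod f m j (by omega)

/-- factor -/
noncomputable def fac (ν : ℕ) : ℚ[X] := X - C (-(ν : ℚ))

/-- product of the factors -/
noncomputable def DD (N : ℕ) : ℚ[X] :=
  ∏ j ∈ Finset.range N, ∏ i ∈ Finset.range (j + 1), fac (i + j + 1)

lemma DD_dvd (n : ℕ) : DD n * DD (n + 1) ∣ (Qp (n + 1)).det := by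
  rw [DD, DD, nr_prods fac (2 * (n + 1)) n (by omega), nr_prods fac (2 * (n + 1)) (n + 1) (by omega),
    ← Finset.prod_mul_distrib]
  apply Finset.prod_dvd_of_coprime
  · intro a _ b _ hab
    simp only [Function.onFun, ← pow_add]
    apply IsCoprime.pow
    apply Polynomial.isCoprime_X_sub_C_of_isUnit_sub
    rw [isUnit_iff_ne_zero]
    intro h
    apply hab
    have : (a : ℚ) = b := by linarith
    exact_mod_cast this
  · intro ν _
    have h := Qp_dvd (n + 1) ν
    rw [Finset.sum_range_succ' (nc ν), nc_zero, add_zero, add_comm, pow_add] at h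
    simp only [nc_succ] at h
    exact h

lemma DD_monic (N : ℕ) : (DD N).Monic :=
  monic_prod_of_monic _ _ fun _ _ => monic_prod_of_monic _ _ fun _ _ => monic_X_sub_C _

lemma DD_deg (N : ℕ) : (DD N).natDegree * 2 = N * (N + 1) := by
  rw [DD, natDegree_prod_of_monic _ _ fun _ _ => monic_prod_of_monic _ _ fun _ _ => monic_X_sub_C _]
  have : ∀ j ∈ Finset.range N, (∏ i ∈ Finset.range (j + 1), fac (i + j + 1)).natDegree = j + 1 := by
    intro j _
    rw [natDegree_prod_of_monic _ _ fun _ _ => monic_X_sub_C _]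
    simp only [fac, natDegree_X_sub_C]
    simp
  rw [Finset.sum_congr rfl this]
  clear this
  induction N with
  | zero => simp
  | succ N ih => rw [Finset.sum_range_succ, add_mul, ih]; ring

lemma det_eq (n : ℕ) : (Qp (n + 1)).det =
    DD n * DD (n + 1) * C ((Qp (n + 1)).det.coeff ((n + 1) ^ 2)) := by
  obtain ⟨q, hq⟩ := DD_dvd n
  have hm := (DD_monic n).mul (DD_monic (n + 1))
  have hd : (DD n * DD (n + 1)).natDegree = (n + 1) ^ 2 := by
    rw [(DD_monic n).natDegree_mul (DD_monic (n + 1))]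
    have h1 := DD_deg n
    have h2 := DD_deg (n + 1)
    nlinarith
  have hq0 : q.natDegree = 0 := by
    by_cases h0 : q = 0
    · simp [h0]
    · have h := (Qp_coeff (n + 1)).1
      rw [hq, hm.natDegree_mul' h0, hd] at h
      omega
  obtain ⟨c, rfl⟩ : ∃ c, q = C c := ⟨_, eq_C_of_natDegree_eq_zero hq0⟩
  have hc : (Qp (n + 1)).det.coeff ((n + 1) ^ 2) = c := by
    rw [hq, coeff_mul_C]
    rw [← hd, hm.coeff_natDegree, one_mul]
  rw [hc, hq]

lemma DD_eval (N : ℕ) (l : ℚ) : (∏ j ∈ Finset.range N, ∏ i ∈ Finset.range (j + 1),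
      (2 / (2 * ((i : ℚ) + 1) - 1))) * (DD N).eval ((l - 1) / 2) =
    ∏ j ∈ Finset.range N, ∏ i ∈ Finset.range (j + 1),
          (2 * (((i : ℚ) + 1) + ((j : ℚ) + 1)) + l - 3) / (2 * ((i : ℚ) + 1) - 1) := by
  rw [DD, eval_prod, ← Finset.prod_mul_distrib]
  refine Finset.prod_congr rfl fun j _ => ?_
  rw [eval_prod, ← Finset.prod_mul_distrib]
  refine Finset.prod_congr rfl fun i _ => ?_
  simp [fac]
  ring

end concl
end ASTProof

theorem ast_two_enumeration_even (n l : ℕ) (hl : 2 ≤ l) :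
    ∑ᶠ A : AST (2 * n + 2) l, (2 : ℚ) ^ qStat A =
      2 ^ (n + 1) *
        (∏ j ∈ Finset.range n, ∏ i ∈ Finset.range (j + 1),
          (2 * (((i : ℚ) + 1) + ((j : ℚ) + 1)) + (l : ℚ) - 3) / (2 * ((i : ℚ) + 1) - 1)) *
        (∏ j ∈ Finset.range (n + 1), ∏ i ∈ Finset.range (j + 1),
          (2 * (((i : ℚ) + 1) + ((j : ℚ) + 1)) + (l : ℚ) - 3) / (2 * ((i : ℚ) + 1) - 1)) := by
  rw [ASTProof.ast_det n l hl, ASTProof.det_eq, (ASTProof.Qp_coeff (n + 1)).2, ASTProof.det_lc1,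
    ASTProof.det_lc0, ← ASTProof.DD_eval, ← ASTProof.DD_eval]
  simp only [Polynomial.eval_mul, Polynomial.eval_C]
  ring
end

section
/- Let a ≥ 0 be an integer, define g(a;i,j) = ∑_{m=0}^{i} C(m+j+a, m) C(i+a, m+a) and D_n(a) = det_{0≤i,j≤n-1}( g(a;i,j) + δ_{i,j} ). Then D_{2n}(a)/D_{2n-1}(a) = 2^n ∏_{k=1}^{n} (2(n+k)+a-1)/(n+k) and D_{2n+1}(a)/D_{2n}(a) = 2^{n+1} ∏_{k=1}^{n} (2(n+k)+a-1)/(n+k), and D_1(a) = 2. -/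
/-- `g(a;i,j) = ∑_{m=0}^{i} C(m+j+a, m) C(i+a, m+a)`. -/
def gAnd (a i j : ℕ) : ℚ :=
  ∑ m ∈ Finset.range (i + 1), ((m + j + a).choose m : ℚ) * ((i + a).choose (m + a) : ℚ)

/-- Andrews' determinant `D_N(a) = det_{0≤i,j≤N-1}( g(a;i,j) + δ_{i,j} )`. -/
def DAnd (a N : ℕ) : ℚ :=
  Matrix.det (Matrix.of fun i j : Fin N => gAnd a i j + if i = j then 1 else 0)


theorem gAnd_zero_left (a j : ℕ) : gAnd a 0 j = 1 := by simp [gAnd]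

theorem gAnd_zero_right (a i : ℕ) : gAnd a i 0 = 2 ^ i * ((a + i).choose i : ℚ) := by
  unfold gAnd
  have h : ∀ m ∈ Finset.range (i + 1),
      ((m + 0 + a).choose m : ℚ) * ((i + a).choose (m + a) : ℚ)
        = ((a + i).choose i : ℚ) * (i.choose m : ℚ) := by
    intro m hm
    have hm' : m ≤ i := by simpa [Nat.lt_succ_iff] using hm
    have := Nat.choose_mul (n := i + a) (k := m + a) (s := a) (by omega)
    simp only [Nat.add_sub_cancel] at this
    have e1 : (m + a).choose a = (m + a).choose m := by
      rw [Nat.choose_symm_add]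
    have e2 : (i + a).choose a = (a + i).choose i := by
      rw [add_comm, Nat.choose_symm_add]
    rw [e1, e2] at this
    rw [add_zero, mul_comm]
    exact_mod_cast this
  rw [Finset.sum_congr rfl h, ← Finset.mul_sum]
  have := Nat.sum_range_choose i
  have h2 : ∑ m ∈ Finset.range (i + 1), (i.choose m : ℚ) = 2 ^ i := by exact_mod_cast this
  rw [h2, mul_comm]

/-- auxiliary sum -/
def hAnd (a i j : ℕ) : ℚ :=
  ∑ m ∈ Finset.range i, ((m + j + a + 1).choose m : ℚ) * ((i + a).choose (m + a + 1) : ℚ)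

theorem gAnd_sub (a i j : ℕ) : gAnd a i (j + 1) = gAnd a i j + hAnd a i j := by
  unfold gAnd hAnd
  rw [Finset.sum_range_succ', Finset.sum_range_succ' (n := i),
    add_right_comm (∑ k ∈ Finset.range i, _), ← Finset.sum_add_distrib]
  congr 1
  · refine Finset.sum_congr rfl fun m _ => ?_
    have e : (m + 1 + (j + 1) + a).choose (m + 1)
        = (m + j + a + 1).choose m + (m + 1 + j + a).choose (m + 1) := by
      rw [show m + 1 + (j + 1) + a = (m + j + a + 1) + 1 by ring, Nat.choose_succ_succ',
        show m + 1 + j + a = m + j + a + 1 by ring]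
    rw [e, show m + 1 + a = m + a + 1 by ring]
    push_cast
    ring
  · simp

theorem hAnd_succ (a i j : ℕ) : hAnd a (i + 1) j = hAnd a i j + gAnd a i (j + 1) := by
  unfold gAnd hAnd
  have h0 : ∑ m ∈ Finset.range i, ((m + j + a + 1).choose m : ℚ) * ((i + a).choose (m + a + 1) : ℚ)
    = ∑ m ∈ Finset.range (i + 1), ((m + j + a + 1).choose m : ℚ) * ((i + a).choose (m + a + 1) : ℚ) := by
    rw [Finset.sum_range_succ, Nat.choose_eq_zero_of_lt (show i + a < i + a + 1 by omega)]
    simp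
  rw [h0, ← Finset.sum_add_distrib]
  refine Finset.sum_congr rfl fun m _ => ?_
  rw [show i + 1 + a = (i + a) + 1 by ring, Nat.choose_succ_succ',
    show m + (j + 1) + a = m + j + a + 1 by ring]
  push_cast
  ring

theorem gAnd_rec (a i j : ℕ) :
    gAnd a (i + 1) (j + 1) = gAnd a (i + 1) j + 2 * gAnd a i (j + 1) - gAnd a i j := by
  have h1 := gAnd_sub a (i + 1) j
  have h2 := gAnd_sub a i j
  have h3 := hAnd_succ a i j
  linarith

/-- iterated difference of the columns -/
def sAnd (a : ℕ) : ℕ → ℕ → ℕ → ℚ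
  | 0, i, j => gAnd a i j
  | k + 1, i, j => sAnd a k i j - 2 * sAnd a k i (j + 1)

theorem sAnd_rec (a k i j : ℕ) :
    sAnd a k (i + 1) (j + 1) = sAnd a k (i + 1) j + 2 * sAnd a k i (j + 1) - sAnd a k i j := by
  induction k generalizing i j with
  | zero => exact gAnd_rec a i j
  | succ k ih =>
    simp only [sAnd]
    have h1 := ih i j
    have h2 := ih i (j + 1)
    linarith

theorem sAnd_zero (a k j : ℕ) : sAnd a k 0 j = (-1) ^ k := by
  induction k generalizing j with
  | zero => simp [sAnd, gAnd_zero_left]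
  | succ k ih => simp only [sAnd, ih]; ring

theorem sAnd_eq (a k i : ℕ) :
    sAnd a k i 0 = (-1) ^ k * 2 ^ i * ((a + k + i).choose i : ℚ) := by
  induction k generalizing i with
  | zero => simp [sAnd, gAnd_zero_right]
  | succ k ihk =>
    induction i with
    | zero => simp [sAnd_zero]
    | succ i ihi =>
      have h : sAnd a (k + 1) (i + 1) 0 = 2 * sAnd a (k + 1) i 0 - sAnd a k (i + 1) 0 := by
        have := sAnd_rec a k i 0
        simp only [sAnd]
        linarith
      rw [h, ihi, ihk, show a + (k + 1) + (i + 1) = (a + k + i + 1) + 1 by ring,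
        Nat.choose_succ_succ', show a + (k + 1) + i = a + k + i + 1 by ring,
        show a + k + (i + 1) = a + k + i + 1 by ring]
      push_cast
      ring

theorem sAnd_sum (a k i j N : ℕ) (h : k ≤ N) :
    ∑ l ∈ Finset.range (N + 1), gAnd a i (j + l) * ((k.choose l : ℚ) * (-2) ^ l)
      = sAnd a k i j := by
  induction k generalizing j N with
  | zero =>
    rw [Finset.sum_range_succ']
    simp [sAnd]
  | succ k ih =>
    obtain ⟨N, rfl⟩ : ∃ M, N = M + 1 := ⟨N - 1, by omega⟩
    have h1 := ih j (N + 1) (by omega)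
    have h2 := ih (j + 1) N (by omega)
    simp only [sAnd]
    rw [← h1, ← h2, Finset.sum_range_succ', Finset.sum_range_succ' (n := N + 1), Finset.mul_sum,
      add_sub_right_comm, ← Finset.sum_sub_distrib]
    congr 1
    · refine Finset.sum_congr rfl fun l _ => ?_
      rw [Nat.choose_succ_succ', show j + 1 + l = j + (l + 1) by ring]
      push_cast
      ring
    · simp

theorem sum_key (a k i N : ℕ) (h : k ≤ N) :
    ∑ l ∈ Finset.range (N + 1), gAnd a i l * ((k.choose l : ℚ) * (-2) ^ l)
      = (-1) ^ k * 2 ^ i * ((a + k + i).choose i : ℚ) := by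
  rw [← sAnd_eq, ← sAnd_sum a k i 0 N h]
  simp

theorem det_key {d : ℕ} (M : Matrix (Fin (d + 1)) (Fin (d + 1)) ℚ) (c : Fin (d + 1) → ℚ) (ρ : ℚ)
    (h : M.mulVec c = Pi.single (Fin.last d) ρ) :
    c (Fin.last d) * M.det = ρ * (M.submatrix Fin.castSucc Fin.castSucc).det := by
  have h1 : (M.updateCol (Fin.last d) (M.mulVec c)).det = c (Fin.last d) * M.det := by
    have := Matrix.det_updateCol_sum M (Fin.last d) c
    rw [smul_eq_mul] at this
    rw [← this]
    congr 2
    ext i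
    simp [Matrix.mulVec, dotProduct, mul_comm]
  rw [← h1, h, Matrix.det_succ_column _ (Fin.last d), Finset.sum_eq_single (Fin.last d)]
  · have e : (M.updateCol (Fin.last d) (Pi.single (Fin.last d) ρ)).submatrix
      (Fin.last d).succAbove (Fin.last d).succAbove = M.submatrix Fin.castSucc Fin.castSucc := by
      ext i j
      simp
    rw [e]
    simp
  · intro b _ hb
    simp [hb]
  · simp

theorem lag_sum (n m : ℕ) (y : ℕ → ℚ) (hy : Set.InjOn y (Finset.range (n + 1))) (hm : m ≤ n) :
    ∑ r ∈ Finset.range (n + 1), (∏ j ∈ (Finset.range (n + 1)).erase r, (y r - y j))⁻¹ * y r ^ m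
      = if m = n then 1 else 0 := by
  have h := Lagrange.coeff_eq_sum (s := Finset.range (n + 1)) (v := y) hy
    (P := (Polynomial.X : Polynomial ℚ) ^ m) (by
      rw [Polynomial.degree_X_pow, Finset.card_range]; exact_mod_cast Nat.lt_succ_of_le hm)
  simp only [Finset.card_range, Nat.add_sub_cancel, Polynomial.coeff_X_pow, Polynomial.eval_pow,
    Polynomial.eval_X] at h
  simp only [eq_comm (a := n) (b := m)] at h
  rw [h]
  refine Finset.sum_congr rfl fun r _ => ?_
  rw [div_eq_mul_inv, mul_comm]

/-- the coefficients of the kernel vector in the shifted power basis -/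
def qAnd (n ε : ℕ) (s : ℕ → ℚ) (r : ℕ) : ℚ :=
  (∏ j ∈ (Finset.range (n + 1)).erase r, (s r ^ 2 - s j ^ 2))⁻¹ * (s r ^ ε)⁻¹

theorem q_mono (n ε e : ℕ) (s : ℕ → ℚ) (hε : ε ≤ 1) (h0 : ∀ r, s r ≠ 0)
    (hy : Set.InjOn (fun r => s r ^ 2) (Finset.range (n + 1))) (he : e ≤ 2 * n + ε) :
    ∑ r ∈ Finset.range (n + 1), qAnd n ε s r * (s r ^ e + (-1) ^ ε * (-s r) ^ e)
      = if e = 2 * n + ε then 2 else 0 := by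
  rcases Nat.even_or_odd (e + ε) with hp | hp
  · obtain ⟨m, rfl⟩ : ∃ m, e = 2 * m + ε := by
      obtain ⟨t, ht⟩ := hp
      exact ⟨t - ε, by omega⟩
    have h := lag_sum n m (fun r => s r ^ 2) hy (by omega)
    have h2 : (2 * m + ε = 2 * n + ε) ↔ m = n := by omega
    simp only [h2]
    have : (if m = n then (2 : ℚ) else 0) = 2 * (if m = n then 1 else 0) := by split_ifs <;> simp
    rw [this, ← h, Finset.mul_sum]
    refine Finset.sum_congr rfl fun r _ => ?_
    have h3 := pow_ne_zero ε (h0 r)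
    have h4 : (-1 : ℚ) ^ ε * (-s r) ^ (2 * m + ε) = s r ^ (2 * m + ε) := by
      rw [neg_pow (s r), ← mul_assoc, ← pow_add, Even.neg_one_pow, one_mul]
      exact ⟨m + ε, by ring⟩
    rw [h4]
    simp only [qAnd]
    rw [pow_add, pow_mul]
    field_simp
    ring
  · rw [if_neg (by rintro rfl; obtain ⟨t, ht⟩ := hp; omega)]
    refine Finset.sum_eq_zero fun r _ => ?_
    have h4 : (-1 : ℚ) ^ ε * (-s r) ^ e = - s r ^ e := by
      rw [neg_pow (s r), ← mul_assoc, ← pow_add, Odd.neg_one_pow, neg_one_mul]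
      rwa [add_comm]
    rw [h4]
    ring

theorem q_poly (n ε : ℕ) (s : ℕ → ℚ) (hε : ε ≤ 1) (h0 : ∀ r, s r ≠ 0)
    (hy : Set.InjOn (fun r => s r ^ 2) (Finset.range (n + 1))) (h : Polynomial ℚ)
    (hd : h.natDegree ≤ 2 * n + ε) :
    ∑ r ∈ Finset.range (n + 1), qAnd n ε s r * (h.eval (s r) + (-1) ^ ε * h.eval (-s r))
      = 2 * h.coeff (2 * n + ε) := by
  have hx : ∀ x, h.eval x = ∑ e ∈ Finset.range (2 * n + ε + 1), h.coeff e * x ^ e := fun x =>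
    Polynomial.eval_eq_sum_range' (Nat.lt_succ_of_le hd) x
  simp only [hx]
  have : ∀ r, qAnd n ε s r * (∑ e ∈ Finset.range (2 * n + ε + 1), h.coeff e * s r ^ e
      + (-1) ^ ε * ∑ e ∈ Finset.range (2 * n + ε + 1), h.coeff e * (-s r) ^ e)
      = ∑ e ∈ Finset.range (2 * n + ε + 1),
        h.coeff e * (qAnd n ε s r * (s r ^ e + (-1) ^ ε * (-s r) ^ e)) := by
    intro r
    rw [Finset.mul_sum, ← Finset.sum_add_distrib, Finset.mul_sum]
    refine Finset.sum_congr rfl fun e _ => ?_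
    ring
  simp only [this]
  rw [Finset.sum_comm]
  simp only [← Finset.mul_sum]
  rw [Finset.sum_congr rfl fun e he => by
    rw [q_mono n ε e s hε h0 hy (by have := Finset.mem_range.1 he; omega)]]
  simp [mul_comm]

/-- the test polynomials -/
noncomputable def hPol (a i : ℕ) : Polynomial ℚ :=
  ∏ l ∈ Finset.range i, (Polynomial.X - Polynomial.C (((a : ℚ) + 1) / 2 + l))

theorem hPol_monic (a i : ℕ) : (hPol a i).Monic :=
  Polynomial.monic_prod_of_monic _ _ fun _ _ => Polynomial.monic_X_sub_C _

theorem hPol_natDegree (a i : ℕ) : (hPol a i).natDegree = i := by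
  unfold hPol
  rw [Polynomial.natDegree_prod_of_monic _ _ fun _ _ => Polynomial.monic_X_sub_C _]
  simp only [Polynomial.natDegree_X_sub_C, Finset.sum_const, Finset.card_range, smul_eq_mul,
    mul_one]

theorem hPol_eval_pos (a i k : ℕ) :
    (hPol a i).eval ((k : ℚ) + ((a : ℚ) + 1) / 2) = (i.factorial : ℚ) * (k.choose i : ℚ) := by
  have h : ((k.descFactorial i : ℕ) : ℚ) = (i.factorial : ℚ) * (k.choose i : ℚ) := by
    exact_mod_cast congrArg (Nat.cast (R := ℚ)) (Nat.descFactorial_eq_factorial_mul_choose k i)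
  rw [← h, ← descPochhammer_eval_eq_descFactorial, descPochhammer_eval_eq_prod_range, hPol,
    Polynomial.eval_prod]
  refine Finset.prod_congr rfl fun l _ => ?_
  simp
  ring

theorem hPol_eval_neg (a i k : ℕ) :
    (hPol a i).eval (-((k : ℚ) + ((a : ℚ) + 1) / 2))
      = (-1) ^ i * ((i.factorial : ℚ) * ((a + k + i).choose i : ℚ)) := by
  have h : (((a + k + 1).ascFactorial i : ℕ) : ℚ)
      = (i.factorial : ℚ) * ((a + k + i).choose i : ℚ) := by
    exact_mod_cast congrArg (Nat.cast (R := ℚ)) (Nat.ascFactorial_eq_factorial_mul_choose (a + k) i)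
  rw [← h, Nat.ascFactorial_eq_prod_range, hPol, Polynomial.eval_prod]
  have : (-1 : ℚ) ^ i = ∏ l ∈ Finset.range i, (-1 : ℚ) := by simp
  push_cast
  rw [this, ← Finset.prod_mul_distrib]
  refine Finset.prod_congr rfl fun l _ => ?_
  simp
  ring

/-- the nodes -/
def sNode (a ε r : ℕ) : ℚ := ((2 * r + ε : ℕ) : ℚ) + ((a : ℚ) + 1) / 2

theorem sNode_pos (a ε r : ℕ) : 0 < sNode a ε r := by unfold sNode; positivity

theorem sNode_inj (a ε : ℕ) (t : Set ℕ) : Set.InjOn (fun r => sNode a ε r ^ 2) t := by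
  intro x _ y _ h
  have h1 : sNode a ε x = sNode a ε y :=
    (pow_left_inj₀ (sNode_pos a ε x).le (sNode_pos a ε y).le two_ne_zero).1 h
  have h2 : ((2 * x + ε : ℕ) : ℚ) = ((2 * y + ε : ℕ) : ℚ) := by
    unfold sNode at h1; linarith
  have h3 : 2 * x + ε = 2 * y + ε := by exact_mod_cast h2
  omega

/-- the kernel vector -/
def cVec (a n ε j : ℕ) : ℚ :=
  ∑ r ∈ Finset.range (n + 1), qAnd n ε (sNode a ε) r * (((2 * r + ε).choose j : ℚ) * (-2) ^ j)

theorem cVec_eq (a n ε i : ℕ) (hε : ε ≤ 1) (hi : i ≤ 2 * n + ε) :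
    cVec a n ε i + ∑ j ∈ Finset.range (2 * n + ε + 1), gAnd a i j * cVec a n ε j
      = if i = 2 * n + ε then (-2) ^ i / (i.factorial : ℚ) * 2 else 0 := by
  have h1 : ∑ j ∈ Finset.range (2 * n + ε + 1), gAnd a i j * cVec a n ε j
      = ∑ r ∈ Finset.range (n + 1), qAnd n ε (sNode a ε) r *
        ((-1) ^ ε * 2 ^ i * ((a + (2 * r + ε) + i).choose i : ℚ)) := by
    simp only [cVec, Finset.mul_sum]
    rw [Finset.sum_comm]
    refine Finset.sum_congr rfl fun r hr => ?_
    have hk := sum_key a (2 * r + ε) i (2 * n + ε) (by have := Finset.mem_range.1 hr; omega)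
    rw [pow_add, pow_mul] at hk
    simp only [neg_one_sq, one_pow, one_mul] at hk
    rw [← hk, Finset.mul_sum]
    refine Finset.sum_congr rfl fun j _ => ?_
    ring
  have h2 := q_poly n ε (sNode a ε) hε (fun r => (sNode_pos a ε r).ne') (sNode_inj a ε _)
    (hPol a i) (by rw [hPol_natDegree]; exact hi)
  have h3 : (hPol a i).coeff (2 * n + ε) = if i = 2 * n + ε then 1 else 0 := by
    split_ifs with h
    · have := (hPol_monic a i).coeff_natDegree
      rwa [hPol_natDegree, show (hPol a i).coeff i = (hPol a i).coeff (2 * n + ε) by rw [← h]] at this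
    · exact Polynomial.coeff_eq_zero_of_natDegree_lt (by rw [hPol_natDegree]; omega)
  have hf : (i.factorial : ℚ) ≠ 0 := by exact_mod_cast i.factorial_ne_zero
  have h4 : (if i = 2 * n + ε then (-2) ^ i / (i.factorial : ℚ) * 2 else 0)
      = (-2) ^ i / (i.factorial : ℚ) * (2 * (hPol a i).coeff (2 * n + ε)) := by
    rw [h3]; split_ifs <;> simp
  rw [h4, ← h2, h1, cVec, ← Finset.sum_add_distrib, Finset.mul_sum]
  refine Finset.sum_congr rfl fun r _ => ?_
  rw [sNode, hPol_eval_pos, hPol_eval_neg, neg_pow (2 : ℚ)]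
  have h5 : (-1 : ℚ) ^ i * (-1) ^ i = 1 := by rw [← mul_pow]; simp
  field_simp
  linear_combination (-(qAnd n ε (sNode a ε) r * (-1) ^ ε * ((a + (2 * r + ε) + i).choose i : ℚ))) * h5

theorem DAnd_step (a n ε : ℕ) (hε : ε ≤ 1) :
    DAnd a (2 * n + ε + 1) = 2 / ((2 * n + ε).factorial : ℚ) * sNode a ε n ^ ε *
      (∏ j ∈ Finset.range n, (sNode a ε n ^ 2 - sNode a ε j ^ 2)) * DAnd a (2 * n + ε) := by
  set M : Matrix (Fin (2 * n + ε + 1)) (Fin (2 * n + ε + 1)) ℚ :=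
    Matrix.of fun i j => gAnd a i j + if i = j then 1 else 0 with hM
  have hmul : M.mulVec (fun j => cVec a n ε j)
      = Pi.single (Fin.last _) ((-2) ^ (2 * n + ε) / ((2 * n + ε).factorial : ℚ) * 2) := by
    ext i
    have h := cVec_eq a n ε i hε (by omega)
    rw [← Fin.sum_univ_eq_sum_range (fun j => gAnd a i j * cVec a n ε j)] at h
    simp only [Matrix.mulVec, dotProduct, hM, Matrix.of_apply, add_mul, Finset.sum_add_distrib,
      ite_mul, one_mul, zero_mul, Finset.sum_ite_eq, Finset.mem_univ, if_true]
    rw [add_comm, h]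
    by_cases hi : i = Fin.last _
    · subst hi; simp
    · have : (i : ℕ) ≠ 2 * n + ε := fun h => hi (Fin.ext h)
      simp [hi, this]
  have key := det_key M _ _ hmul
  have hsub : (M.submatrix Fin.castSucc Fin.castSucc).det = DAnd a (2 * n + ε) := by
    unfold DAnd
    congr 1
    ext i j
    simp [hM]
  have hD : M.det = DAnd a (2 * n + ε + 1) := rfl
  have hc : cVec a n ε (2 * n + ε) = qAnd n ε (sNode a ε) n * (-2) ^ (2 * n + ε) := by
    unfold cVec
    rw [Finset.sum_range_succ, Finset.sum_eq_zero]
    · simp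
    · intro r hr
      rw [Nat.choose_eq_zero_of_lt (by have := Finset.mem_range.1 hr; omega)]
      simp
  rw [hsub, hD] at key
  simp only [Fin.val_last] at key
  rw [hc] at key
  have he : (Finset.range (n + 1)).erase n = Finset.range n := by
    rw [Finset.range_add_one, Finset.erase_insert (by simp)]
  have hs : sNode a ε n ^ ε ≠ 0 := pow_ne_zero _ (sNode_pos a ε n).ne'
  have hP : ∏ j ∈ Finset.range n, (sNode a ε n ^ 2 - sNode a ε j ^ 2) ≠ 0 := by
    refine Finset.prod_ne_zero_iff.2 fun j hj h => ?_
    have := sNode_inj a ε Set.univ (Set.mem_univ n) (Set.mem_univ j) (sub_eq_zero.1 h)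
    have := Finset.mem_range.1 hj
    omega
  have h2 : (-2 : ℚ) ^ (2 * n + ε) ≠ 0 := pow_ne_zero _ (by norm_num)
  have hf : ((2 * n + ε).factorial : ℚ) ≠ 0 := by exact_mod_cast Nat.factorial_ne_zero _
  rw [qAnd, he] at key
  have key2 : DAnd a (2 * n + ε + 1) * (-2 : ℚ) ^ (2 * n + ε) =
    (2 / ((2 * n + ε).factorial : ℚ) * sNode a ε n ^ ε *
      (∏ j ∈ Finset.range n, (sNode a ε n ^ 2 - sNode a ε j ^ 2)) * DAnd a (2 * n + ε))
      * (-2 : ℚ) ^ (2 * n + ε) := by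
    generalize (∏ j ∈ Finset.range n, (sNode a ε n ^ 2 - sNode a ε j ^ 2)) = P at *
    generalize sNode a ε n ^ ε = S at *
    generalize (-2 : ℚ) ^ (2 * n + ε) = T at *
    field_simp at key ⊢
    linear_combination key
  exact mul_right_cancel₀ h2 key2

theorem prod_even (a n : ℕ) :
    (∏ j ∈ Finset.range n, (sNode a 0 n ^ 2 - sNode a 0 j ^ 2))
      = 2 ^ n * (n.factorial : ℚ) *
        ∏ k ∈ Finset.range n, (2 * ((n : ℚ) + ((k : ℚ) + 1)) + (a : ℚ) - 1) := by
  have h1 : (n.factorial : ℚ) = ∏ j ∈ Finset.range n, ((n : ℚ) - j) := by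
    rw [← descPochhammer_eval_eq_prod_range, descPochhammer_eval_eq_descFactorial,
      Nat.descFactorial_self]
  have h2 : (2 : ℚ) ^ n = ∏ j ∈ Finset.range n, (2 : ℚ) := by simp
  rw [h1, h2, ← Finset.prod_mul_distrib, ← Finset.prod_mul_distrib]
  refine Finset.prod_congr rfl fun j _ => ?_
  simp only [sNode]
  push_cast
  ring

theorem prod_odd (a n : ℕ) :
    sNode a 1 n * (∏ j ∈ Finset.range n, (sNode a 1 n ^ 2 - sNode a 1 j ^ 2))
      = 2 ^ n * (n.factorial : ℚ) / 2 *
        ∏ k ∈ Finset.range (n + 1), (2 * (((n + 1 : ℕ) : ℚ) + ((k : ℚ) + 1)) + (a : ℚ) - 1) := by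
  have h1 : (n.factorial : ℚ) = ∏ j ∈ Finset.range n, ((n : ℚ) - j) := by
    rw [← descPochhammer_eval_eq_prod_range, descPochhammer_eval_eq_descFactorial,
      Nat.descFactorial_self]
  have h2 : (2 : ℚ) ^ n = ∏ j ∈ Finset.range n, (2 : ℚ) := by simp
  have h3 : ∏ j ∈ Finset.range n, (sNode a 1 n ^ 2 - sNode a 1 j ^ 2)
      = 2 ^ n * (n.factorial : ℚ) *
        ∏ k ∈ Finset.range n, (2 * (((n + 1 : ℕ) : ℚ) + ((k : ℚ) + 1)) + (a : ℚ) - 1) := by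
    rw [h1, h2, ← Finset.prod_mul_distrib, ← Finset.prod_mul_distrib]
    refine Finset.prod_congr rfl fun j _ => ?_
    simp only [sNode]
    push_cast
    ring
  rw [h3, Finset.prod_range_succ, sNode]
  push_cast
  ring

theorem prod_den (n : ℕ) :
    (n.factorial : ℚ) * ∏ k ∈ Finset.range n, ((n : ℚ) + ((k : ℚ) + 1))
      = ((2 * n).factorial : ℚ) := by
  have h := Nat.factorial_mul_ascFactorial n n
  rw [Nat.ascFactorial_eq_prod_range, ← two_mul] at h
  rw [← h]
  push_cast
  congr 1
  refine Finset.prod_congr rfl fun j _ => ?_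
  ring

theorem DAnd_even (a n : ℕ) :
    DAnd a (2 * n + 1) = (2 ^ (n + 1) * ∏ k ∈ Finset.range n,
      (2 * ((n : ℚ) + ((k : ℚ) + 1)) + (a : ℚ) - 1) / ((n : ℚ) + ((k : ℚ) + 1))) *
      DAnd a (2 * n) := by
  have h := DAnd_step a n 0 (by norm_num)
  simp only [add_zero, pow_zero, mul_one] at h
  have hf : (n.factorial : ℚ) ≠ 0 := by exact_mod_cast Nat.factorial_ne_zero _
  have hp : ∏ k ∈ Finset.range n, ((n : ℚ) + ((k : ℚ) + 1)) ≠ 0 :=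
    Finset.prod_ne_zero_iff.2 fun k _ => by positivity
  rw [h, prod_even, ← prod_den, Finset.prod_div_distrib]
  field_simp
  ring

theorem DAnd_odd (a n : ℕ) :
    DAnd a (2 * (n + 1)) = (2 ^ (n + 1) * ∏ k ∈ Finset.range (n + 1),
      (2 * (((n + 1 : ℕ) : ℚ) + ((k : ℚ) + 1)) + (a : ℚ) - 1) /
        (((n + 1 : ℕ) : ℚ) + ((k : ℚ) + 1))) *
      DAnd a (2 * n + 1) := by
  have h := DAnd_step a n 1 le_rfl
  simp only [pow_one] at h
  have hf : (n.factorial : ℚ) ≠ 0 := by exact_mod_cast Nat.factorial_ne_zero _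
  have hp : ∏ k ∈ Finset.range (n + 1), (((n + 1 : ℕ) : ℚ) + ((k : ℚ) + 1)) ≠ 0 :=
    Finset.prod_ne_zero_iff.2 fun k _ => by positivity
  have hd := prod_den (n + 1)
  rw [show 2 * (n + 1) = (2 * n + 1) + 1 by ring, Nat.factorial_succ n,
    Nat.factorial_succ (2 * n + 1)] at hd
  have hd2 : ((2 * n + 1).factorial : ℚ) = (n.factorial : ℚ) / 2 *
      ∏ k ∈ Finset.range (n + 1), (((n + 1 : ℕ) : ℚ) + ((k : ℚ) + 1)) := by
    have hn : ((n : ℚ) + 1) ≠ 0 := by positivity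
    apply mul_left_cancel₀ hn
    generalize ∏ k ∈ Finset.range (n + 1), (((n + 1 : ℕ) : ℚ) + ((k : ℚ) + 1)) = P at *
    push_cast at hd
    linear_combination -hd / 2
  rw [show 2 * (n + 1) = 2 * n + 1 + 1 by ring, h, mul_assoc (2 / _) (sNode a 1 n), prod_odd, hd2,
    Finset.prod_div_distrib]
  generalize ∏ k ∈ Finset.range (n + 1), (((n + 1 : ℕ) : ℚ) + ((k : ℚ) + 1)) = P at *
  field_simp
  ring

theorem fac_ne (a n m : ℕ) : ∏ k ∈ Finset.range m,
      (2 * ((n : ℚ) + ((k : ℚ) + 1)) + (a : ℚ) - 1) / ((n : ℚ) + ((k : ℚ) + 1)) ≠ 0 := by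
  refine Finset.prod_ne_zero_iff.2 fun k _ => ?_
  have : (0 : ℚ) < 2 * ((n : ℚ) + ((k : ℚ) + 1)) + (a : ℚ) - 1 := by
    have h1 : (0 : ℚ) ≤ n := by positivity
    have h2 : (0 : ℚ) ≤ k := by positivity
    have h3 : (0 : ℚ) ≤ a := by positivity
    linarith
  exact (div_pos this (by positivity)).ne'

theorem DAnd_ne (a n : ℕ) : DAnd a (2 * n) ≠ 0 ∧ DAnd a (2 * n + 1) ≠ 0 := by
  have step : ∀ n, DAnd a (2 * n) ≠ 0 → DAnd a (2 * n + 1) ≠ 0 := by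
    intro n h
    rw [DAnd_even]
    exact mul_ne_zero (mul_ne_zero (by positivity) (fac_ne a n n)) h
  induction n with
  | zero =>
    have h0 : DAnd a (2 * 0) ≠ 0 := by simp [DAnd]
    exact ⟨h0, step 0 h0⟩
  | succ n ih =>
    have h0 : DAnd a (2 * (n + 1)) ≠ 0 := by
      rw [DAnd_odd]
      exact mul_ne_zero (mul_ne_zero (by positivity) (fac_ne a (n + 1) (n + 1))) ih.2
    exact ⟨h0, step _ h0⟩

/-- Andrews' determinant evaluation: for `a ≥ 0`,
`D_{2n}(a)/D_{2n-1}(a) = 2^n ∏_{k=1}^{n} (2(n+k)+a-1)/(n+k)`,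
`D_{2n+1}(a)/D_{2n}(a) = 2^{n+1} ∏_{k=1}^{n} (2(n+k)+a-1)/(n+k)`, and `D_1(a) = 2`. -/
theorem andrews_determinant_evaluation (a : ℕ) :
    (∀ n : ℕ, 1 ≤ n →
        DAnd a (2 * n) / DAnd a (2 * n - 1) =
          2 ^ n * ∏ k ∈ Finset.range n,
            (2 * ((n : ℚ) + ((k : ℚ) + 1)) + (a : ℚ) - 1) / ((n : ℚ) + ((k : ℚ) + 1))) ∧
    (∀ n : ℕ,
        DAnd a (2 * n + 1) / DAnd a (2 * n) =
          2 ^ (n + 1) * ∏ k ∈ Finset.range n,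
            (2 * ((n : ℚ) + ((k : ℚ) + 1)) + (a : ℚ) - 1) / ((n : ℚ) + ((k : ℚ) + 1))) ∧
    DAnd a 1 = 2 := by
  refine ⟨fun n hn => ?_, fun n => ?_, ?_⟩
  · obtain ⟨n, rfl⟩ : ∃ m, n = m + 1 := ⟨n - 1, by omega⟩
    rw [DAnd_odd, show 2 * (n + 1) - 1 = 2 * n + 1 by omega, mul_div_assoc,
      div_self (DAnd_ne a n).2, mul_one]
  · rw [DAnd_even, mul_div_assoc, div_self (DAnd_ne a n).1, mul_one]
  · have := DAnd_even a 0
    simpa [DAnd] using this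
end
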